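/- arXiv:2409.19353 — 2 statements merged into one kernel-verified Lean document; each statement's English description precedes it below -/
import Mathlib

section
/- Let n ≥ 2, let x₀ ∈ ℝⁿ, R > 0, and let B = B(x₀,R) be the open ball with boundary sphere ∂B. Let 1 ≤ p < ∞, 1 ≤ q < ∞, 1 ≤ r < ∞ satisfy q(n−2p) < np and q(n−1) < nr, and assume additionally that p > 1 whenever n = 2 and q > 1. Then there exists a constant δ > 0, depending only on n, p, q, r, R, such that the following holds: for every f : ℝⁿ → ℂ that is continuous on cl(B) and twice continuously differentiable on B, and every continuous function g on cl(B) satisfying g(x) = Δf(x) = ∑ᵢ₌₁ⁿ ∂²f/∂xᵢ²(x) for all x ∈ B, one has δ·‖f‖_{L^q(B)} ≤ ‖g‖_{L^p(B)} + ‖f‖_{L^r(∂B)}. (The Euclidean-ball case of Theorem 1.3.) -/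
open Metric MeasureTheory

/-- The Euclidean Laplacian of a complex-valued function on `ℝⁿ`. -/
noncomputable def laplacianC (n : ℕ) (f : EuclideanSpace ℝ (Fin n) → ℂ)
    (x : EuclideanSpace ℝ (Fin n)) : ℂ :=
  ∑ i : Fin n,
    fderiv ℝ (fun y => fderiv ℝ f y (EuclideanSpace.single i 1)) x (EuclideanSpace.single i 1)

open scoped ENNReal Pointwise

theorem lsi_riesz {X : Type*} [PseudoMetricSpace X] [MeasurableSpace X] [OpensMeasurableSpace X]
    (μ : Measure X) [IsFiniteMeasure μ] (d C a : ℝ) (ha : 0 ≤ a) (had : a < d) (hC : 0 ≤ C)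
    (h : ∀ (x : X) (r : ℝ), 0 < r → μ (closedBall x r) ≤ ENNReal.ofReal (C * r ^ d)) :
    ∃ M : ℝ≥0∞, M ≠ ∞ ∧ ∀ x, ∫⁻ y, (edist x y) ^ (-a) ∂μ ≤ M := by
  set t : ℝ := 2⁻¹ with ht
  have ht0 : 0 < t := by norm_num [ht]
  have ht1 : t < 1 := by norm_num [ht]
  refine ⟨μ Set.univ + ∑' k : ℕ, ENNReal.ofReal (t ^ (-a) * C) * (ENNReal.ofReal (t ^ (d - a))) ^ k,
    ?_, ?_⟩
  · rw [ENNReal.tsum_mul_left, ENNReal.tsum_geometric]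
    have h1 : ENNReal.ofReal (t ^ (d - a)) < 1 := by
      rw [ENNReal.ofReal_lt_one]
      exact Real.rpow_lt_one ht0.le ht1 (by linarith)
    refine ENNReal.add_ne_top.2 ⟨measure_ne_top _ _, ENNReal.mul_ne_top ENNReal.ofReal_ne_top ?_⟩
    rw [ENNReal.inv_ne_top]
    exact (tsub_pos_of_lt h1).ne'
  · intro x
    have hpt : ∀ y, (edist x y) ^ (-a) ≤ 1 + ∑' k : ℕ, ENNReal.ofReal ((t ^ (k + 1)) ^ (-a)) *
        (closedBall x (t ^ k)).indicator (fun _ => (1 : ℝ≥0∞)) y := by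
      intro y
      rcases lt_or_ge 1 (dist x y) with h1 | h1
      · refine le_trans ?_ le_self_add
        rw [ENNReal.rpow_neg, ENNReal.inv_le_one, edist_dist]
        have h2 : (1 : ℝ≥0∞) ≤ ENNReal.ofReal (dist x y) := by
          rw [← ENNReal.ofReal_one]; exact ENNReal.ofReal_le_ofReal h1.le
        calc (1 : ℝ≥0∞) = 1 ^ a := (ENNReal.one_rpow a).symm
          _ ≤ _ := ENNReal.rpow_le_rpow h2 ha
      · rcases eq_or_lt_of_le (dist_nonneg (x := x) (y := y)) with h0 | h0
        · have : ∑' k : ℕ, ENNReal.ofReal ((t ^ (k + 1)) ^ (-a)) *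
            (closedBall x (t ^ k)).indicator (fun _ => (1 : ℝ≥0∞)) y = ∞ := by
            rw [eq_top_iff, ← ENNReal.tsum_const_eq_top_of_ne_zero (α := ℕ) one_ne_zero]
            refine ENNReal.tsum_le_tsum fun k => ?_
            rw [Set.indicator_of_mem, mul_one, ← ENNReal.ofReal_one]
            · refine ENNReal.ofReal_le_ofReal ?_
              exact Real.one_le_rpow_of_pos_of_le_one_of_nonpos (by positivity)
                (pow_le_one₀ ht0.le ht1.le) (by linarith)
            · rw [mem_closedBall', ← h0]; positivity
          rw [this]; simp
        · obtain ⟨k, hk1, hk2⟩ := exists_nat_pow_near_of_lt_one h0 h1 ht0 ht1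
          refine le_trans ?_ le_add_self
          refine le_trans ?_ (ENNReal.le_tsum k)
          rw [Set.indicator_of_mem (by rw [mem_closedBall']; exact hk2), mul_one, edist_dist,
            ENNReal.ofReal_rpow_of_pos h0]
          refine ENNReal.ofReal_le_ofReal ?_
          exact Real.rpow_le_rpow_of_nonpos (by positivity) hk1.le (by linarith)
    refine (lintegral_mono hpt).trans ?_
    rw [lintegral_add_left measurable_const, lintegral_one, lintegral_tsum]
    · gcongr with k
      rw [lintegral_const_mul _ (measurable_const.indicator measurableSet_closedBall),
        lintegral_indicator measurableSet_closedBall, setLIntegral_one]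
      refine (mul_le_mul_right (h x (t ^ k) (by positivity)) _).trans (le_of_eq ?_)
      rw [← ENNReal.ofReal_pow (by positivity), ← ENNReal.ofReal_mul (by positivity),
        ← ENNReal.ofReal_mul (by positivity)]
      congr 1
      rw [← Real.rpow_natCast, ← Real.rpow_natCast, ← Real.rpow_natCast, ← Real.rpow_mul ht0.le,
        ← Real.rpow_mul ht0.le, ← Real.rpow_mul ht0.le]
      have : t ^ ((↑(k + 1) : ℝ) * -a) * (C * t ^ ((k:ℝ) * d)) =
        C * (t ^ ((↑(k + 1) : ℝ) * -a) * t ^ ((k:ℝ) * d)) := by ring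
      rw [this, ← Real.rpow_add ht0]
      have : t ^ (-a) * C * t ^ ((d - a) * k) = C * (t ^ (-a) * t ^ ((d - a) * k)) := by ring
      rw [this, ← Real.rpow_add ht0]
      congr 2
      push_cast; ring
    · intro k
      exact ((measurable_const.indicator measurableSet_closedBall).const_mul _).aemeasurable

/-- Young-type inequality, `p ≤ q`. -/
theorem lsi_young_aux {X : Type*} [PseudoMetricSpace X] [SecondCountableTopology X]
    [MeasurableSpace X] [BorelSpace X]
    (μ ν : Measure X) [IsFiniteMeasure μ] [IsFiniteMeasure ν] (d e C κ p q : ℝ) (hC : 0 ≤ C)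
    (hd : 0 < d) (he : 0 < e)
    (hμ : ∀ (x : X) (r : ℝ), 0 < r → μ (closedBall x r) ≤ ENNReal.ofReal (C * r ^ d))
    (hν : ∀ (x : X) (r : ℝ), 0 < r → ν (closedBall x r) ≤ ENNReal.ofReal (C * r ^ e))
    (hp : 1 ≤ p) (hpq : p ≤ q) (hκ0 : 0 ≤ κ) (hκ : κ < e * (1 - 1 / p) + d / q) :
    ∃ M : ℝ≥0∞, M ≠ ∞ ∧ ∀ F : X → ℝ≥0∞, AEMeasurable F ν →
      ∫⁻ x, (∫⁻ y, (edist x y) ^ (-κ) * F y ∂ν) ^ q ∂μ ≤ M * (∫⁻ y, F y ^ p ∂ν) ^ (q / p) := by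
  have hp0 : 0 < p := by linarith
  have hq0 : 0 < q := by linarith
  have hp1 : 0 ≤ 1 - 1 / p := by
    rw [sub_nonneg, div_le_one hp0]; exact hp
  set σ := e * (1 - 1 / p) + d / q with hσ
  have hσ0 : 0 < σ := lt_of_le_of_lt hκ0 hκ
  set l := κ / σ with hl
  have hl0 : 0 ≤ l := by positivity
  have hl1 : l < 1 := (div_lt_one hσ0).2 hκ
  set a := l * e
  set c := l * d * p / q
  have ha0 : 0 ≤ a := by positivity
  have hc0 : 0 ≤ c := by positivity
  have hsum : a * (1 - 1 / p) + c * (1 / p) = κ := by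
    have : a * (1 - 1 / p) + c * (1 / p) = l * σ := by
      simp only [a, c, hσ]; field_simp
    rw [this, hl]; field_simp
  obtain ⟨M₁, hM₁, h₁⟩ := lsi_riesz ν e C a ha0 (by nlinarith) hC hν
  obtain ⟨M₂, hM₂, h₂⟩ := lsi_riesz μ d C (c * (q / p)) (by positivity) (by
    have : c * (q / p) = l * d := by simp only [c]; field_simp
    rw [this]; nlinarith) hC hμ
  refine ⟨M₁ ^ ((1 - 1 / p) * q) * M₂, ENNReal.mul_ne_top
    (ENNReal.rpow_ne_top_of_nonneg (by positivity) hM₁) hM₂, fun F hF => ?_⟩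
  have hmeas : ∀ (b : ℝ) (x : X), Measurable fun y => (edist x y) ^ b := fun b x =>
    (measurable_edist_right).pow_const b
  have hm : 1 ≤ q / p := (one_le_div hp0).2 hpq
  have hm1 : 0 ≤ 1 - 1 / (q / p) := by
    rw [sub_nonneg, div_le_one (by positivity)]; exact hm
  have hpt : ∀ x, (∫⁻ y, (edist x y) ^ (-κ) * F y ∂ν) ^ q ≤
      M₁ ^ ((1 - 1 / p) * q) * ((∫⁻ y, F y ^ p ∂ν) ^ (q / p - 1) *
        ∫⁻ y, (edist x y) ^ (-(c * (q / p))) * F y ^ p ∂ν) := by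
    intro x
    have e1 : ∫⁻ y, (edist x y) ^ (-κ) * F y ∂ν ≤
        (∫⁻ y, (edist x y) ^ (-a) ∂ν) ^ (1 - 1 / p) *
        (∫⁻ y, (edist x y) ^ (-c) * F y ^ p ∂ν) ^ (1 / p) := by
      refine le_trans (le_of_eq (lintegral_congr fun y => ?_))
        (ENNReal.lintegral_mul_norm_pow_le (hmeas _ _).aemeasurable
          ((hmeas _ _).aemeasurable.mul (hF.pow_const p)) hp1 (by positivity) (by ring))
      rw [Pi.mul_apply, ENNReal.mul_rpow_of_nonneg _ _ (by positivity), ← ENNReal.rpow_mul, ← ENNReal.rpow_mul,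
        ← ENNReal.rpow_mul, mul_one_div_cancel hp0.ne', ENNReal.rpow_one, ← mul_assoc]
      congr 1
      rw [neg_mul, neg_mul, ENNReal.rpow_neg, ENNReal.rpow_neg, ENNReal.rpow_neg,
        ← ENNReal.inv_rpow, ← ENNReal.inv_rpow, ← ENNReal.inv_rpow,
        ← ENNReal.rpow_add_of_nonneg _ _ (by positivity) (by positivity), hsum]
    have e2 : ∫⁻ y, (edist x y) ^ (-c) * F y ^ p ∂ν ≤
        (∫⁻ y, F y ^ p ∂ν) ^ (1 - 1 / (q / p)) *
        (∫⁻ y, (edist x y) ^ (-(c * (q / p))) * F y ^ p ∂ν) ^ (1 / (q / p)) := by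
      refine le_trans (le_of_eq (lintegral_congr fun y => ?_))
        (ENNReal.lintegral_mul_norm_pow_le (hF.pow_const p)
          ((hmeas _ _).aemeasurable.mul (hF.pow_const p)) hm1 (by positivity) (by ring))
      rw [Pi.mul_apply, ENNReal.mul_rpow_of_nonneg _ _ (by positivity),
        mul_left_comm, ← ENNReal.rpow_add_of_nonneg _ _ hm1 (by positivity)]
      rw [sub_add_cancel, ENNReal.rpow_one, ← ENNReal.rpow_mul]
      congr 2
      field_simp
    calc (∫⁻ y, (edist x y) ^ (-κ) * F y ∂ν) ^ q
        ≤ (M₁ ^ (1 - 1 / p) * ((∫⁻ y, F y ^ p ∂ν) ^ (1 - 1 / (q / p)) *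
        (∫⁻ y, (edist x y) ^ (-(c * (q / p))) * F y ^ p ∂ν) ^ (1 / (q / p))) ^ (1 / p)) ^ q := by
          gcongr
          refine e1.trans ?_
          gcongr
          exact h₁ x
      _ = _ := by
          rw [ENNReal.mul_rpow_of_nonneg _ _ hq0.le, ← ENNReal.rpow_mul, ← ENNReal.rpow_mul,
            ENNReal.mul_rpow_of_nonneg _ _ (by positivity), ← ENNReal.rpow_mul,
            ← ENNReal.rpow_mul]
          congr 2
          · congr 1; field_simp
          · rw [show 1 / (q / p) * (1 / p * q) = 1 by field_simp, ENNReal.rpow_one]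
  refine (lintegral_mono hpt).trans ?_
  have hprod : AEMeasurable (fun z : X × X => (edist z.1 z.2) ^ (-(c * (q / p))) * F z.2 ^ p)
      (μ.prod ν) := by
    refine AEMeasurable.mul ?_ ?_
    · exact (measurable_edist.pow_const _).aemeasurable
    · exact (hF.pow_const p).comp_snd
  rw [lintegral_const_mul'' _ (by exact (hprod.lintegral_prod_right').const_mul _),
    lintegral_const_mul'' _ (by exact hprod.lintegral_prod_right'), lintegral_lintegral_swap hprod]
  rw [mul_assoc]
  refine mul_le_mul_right ?_ _
  calc _ ≤ (∫⁻ y, F y ^ p ∂ν) ^ (q / p - 1) * ∫⁻ y, M₂ * F y ^ p ∂ν := by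
        refine mul_le_mul_right (lintegral_mono fun y => ?_) _
        rw [lintegral_mul_const'' _ (by
          exact ((measurable_edist_left).pow_const _).aemeasurable)]
        refine mul_le_mul_left ?_ _
        simpa only [edist_comm] using h₂ y
    _ = _ := by
        rw [lintegral_const_mul'' _ (hF.pow_const p), mul_left_comm]
        congr 1
        nth_rewrite 2 [← ENNReal.rpow_one (∫⁻ y, F y ^ p ∂ν)]
        rw [← ENNReal.rpow_add_of_nonneg _ _ (by linarith) zero_le_one]
        congr 1; ring

theorem lsi_young {X : Type*} [PseudoMetricSpace X] [SecondCountableTopology X]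
    [MeasurableSpace X] [BorelSpace X]
    (μ ν : Measure X) [IsFiniteMeasure μ] [IsFiniteMeasure ν] (d e C κ p q : ℝ) (hC : 0 ≤ C)
    (hd : 0 < d) (he : 0 < e)
    (hμ : ∀ (x : X) (r : ℝ), 0 < r → μ (closedBall x r) ≤ ENNReal.ofReal (C * r ^ d))
    (hν : ∀ (x : X) (r : ℝ), 0 < r → ν (closedBall x r) ≤ ENNReal.ofReal (C * r ^ e))
    (hp : 1 ≤ p) (hq : 1 ≤ q) (hκ0 : 0 ≤ κ) (hκ : κ < e * (1 - 1 / p) + d / max p q) :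
    ∃ M : ℝ≥0∞, M ≠ ∞ ∧ ∀ F : X → ℝ≥0∞, AEMeasurable F ν →
      (∫⁻ x, (∫⁻ y, (edist x y) ^ (-κ) * F y ∂ν) ^ q ∂μ) ^ (1 / q)
        ≤ M * (∫⁻ y, F y ^ p ∂ν) ^ (1 / p) := by
  have hp0 : 0 < p := by linarith
  have hq0 : 0 < q := by linarith
  set m := max p q with hm
  have hm0 : 0 < m := lt_max_of_lt_left hp0
  obtain ⟨M, hM, h⟩ := lsi_young_aux μ ν d e C κ p m hC hd he hμ hν hp (le_max_left _ _) hκ0 hκ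
  have hqm : q ≤ m := le_max_right _ _
  have h1m : 0 ≤ 1 / q - 1 / m := sub_nonneg.2 (one_div_le_one_div_of_le hq0 hqm)
  refine ⟨μ Set.univ ^ (1 / q - 1 / m) * M ^ (1 / m), ENNReal.mul_ne_top
    (ENNReal.rpow_ne_top_of_nonneg h1m (measure_ne_top _ _))
    (ENNReal.rpow_ne_top_of_nonneg (by positivity) hM), fun F hF => ?_⟩
  have hmeas : AEMeasurable (fun x => ∫⁻ y, (edist x y) ^ (-κ) * F y ∂ν) μ := by
    have hprod : AEMeasurable (fun z : X × X => (edist z.1 z.2) ^ (-κ) * F z.2)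
      (μ.prod ν) := AEMeasurable.mul (measurable_edist.pow_const _).aemeasurable hF.comp_snd
    exact hprod.lintegral_prod_right'
  set U := fun x => ∫⁻ y, (edist x y) ^ (-κ) * F y ∂ν
  have e1 : ∫⁻ x, U x ^ q ∂μ ≤ (μ Set.univ) ^ (1 - q / m) * (∫⁻ x, U x ^ m ∂μ) ^ (q / m) := by
    have := ENNReal.lintegral_mul_norm_pow_le (μ := μ) (f := fun _ => 1) (g := fun x => U x ^ m)
      measurable_const.aemeasurable (hmeas.pow_const m) (p := 1 - q / m) (q := q / m)
      (by rw [sub_nonneg, div_le_one hm0]; exact hqm) (by positivity) (by ring)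
    simp only [ENNReal.one_rpow, one_mul, lintegral_one] at this
    refine le_trans (le_of_eq (lintegral_congr fun x => ?_)) this
    rw [← ENNReal.rpow_mul]; congr 1; field_simp
  calc (∫⁻ x, U x ^ q ∂μ) ^ (1 / q)
      ≤ ((μ Set.univ) ^ (1 - q / m) * (M * (∫⁻ y, F y ^ p ∂ν) ^ (m / p)) ^ (q / m)) ^ (1 / q) := by
        gcongr
        refine e1.trans ?_
        gcongr
        exact h F hF
    _ = _ := by
        rw [ENNReal.mul_rpow_of_nonneg _ _ (by positivity), ← ENNReal.rpow_mul,
          ← ENNReal.rpow_mul, ENNReal.mul_rpow_of_nonneg _ _ (by positivity), ← ENNReal.rpow_mul,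
          ← mul_assoc]
        congr 2
        · congr 1; field_simp
        · congr 1; field_simp
        · field_simp

/-- The surface measure on the unit sphere, as a measure on the ambient space. -/
noncomputable def lsiSphere (n : ℕ) : Measure (EuclideanSpace ℝ (Fin n)) :=
  Measure.map Subtype.val (volume : Measure (EuclideanSpace ℝ (Fin n))).toSphere

instance lsiSphere_finite (n : ℕ) : IsFiniteMeasure (lsiSphere n) := by
  unfold lsiSphere; infer_instance

theorem lsiSphere_closedBall (n : ℕ) (hn : 2 ≤ n) : ∃ C : ℝ, 0 ≤ C ∧
    ∀ (x : EuclideanSpace ℝ (Fin n)) (r : ℝ), 0 < r →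
      lsiSphere n (closedBall x r) ≤ ENNReal.ofReal (C * r ^ ((n : ℝ) - 1)) := by
  have hn1 : (0 : ℝ) < (n : ℝ) - 1 := by
    have : (2 : ℝ) ≤ n := by exact_mod_cast hn
    linarith
  set V := (volume (ball (0 : EuclideanSpace ℝ (Fin n)) 1)).toReal with hV
  have hVf : volume (ball (0 : EuclideanSpace ℝ (Fin n)) 1) = ENNReal.ofReal V := by
    rw [hV, ENNReal.ofReal_toReal measure_ball_lt_top.ne]
  have hV0 : 0 ≤ V := ENNReal.toReal_nonneg
  set T := (lsiSphere n Set.univ).toReal with hT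
  have hT0 : 0 ≤ T := ENNReal.toReal_nonneg
  refine ⟨T + n * (2 * 3 ^ n * V), by positivity, fun x r hr => ?_⟩
  rcases le_or_gt 1 r with h1 | h1
  · calc lsiSphere n (closedBall x r) ≤ lsiSphere n Set.univ := measure_mono (Set.subset_univ _)
      _ = ENNReal.ofReal T := by rw [hT, ENNReal.ofReal_toReal (measure_ne_top _ _)]
      _ ≤ _ := by
        refine ENNReal.ofReal_le_ofReal ?_
        have : 1 ≤ r ^ ((n : ℝ) - 1) := Real.one_le_rpow h1 hn1.le
        have h3 : 0 ≤ n * (2 * 3 ^ n * V) := by positivity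
        nlinarith
  · rw [lsiSphere, Measure.map_apply measurable_subtype_coe measurableSet_closedBall,
      Measure.toSphere_apply' _ (measurable_subtype_coe measurableSet_closedBall)]
    set N := ⌊1 / r⌋₊ + 1 with hN
    have hsub : Set.Ioo (0 : ℝ) 1 • ((↑) '' ((↑) ⁻¹' closedBall x r :
        Set (sphere (0 : EuclideanSpace ℝ (Fin n)) 1)) : Set (EuclideanSpace ℝ (Fin n))) ⊆
        ⋃ j ∈ Finset.range N, closedBall (((j : ℝ) * r) • x) (3 * r) := by
      rintro _ ⟨t, ⟨ht0, ht1⟩, _, ⟨w, hw, rfl⟩, rfl⟩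
      have hw1 : ‖(w : EuclideanSpace ℝ (Fin n))‖ = 1 := by simpa using w.2
      have hwx : ‖(w : EuclideanSpace ℝ (Fin n)) - x‖ ≤ r := by
        simpa [dist_eq_norm] using hw
      have hx2 : ‖x‖ ≤ 2 := by
        have := norm_sub_norm_le x (w : EuclideanSpace ℝ (Fin n))
        rw [norm_sub_rev] at this
        linarith
      simp only [Set.mem_iUnion, Finset.mem_range, exists_prop]
      refine ⟨⌊t / r⌋₊, ?_, ?_⟩
      · rw [hN, Nat.lt_succ_iff]
        exact Nat.floor_le_floor (by gcongr)
      · have f1 : (⌊t / r⌋₊ : ℝ) * r ≤ t := by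
          have := Nat.floor_le (div_nonneg ht0.le hr.le)
          rwa [le_div_iff₀ hr] at this
        have f2 : t < (⌊t / r⌋₊ : ℝ) * r + r := by
          have := Nat.lt_floor_add_one (t / r)
          rw [div_lt_iff₀ hr] at this
          linarith
        rw [mem_closedBall, dist_eq_norm]
        have : t • (w : EuclideanSpace ℝ (Fin n)) - ((⌊t / r⌋₊ : ℝ) * r) • x =
          t • ((w : EuclideanSpace ℝ (Fin n)) - x) + (t - (⌊t / r⌋₊ : ℝ) * r) • x := by
          rw [smul_sub, sub_smul]; abel
        show ‖t • (w : EuclideanSpace ℝ (Fin n)) - ((⌊t / r⌋₊ : ℝ) * r) • x‖ ≤ 3 * r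
        rw [this]
        refine (norm_add_le _ _).trans ?_
        rw [norm_smul, norm_smul, Real.norm_of_nonneg ht0.le, Real.norm_of_nonneg (by linarith)]
        have g1 : t * ‖(w : EuclideanSpace ℝ (Fin n)) - x‖ ≤ 1 * r :=
          mul_le_mul ht1.le hwx (norm_nonneg _) zero_le_one
        have g2 : (t - (⌊t / r⌋₊ : ℝ) * r) * ‖x‖ ≤ r * 2 :=
          mul_le_mul (by linarith) hx2 (norm_nonneg _) hr.le
        linarith
    have hvol : volume (⋃ j ∈ Finset.range N, closedBall (((j : ℝ) * r) • x) (3 * r)) ≤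
        ENNReal.ofReal ((2 / r) * ((3 * r) ^ n * V)) := by
      refine (measure_biUnion_finset_le _ _).trans ?_
      simp only [Measure.addHaar_closedBall volume _ (by positivity : 0 ≤ 3 * r), finrank_euclideanSpace,
        Fintype.card_fin, hVf]
      rw [Finset.sum_const, Finset.card_range, nsmul_eq_mul, ← ENNReal.ofReal_mul (by positivity),
        ← ENNReal.ofReal_natCast, ← ENNReal.ofReal_mul (by positivity)]
      refine ENNReal.ofReal_le_ofReal (mul_le_mul_of_nonneg_right ?_ (by positivity))
      have : (⌊1 / r⌋₊ : ℝ) ≤ 1 / r := Nat.floor_le (by positivity)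
      have h2 : 1 ≤ 1 / r := by rw [le_div_iff₀ hr]; linarith
      rw [hN]; push_cast
      have : 2 / r = 1 / r + 1 / r := by ring
      linarith
    refine (mul_le_mul_right ((measure_mono hsub).trans hvol) _).trans ?_
    rw [finrank_euclideanSpace, Fintype.card_fin, ← ENNReal.ofReal_natCast,
      ← ENNReal.ofReal_mul (by positivity)]
    refine ENNReal.ofReal_le_ofReal ?_
    have hr1 : r ^ n = r * r ^ ((n : ℝ) - 1) := by
      rw [Real.rpow_sub_one hr.ne', Real.rpow_natCast]; field_simp
    have hp : 0 ≤ r ^ ((n : ℝ) - 1) := by positivity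
    calc (n : ℝ) * (2 / r * ((3 * r) ^ n * V)) = n * (2 * 3 ^ n * V) * r ^ ((n : ℝ) - 1) := by
          rw [mul_pow, hr1]; field_simp
      _ ≤ _ := by
        apply mul_le_mul_of_nonneg_right _ hp
        linarith

theorem lsiSphere_le_hausdorff (n : ℕ) (hn : 2 ≤ n) (x₀ : EuclideanSpace ℝ (Fin n)) (R : ℝ)
    (hR : 0 < R) : ∃ C : ℝ≥0∞, C ≠ ∞ ∧ 
    Measure.map (fun w => x₀ + R • w) (lsiSphere n) ≤ C • μH[(n : ℝ) - 1] := by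
  have hn1 : (0 : ℝ) < (n : ℝ) - 1 := by
    have : (2 : ℝ) ≤ n := by exact_mod_cast hn
    linarith
  obtain ⟨C, hC, h⟩ := lsiSphere_closedBall n hn
  set D : ℝ := (C + 1) * (1 / R) ^ ((n : ℝ) - 1) with hD
  have hD0 : 0 < D := by positivity
  have hcont : Measurable (fun w : EuclideanSpace ℝ (Fin n) => x₀ + R • w) := by fun_prop
  set μ := Measure.map (fun w => x₀ + R • w) (lsiSphere n) with hμ
  have hb : ∀ (y : EuclideanSpace ℝ (Fin n)) (r : ℝ), 0 < r →
      μ (closedBall y r) ≤ ENNReal.ofReal D * (ENNReal.ofReal r) ^ ((n : ℝ) - 1) := by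
    intro y r hr
    rw [hμ, Measure.map_apply hcont measurableSet_closedBall]
    have hs : (fun w : EuclideanSpace ℝ (Fin n) => x₀ + R • w) ⁻¹' closedBall y r ⊆
        closedBall (R⁻¹ • (y - x₀)) (1 / R * r) := by
      intro w hw
      simp only [Set.mem_preimage, mem_closedBall, dist_eq_norm] at hw ⊢
      have : w - R⁻¹ • (y - x₀) = R⁻¹ • (x₀ + R • w - y) := by
        rw [smul_sub, smul_sub, smul_add, smul_smul, inv_mul_cancel₀ hR.ne', one_smul]; abel
      rw [this, norm_smul, norm_inv, Real.norm_of_nonneg hR.le, one_div]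
      gcongr
    refine (measure_mono hs).trans ((h _ _ (by positivity)).trans ?_)
    rw [ENNReal.ofReal_rpow_of_pos hr, ← ENNReal.ofReal_mul hD0.le]
    refine ENNReal.ofReal_le_ofReal ?_
    rw [Real.mul_rpow (by positivity) hr.le, hD, ← mul_assoc]
    gcongr
    linarith
  refine ⟨ENNReal.ofReal D, ENNReal.ofReal_ne_top, ?_⟩
  have hDne : ENNReal.ofReal D ≠ 0 := by simpa using hD0
  have key : (ENNReal.ofReal D)⁻¹ • μ ≤ μH[(n : ℝ) - 1] := by
    refine Measure.le_hausdorffMeasure _ _ 1 one_pos fun s hs => ?_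
    rw [Measure.smul_apply, smul_eq_mul]
    rcases s.eq_empty_or_nonempty with rfl | ⟨y, hy⟩
    · simp
    have hfin : Metric.ediam s ≠ ∞ := ne_top_of_le_ne_top ENNReal.one_ne_top hs
    have hr : ∀ r : ℝ, Metric.diam s < r → μ s ≤ ENNReal.ofReal D * (ENNReal.ofReal r) ^ ((n : ℝ) - 1) := by
      intro r hr
      refine (measure_mono ?_).trans (hb y r (lt_of_le_of_lt Metric.diam_nonneg hr))
      intro z hz
      rw [mem_closedBall]
      exact (Metric.dist_le_diam_of_mem (Metric.isBounded_iff_ediam_ne_top.2 hfin) hz hy).trans hr.le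
    have hlim : μ s ≤ ENNReal.ofReal D * (ENNReal.ofReal (Metric.diam s)) ^ ((n : ℝ) - 1) := by
      have ht : Filter.Tendsto (fun r : ℝ => ENNReal.ofReal D * (ENNReal.ofReal r) ^ ((n : ℝ) - 1))
          (nhdsWithin (Metric.diam s) (Set.Ioi (Metric.diam s)))
          (nhds (ENNReal.ofReal D * (ENNReal.ofReal (Metric.diam s)) ^ ((n : ℝ) - 1))) := by
        refine Filter.Tendsto.mono_left ?_ nhdsWithin_le_nhds
        refine ENNReal.Tendsto.const_mul ?_ (Or.inr ENNReal.ofReal_ne_top)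
        exact ((ENNReal.continuous_rpow_const.comp ENNReal.continuous_ofReal).tendsto _)
      exact ge_of_tendsto ht (Filter.eventually_of_mem self_mem_nhdsWithin hr)
    have hdd : ENNReal.ofReal (Metric.diam s) = Metric.ediam s := ENNReal.ofReal_toReal hfin
    rw [hdd] at hlim
    calc (ENNReal.ofReal D)⁻¹ * μ s ≤ (ENNReal.ofReal D)⁻¹ * (ENNReal.ofReal D * Metric.ediam s ^ ((n : ℝ) - 1)) := by
          gcongr
      _ = _ := by
          rw [← mul_assoc, ENNReal.inv_mul_cancel hDne ENNReal.ofReal_ne_top, one_mul]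
  intro s
  have := key s
  rw [Measure.smul_apply, smul_eq_mul] at this ⊢
  calc μ s = ENNReal.ofReal D * ((ENNReal.ofReal D)⁻¹ * μ s) := by
        rw [← mul_assoc, ENNReal.mul_inv_cancel hDne ENNReal.ofReal_ne_top, one_mul]
    _ ≤ _ := by gcongr

theorem lsi_hausdorff_sphere_lt_top (n : ℕ) (hn : 2 ≤ n) (x₀ : EuclideanSpace ℝ (Fin n)) (R : ℝ)
    (hR : 0 < R) : μH[(n : ℝ) - 1] (sphere x₀ R) < ∞ := by
  obtain ⟨m, rfl⟩ : ∃ m, n = m + 1 := ⟨n - 1, by omega⟩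
  have hm : ((m + 1 : ℕ) : ℝ) - 1 = (Fintype.card (Fin m) : ℕ) := by simp
  rw [hm]
  set w : Fin (m + 1) → (Fin m → ℝ) → EuclideanSpace ℝ (Fin (m + 1)) :=
    fun i v => WithLp.toLp 2 (i.insertNth (1 : ℝ) v) with hw
  have hwi : ∀ i v, w i v i = 1 := fun i v => by simp [hw]
  have hw0 : ∀ i v, w i v ≠ 0 := fun i v h => by
    have := hwi i v; rw [h] at this; simp at this
  have hwc : ∀ i, ContDiff ℝ 1 (w i) := by
    intro i
    rw [contDiff_euclidean]
    intro j
    rcases Fin.eq_self_or_eq_succAbove i j with rfl | ⟨k, rfl⟩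
    · simp [hw, contDiff_const]
    · simpa [hw] using contDiff_apply ℝ ℝ k
  set F : Fin (m + 1) → ℝ → (Fin m → ℝ) → EuclideanSpace ℝ (Fin (m + 1)) :=
    fun i c v => x₀ + c • (‖w i v‖⁻¹ • w i v) with hF
  have hFc : ∀ i c, ContDiff ℝ 1 (F i c) := by
    intro i c
    have h1 : ContDiff ℝ 1 (fun v => ‖w i v‖⁻¹) :=
      ((hwc i).norm ℝ (hw0 i)).inv (fun v => norm_ne_zero_iff.2 (hw0 i v))
    have h2 : ContDiff ℝ 1 (fun v => ‖w i v‖⁻¹ • w i v) := h1.smul (hwc i)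
    have h3 : ContDiff ℝ 1 (fun v => c • (‖w i v‖⁻¹ • w i v)) := h2.const_smul c
    exact contDiff_const.add h3
  set K : Set (Fin m → ℝ) := closedBall 0 1 with hK
  have hfin : ∀ i c, μH[(Fintype.card (Fin m) : ℕ)] (F i c '' K) < ∞ := by
    intro i c
    obtain ⟨L, hL⟩ := (hFc i c).contDiffOn.exists_lipschitzOnWith (s := K) one_ne_zero
      (convex_closedBall _ _) (isCompact_closedBall _ _)
    refine (hL.hausdorffMeasure_image_le (by positivity)).trans_lt ?_
    rw [hausdorffMeasure_pi_real]
    exact ENNReal.mul_lt_top (ENNReal.rpow_lt_top_of_nonneg (by positivity) ENNReal.coe_ne_top)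
      (isCompact_closedBall _ _).measure_lt_top
  have hsub : sphere x₀ R ⊆ ⋃ i, (F i R '' K ∪ F i (-R) '' K) := by
    intro y hy
    have hyR : ‖y - x₀‖ = R := by simpa [dist_eq_norm] using hy
    set z := y - x₀ with hz
    obtain ⟨i, -, hi⟩ := Finset.exists_max_image Finset.univ (fun i => |z i|) ⟨0, Finset.mem_univ _⟩
    have hzi : z i ≠ 0 := by
      intro h0
      have : z = 0 := by
        ext j
        have := hi j (Finset.mem_univ _)
        rw [h0, abs_zero] at this
        simpa using abs_nonpos_iff.1 this
      rw [this, norm_zero] at hyR; linarith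
    have hwz : w i (fun k => z (i.succAbove k) / z i) = (z i)⁻¹ • z := by
      ext j
      rcases Fin.eq_self_or_eq_succAbove i j with rfl | ⟨k, rfl⟩
      · simp [hw, hzi]
      · simp [hw, div_eq_inv_mul]
    have hvK : (fun k => z (i.succAbove k) / z i) ∈ K := by
      rw [hK, mem_closedBall_zero_iff, pi_norm_le_iff_of_nonneg zero_le_one]
      intro k
      rw [Real.norm_eq_abs, abs_div, div_le_one (abs_pos.2 hzi)]
      exact hi _ (Finset.mem_univ _)
    rw [Set.mem_iUnion]
    refine ⟨i, ?_⟩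
    rcases lt_or_gt_of_ne hzi with hneg | hpos
    · right
      refine ⟨_, hvK, ?_⟩
      simp only [hF]
      rw [hwz, norm_smul, norm_inv, Real.norm_eq_abs, abs_of_neg hneg, hyR, smul_smul, smul_smul]
      have : -R * ((-z i)⁻¹ * R)⁻¹ * (z i)⁻¹ = 1 := by field_simp
      rw [this, one_smul, hz]; abel
    · left
      refine ⟨_, hvK, ?_⟩
      simp only [hF]
      rw [hwz, norm_smul, norm_inv, Real.norm_eq_abs, abs_of_pos hpos, hyR, smul_smul, smul_smul]
      have : R * ((z i)⁻¹ * R)⁻¹ * (z i)⁻¹ = 1 := by field_simp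
      rw [this, one_smul, hz]; abel
  refine (measure_mono hsub).trans_lt ?_
  refine (measure_iUnion_le _).trans_lt ?_
  rw [tsum_fintype]
  refine ENNReal.sum_lt_top.2 fun i _ => ?_
  exact (measure_union_le _ _).trans_lt (ENNReal.add_lt_top.2 ⟨hfin _ _, hfin _ _⟩)

theorem lsi_shell (n : ℕ) (ρ : ℝ) (hρ0 : 0 < ρ) (hρ : ρ < 1)
    (Φ : EuclideanSpace ℝ (Fin n) → ℝ≥0∞) (hΦ : Measurable Φ) :
    ∫⁻ y in {y : EuclideanSpace ℝ (Fin n) | ρ ≤ ‖y‖ ∧ ‖y‖ < 1}, Φ (‖y‖⁻¹ • y) ≤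
      ENNReal.ofReal (1 - ρ) * ∫⁻ w, Φ w ∂(lsiSphere n) := by
  set A := {y : EuclideanSpace ℝ (Fin n) | ρ ≤ ‖y‖ ∧ ‖y‖ < 1} with hA
  have hAm : MeasurableSet A :=
    (measurableSet_le measurable_const measurable_norm).inter
      (measurableSet_lt measurable_norm measurable_const)
  have hA0 : A ⊆ {0}ᶜ := by
    intro y hy h0
    rw [Set.mem_singleton_iff] at h0
    have := hy.1
    rw [h0, norm_zero] at this; linarith
  set I : Set ℝ := Set.Ico ρ 1 with hI
  set J : Set (Set.Ioi (0 : ℝ)) := Subtype.val ⁻¹' I with hJ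
  have hJm : MeasurableSet J := measurable_subtype_coe measurableSet_Ico
  have hmp := (volume : Measure (EuclideanSpace ℝ (Fin n))).measurePreserving_homeomorphUnitSphereProd
  have e1 : ∫⁻ y in A, Φ (‖y‖⁻¹ • y) = ∫⁻ z, Φ z.1 * J.indicator 1 z.2
      ∂((volume : Measure (EuclideanSpace ℝ (Fin n))).toSphere.prod
        (Measure.volumeIoiPow (Module.finrank ℝ (EuclideanSpace ℝ (Fin n)) - 1))) := by
    rw [← hmp.lintegral_comp_emb (Homeomorph.measurableEmbedding _)]
    rw [← lintegral_indicator hAm]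
    have : ∫⁻ y, A.indicator (fun y => Φ (‖y‖⁻¹ • y)) y =
      ∫⁻ y in ({0}ᶜ : Set (EuclideanSpace ℝ (Fin n))), A.indicator (fun y => Φ (‖y‖⁻¹ • y)) y := by
      rw [← lintegral_indicator (measurableSet_singleton _).compl]
      congr 1
      rw [Set.indicator_indicator, Set.inter_eq_right.2 hA0]
    rw [this, ← lintegral_subtype_comap (measurableSet_singleton _).compl]
    refine lintegral_congr fun y => ?_
    by_cases hy : (y : EuclideanSpace ℝ (Fin n)) ∈ A
    · rw [Set.indicator_of_mem hy, Set.indicator_of_mem]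
      · simp
      · simpa [hJ, hI, hA] using hy
    · rw [Set.indicator_of_notMem hy, Set.indicator_of_notMem]
      · simp
      · simpa [hJ, hI, hA] using hy
  rw [e1, lintegral_prod_mul (f := fun w : sphere (0 : EuclideanSpace ℝ (Fin n)) 1 => Φ w)
    (g := J.indicator 1) (hΦ.comp measurable_subtype_coe).aemeasurable
    (measurable_one.indicator hJm).aemeasurable, lsiSphere,
    lintegral_map hΦ measurable_subtype_coe, mul_comm]
  gcongr
  rw [lintegral_indicator_one hJm, Measure.volumeIoiPow, withDensity_apply _ hJm]
  calc _ ≤ ∫⁻ _ in J, 1 ∂(Measure.comap Subtype.val (volume : Measure ℝ)) := by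
        refine setLIntegral_mono measurable_const fun t ht => ?_
        rw [← ENNReal.ofReal_one]
        exact ENNReal.ofReal_le_ofReal (pow_le_one₀ (hρ0.le.trans ht.1) ht.2.le)
    _ = (Measure.comap Subtype.val (volume : Measure ℝ)) J := by simp
    _ ≤ volume I := by
        rw [(MeasurableEmbedding.subtype_coe measurableSet_Ioi).comap_apply]
        exact measure_mono (Set.image_preimage_subset _ _)
    _ = _ := by simp [hI]

theorem lsi_integrable_aux {n : ℕ} {ρ : ℝ} (hρ : ρ < 1) {w : EuclideanSpace ℝ (Fin n) → ℝ}
    {k : EuclideanSpace ℝ (Fin n) → ℂ} (hw : Continuous w) (hk : ContinuousOn k (ball 0 1))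
    (h0 : ∀ y, ρ < ‖y‖ → w y = 0) : Integrable (fun y => w y • k y) := by
  have hsub : closedBall (0 : EuclideanSpace ℝ (Fin n)) ρ ⊆ ball 0 1 := closedBall_subset_ball hρ
  rw [← integrableOn_iff_integrable_of_support_subset (s := closedBall 0 ρ)]
  · exact (hw.continuousOn.smul (hk.mono hsub)).integrableOn_compact (isCompact_closedBall _ _)
  · intro y hy
    by_contra h
    simp only [mem_closedBall_zero_iff, not_le] at h
    exact hy (by simp [h0 y h])

theorem lsi_ibp (n : ℕ) (ρ : ℝ) (hρ : ρ < 1) (W : EuclideanSpace ℝ (Fin n) → ℝ)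
    (W1 W2 : Fin n → EuclideanSpace ℝ (Fin n) → ℝ)
    (hW : ∀ i y, HasLineDerivAt ℝ W (W1 i y) y (EuclideanSpace.single i 1))
    (hW1 : ∀ i y, HasLineDerivAt ℝ (W1 i) (W2 i y) y (EuclideanSpace.single i 1))
    (c0 : Continuous W) (c1 : ∀ i, Continuous (W1 i)) (c2 : ∀ i, Continuous (W2 i))
    (z0 : ∀ y, ρ < ‖y‖ → W y = 0) (z1 : ∀ i y, ρ < ‖y‖ → W1 i y = 0)
    (z2 : ∀ i y, ρ < ‖y‖ → W2 i y = 0)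
    (f : EuclideanSpace ℝ (Fin n) → ℂ) (hf : ContDiffOn ℝ 2 f (ball 0 1)) :
    ∫ y, W y • laplacianC n f y = ∫ y, (∑ i, W2 i y) • f y := by
  have hts : ∀ w : EuclideanSpace ℝ (Fin n) → ℝ, (∀ y, ρ < ‖y‖ → w y = 0) →
      tsupport w ⊆ ball 0 1 := by
    intro w hw
    refine (closure_minimal ?_ isClosed_closedBall).trans (closedBall_subset_ball hρ)
    intro y hy
    by_contra h
    simp only [mem_closedBall_zero_iff, not_le] at h
    exact hy (hw y h)
  have hfd : ContDiffOn ℝ 1 (fderiv ℝ f) (ball 0 1) :=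
    hf.fderiv_of_isOpen isOpen_ball (by norm_num)
  have hfdi : ∀ i : Fin n, ContDiffOn ℝ 1
      (fun y => fderiv ℝ f y (EuclideanSpace.single i 1)) (ball 0 1) :=
    fun i => hfd.clm_apply contDiffOn_const
  have hfdd : ∀ i : Fin n, ContinuousOn (fun x => fderiv ℝ
      (fun y => fderiv ℝ f y (EuclideanSpace.single i 1)) x (EuclideanSpace.single i 1)) (ball 0 1) :=
    fun i => (((hfdi i).fderiv_of_isOpen isOpen_ball (m := 0) (by norm_num)).continuousOn).clm_apply
      continuousOn_const
  have key : ∀ i : Fin n, ∫ y, W y • (fderiv ℝ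
      (fun y => fderiv ℝ f y (EuclideanSpace.single i 1)) y (EuclideanSpace.single i 1)) =
      ∫ y, W2 i y • f y := by
    intro i
    have h1 := integral_bilinear_hasLineDerivAt_right_eq_neg_left_of_integrable
      (μ := (volume : Measure (EuclideanSpace ℝ (Fin n))))
      (f := W) (f' := W1 i) (g := fun y => fderiv ℝ f y (EuclideanSpace.single i 1))
      (g' := fun x => fderiv ℝ
        (fun y => fderiv ℝ f y (EuclideanSpace.single i 1)) x (EuclideanSpace.single i 1))
      (v := EuclideanSpace.single i 1) (B := ContinuousLinearMap.lsmul ℝ ℝ)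
      (by simpa using lsi_integrable_aux hρ (c1 i) (hfdi i).continuousOn (z1 i))
      (by simpa using lsi_integrable_aux hρ c0 (hfdd i) z0)
      (by simpa using lsi_integrable_aux hρ c0 (hfdi i).continuousOn z0)
      (fun y _ => hW i y)
      (fun y hy => (((hfdi i).differentiableOn (by norm_num) y (hts W z0 hy)).differentiableAt
        (isOpen_ball.mem_nhds (hts W z0 hy))).hasFDerivAt.hasLineDerivAt _)
    have h2 := integral_bilinear_hasLineDerivAt_right_eq_neg_left_of_integrable
      (μ := (volume : Measure (EuclideanSpace ℝ (Fin n))))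
      (f := W1 i) (f' := W2 i) (g := f)
      (g' := fun y => fderiv ℝ f y (EuclideanSpace.single i 1))
      (v := EuclideanSpace.single i 1) (B := ContinuousLinearMap.lsmul ℝ ℝ)
      (by simpa using lsi_integrable_aux hρ (c2 i) hf.continuousOn (z2 i))
      (by simpa using lsi_integrable_aux hρ (c1 i) (hfdi i).continuousOn (z1 i))
      (by simpa using lsi_integrable_aux hρ (c1 i) hf.continuousOn (z1 i))
      (fun y _ => hW1 i y)
      (fun y hy => ((hf.differentiableOn (by norm_num) y (hts _ (z1 i) hy)).differentiableAt
        (isOpen_ball.mem_nhds (hts _ (z1 i) hy))).hasFDerivAt.hasLineDerivAt _)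
    simp only [ContinuousLinearMap.lsmul_apply] at h1 h2
    rw [h1, h2, neg_neg]
  simp only [laplacianC, Finset.smul_sum, Finset.sum_smul]
  rw [integral_finsetSum _ fun i _ => lsi_integrable_aux hρ c0 (hfdd i) z0,
    integral_finsetSum _ fun i _ => lsi_integrable_aux hρ (c2 i) hf.continuousOn (z2 i)]
  exact Finset.sum_congr rfl fun i _ => key i

theorem lsi_ld_comp {n : ℕ} {P : EuclideanSpace ℝ (Fin n) → ℝ} {g : ℝ → ℝ} {g' P' : ℝ}
    {y v : EuclideanSpace ℝ (Fin n)} (hP : HasLineDerivAt ℝ P P' y v)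
    (hg : HasDerivAt g g' (P y)) : HasLineDerivAt ℝ (fun z => g (P z)) (g' * P') y v := by
  unfold HasLineDerivAt at *
  exact HasDerivAt.comp_of_eq (h₂ := g) 0 hg hP (by simp)

theorem lsi_ld_mul {n : ℕ} {P K : EuclideanSpace ℝ (Fin n) → ℝ} {P' K' : ℝ}
    {y v : EuclideanSpace ℝ (Fin n)} (hP : HasLineDerivAt ℝ P P' y v)
    (hK : HasLineDerivAt ℝ K K' y v) :
    HasLineDerivAt ℝ (fun z => P z * K z) (P' * K y + P y * K') y v := by
  unfold HasLineDerivAt at *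
  simpa using hP.fun_mul hK

theorem lsi_ld_sub {n : ℕ} {P K : EuclideanSpace ℝ (Fin n) → ℝ} {P' K' : ℝ}
    {y v : EuclideanSpace ℝ (Fin n)} (hP : HasLineDerivAt ℝ P P' y v)
    (hK : HasLineDerivAt ℝ K K' y v) :
    HasLineDerivAt ℝ (fun z => P z - K z) (P' - K') y v := by
  unfold HasLineDerivAt at *
  exact hP.fun_sub hK

theorem lsi_ld_add {n : ℕ} {P K : EuclideanSpace ℝ (Fin n) → ℝ} {P' K' : ℝ}
    {y v : EuclideanSpace ℝ (Fin n)} (hP : HasLineDerivAt ℝ P P' y v)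
    (hK : HasLineDerivAt ℝ K K' y v) :
    HasLineDerivAt ℝ (fun z => P z + K z) (P' + K') y v := by
  unfold HasLineDerivAt at *
  exact hP.fun_add hK

theorem lsi_ld_quad {n : ℕ} (a c : ℝ) (b y : EuclideanSpace ℝ (Fin n)) (i : Fin n) :
    HasLineDerivAt ℝ (fun z => a + inner ℝ b z + c * ‖z‖ ^ 2) (b i + c * (2 * y i)) y
      (EuclideanSpace.single i 1) := by
  have h1 : HasFDerivAt (fun z : EuclideanSpace ℝ (Fin n) => a + inner ℝ b z + c * ‖z‖ ^ 2)
      (innerSL ℝ b + c • (2 • innerSL ℝ y)) y := by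
    have := ((innerSL ℝ b).hasFDerivAt (x := y)).const_add a
    exact this.add ((hasStrictFDerivAt_norm_sq y).hasFDerivAt.const_mul c)
  have := h1.hasLineDerivAt (EuclideanSpace.single i 1)
  have e : b i + c * (2 * y i) = (innerSL ℝ b + c • (2 • innerSL ℝ y)) (EuclideanSpace.single i 1) := by
    simp [EuclideanSpace.inner_single_right]
  rw [e]
  exact this

theorem lsi_ld_lin {n : ℕ} (a c : ℝ) (y : EuclideanSpace ℝ (Fin n)) (i : Fin n) :
    HasLineDerivAt ℝ (fun z : EuclideanSpace ℝ (Fin n) => a + c * (2 * z i)) (2 * c) y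
      (EuclideanSpace.single i 1) := by
  unfold HasLineDerivAt
  have : HasDerivAt (fun t : ℝ => a + c * (2 * (y i + t))) (c * (2 * 1)) 0 :=
    ((((hasDerivAt_id (0 : ℝ)).const_add (y i)).const_mul 2).const_mul c).const_add a
  have e1 : (fun t : ℝ => a + c * (2 * (y + t • EuclideanSpace.single i (1 : ℝ)) i)) =
      fun t : ℝ => a + c * (2 * (y i + t)) := by
    ext t; simp
  have e2 : 2 * c = c * (2 * 1) := by ring
  show HasDerivAt (fun t : ℝ => a + c * (2 * (y + t • EuclideanSpace.single i (1 : ℝ)) i)) _ 0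
  rw [e1, e2]
  exact this

theorem lsi_theta : ∃ (θ θ1 θ2 : ℝ → ℝ) (C : ℝ), 0 < C ∧ (∀ u, HasDerivAt θ (θ1 u) u) ∧
    (∀ u, HasDerivAt θ1 (θ2 u) u) ∧ Continuous θ2 ∧
    (∀ u ≤ 1 / 3, θ u = 0 ∧ θ1 u = 0 ∧ θ2 u = 0) ∧
    (∀ u, 2 / 3 ≤ u → θ u = 1 ∧ θ1 u = 0 ∧ θ2 u = 0) ∧
    (∀ u, 0 ≤ θ u ∧ θ u ≤ 1 ∧ |θ1 u| ≤ C ∧ |θ2 u| ≤ C) := by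
  set θ : ℝ → ℝ := fun u => Real.smoothTransition (4 * u - 3 / 2) with hθ
  have hsm : ContDiff ℝ 2 θ := by
    have : ContDiff ℝ 2 Real.smoothTransition := Real.smoothTransition.contDiff
    exact this.comp ((contDiff_const.mul contDiff_id).sub contDiff_const)
  have hsm1 : ContDiff ℝ 1 (deriv θ) := by
    have h2 : ContDiff ℝ (1 + 1) θ := by norm_num; exact hsm
    exact (contDiff_succ_iff_deriv.1 h2).2.2
  have hsm2 : Continuous (deriv (deriv θ)) := by
    exact hsm1.continuous_deriv (by norm_num)
  have hl : ∀ u ≤ 1 / 3, θ u = 0 ∧ deriv θ u = 0 ∧ deriv (deriv θ) u = 0 := by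
    intro u hu
    have e0 : θ =ᶠ[nhds u] fun _ => 0 := by
      filter_upwards [Iio_mem_nhds (show u < 3 / 8 by linarith)] with v hv
      simp only [hθ]
      rw [Real.smoothTransition.zero_iff_nonpos]
      simp only [Set.mem_Iio] at hv; linarith
    have e1 : deriv θ =ᶠ[nhds u] fun _ => 0 := by
      have := e0.deriv
      simpa using this
    refine ⟨e0.self_of_nhds, e1.self_of_nhds, ?_⟩
    have := e1.deriv.self_of_nhds
    simpa using this
  have hrr : ∀ u, 2 / 3 ≤ u → θ u = 1 ∧ deriv θ u = 0 ∧ deriv (deriv θ) u = 0 := by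
    intro u hu
    have e0 : θ =ᶠ[nhds u] fun _ => 1 := by
      filter_upwards [Ioi_mem_nhds (show 5 / 8 < u by linarith)] with v hv
      simp only [hθ]
      apply Real.smoothTransition.one_of_one_le
      simp only [Set.mem_Ioi] at hv; linarith
    have e1 : deriv θ =ᶠ[nhds u] fun _ => 0 := by
      have := e0.deriv
      simpa using this
    refine ⟨e0.self_of_nhds, e1.self_of_nhds, ?_⟩
    have := e1.deriv.self_of_nhds
    simpa using this
  obtain ⟨C1, hC1⟩ := (isCompact_Icc (a := (1 / 3 : ℝ)) (b := 2 / 3)).exists_bound_of_continuousOn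
    hsm1.continuous.continuousOn
  obtain ⟨C2, hC2⟩ := (isCompact_Icc (a := (1 / 3 : ℝ)) (b := 2 / 3)).exists_bound_of_continuousOn
    hsm2.continuousOn
  refine ⟨θ, deriv θ, deriv (deriv θ), |C1| + |C2| + 1, by positivity,
    fun u => (hsm.differentiable (by norm_num) u).hasDerivAt,
    fun u => (hsm1.differentiable (by norm_num) u).hasDerivAt, hsm2, hl, hrr, fun u =>
    ⟨Real.smoothTransition.nonneg _, Real.smoothTransition.le_one _, ?_⟩⟩
  have a1 := abs_nonneg C1
  have a2 := abs_nonneg C2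
  rcases le_or_gt u (1 / 3) with h | h
  · rw [(hl u h).2.1, (hl u h).2.2, abs_zero]; constructor <;> linarith
  rcases le_or_gt (2 / 3) u with h' | h'
  · rw [(hrr u h').2.1, (hrr u h').2.2, abs_zero]; constructor <;> linarith
  have b1 := hC1 u ⟨h.le, h'.le⟩
  have b2 := hC2 u ⟨h.le, h'.le⟩
  rw [Real.norm_eq_abs] at b1 b2
  have := le_abs_self C1
  have := le_abs_self C2
  constructor <;> linarith

theorem lsi_phi (a e : ℝ) (he : 0 < e) :
    ∃ φ : ℝ → ℝ, ∀ t, 0 ≤ t → HasDerivAt φ ((t + e) ^ a) t := by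
  have hc : Continuous (fun t : ℝ => (|t| + e) ^ a) :=
    (continuous_abs.add continuous_const).rpow_const fun t => Or.inl (by show |t| + e ≠ 0; positivity)
  refine ⟨fun t => ∫ τ in (0 : ℝ)..t, (|τ| + e) ^ a, fun t ht => ?_⟩
  have := intervalIntegral.integral_hasDerivAt_right (hc.intervalIntegrable 0 t)
    (hc.stronglyMeasurableAtFilter _ _) hc.continuousAt
  rwa [abs_of_nonneg ht] at this

theorem lsi_green_id (n : ℕ) (x : EuclideanSpace ℝ (Fin n)) (χ0 χ1 χ2 : ℝ → ℝ)
    (hχ0 : ∀ t, HasDerivAt χ0 (χ1 t) t) (hχ1 : ∀ t, HasDerivAt χ1 (χ2 t) t) (cχ2 : Continuous χ2)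
    (ρ : ℝ) (hρ0 : 0 ≤ ρ) (hρ : ρ < 1) (hz : ∀ t, ρ ^ 2 < t → χ0 t = 0 ∧ χ1 t = 0 ∧ χ2 t = 0)
    (φ φ1 φ2 : ℝ → ℝ) (hφ0 : ∀ t, 0 ≤ t → HasDerivAt φ (φ1 t) t)
    (hφ1 : ∀ t, 0 ≤ t → HasDerivAt φ1 (φ2 t) t) (cφ2 : ∀ t, 0 ≤ t → ContinuousAt φ2 t)
    (Q s : EuclideanSpace ℝ (Fin n) → ℝ)
    (hQ : Q = fun y => 1 + inner ℝ (-(2 : ℝ) • x) y + ‖x‖ ^ 2 * ‖y‖ ^ 2)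
    (hs : s = fun y => ‖x‖ ^ 2 + inner ℝ (-(2 : ℝ) • x) y + 1 * ‖y‖ ^ 2)
    (hQ0 : ∀ y, 0 ≤ Q y) (hs0 : ∀ y, 0 ≤ s y)
    (f : EuclideanSpace ℝ (Fin n) → ℂ) (hf : ContDiffOn ℝ 2 f (ball 0 1)) :
    ∫ y, (χ0 (‖y‖ ^ 2) * (φ (Q y) - φ (s y))) • laplacianC n f y =
    ∫ y, (((4 * ‖y‖ ^ 2 * χ2 (‖y‖ ^ 2) + 2 * n * χ1 (‖y‖ ^ 2)) * (φ (Q y) - φ (s y)) +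
      8 * χ1 (‖y‖ ^ 2) * (φ1 (Q y) * (‖x‖ ^ 2 * ‖y‖ ^ 2 - inner ℝ x y) -
        φ1 (s y) * (‖y‖ ^ 2 - inner ℝ x y))) +
      χ0 (‖y‖ ^ 2) * (‖x‖ ^ 2 * (4 * Q y * φ2 (Q y) + 2 * n * φ1 (Q y)) -
        (4 * s y * φ2 (s y) + 2 * n * φ1 (s y)))) • f y := by
  set b : EuclideanSpace ℝ (Fin n) := -(2 : ℝ) • x with hb
  set T : EuclideanSpace ℝ (Fin n) → ℝ := fun y => ‖y‖ ^ 2 with hT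
  set Qi : Fin n → EuclideanSpace ℝ (Fin n) → ℝ := fun i y => b i + ‖x‖ ^ 2 * (2 * y i) with hQi
  set si : Fin n → EuclideanSpace ℝ (Fin n) → ℝ := fun i y => b i + 1 * (2 * y i) with hsi
  set Ti : Fin n → EuclideanSpace ℝ (Fin n) → ℝ := fun i y => 0 + 1 * (2 * y i) with hTi
  have dQ : ∀ i y, HasLineDerivAt ℝ Q (Qi i y) y (EuclideanSpace.single i 1) := by
    intro i y; rw [hQ]; exact lsi_ld_quad _ _ _ _ _
  have ds : ∀ i y, HasLineDerivAt ℝ s (si i y) y (EuclideanSpace.single i 1) := by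
    intro i y; rw [hs]; exact lsi_ld_quad _ _ _ _ _
  have dT : ∀ i y, HasLineDerivAt ℝ T (Ti i y) y (EuclideanSpace.single i 1) := by
    intro i y
    have := lsi_ld_quad (n := n) 0 1 0 y i
    simpa [hT, hTi] using this
  have dQi : ∀ i y, HasLineDerivAt ℝ (Qi i) (2 * ‖x‖ ^ 2) y (EuclideanSpace.single i 1) :=
    fun i y => lsi_ld_lin _ _ _ _
  have dsi : ∀ i y, HasLineDerivAt ℝ (si i) (2 * 1) y (EuclideanSpace.single i 1) :=
    fun i y => lsi_ld_lin _ _ _ _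
  have dTi : ∀ i y, HasLineDerivAt ℝ (Ti i) (2 * 1) y (EuclideanSpace.single i 1) :=
    fun i y => lsi_ld_lin _ _ _ _
  have cQ : Continuous Q := by rw [hQ]; fun_prop
  have cs : Continuous s := by rw [hs]; fun_prop
  have cT : Continuous T := by rw [hT]; fun_prop
  have cQi : ∀ i, Continuous (Qi i) := fun i => by simp only [hQi]; fun_prop
  have csi : ∀ i, Continuous (si i) := fun i => by simp only [hsi]; fun_prop
  have cTi : ∀ i, Continuous (Ti i) := fun i => by simp only [hTi]; fun_prop
  have cχ0 : Continuous χ0 := continuous_iff_continuousAt.2 fun t => (hχ0 t).continuousAt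
  have cχ1 : Continuous χ1 := continuous_iff_continuousAt.2 fun t => (hχ1 t).continuousAt
  have cc : ∀ (g : ℝ → ℝ) (P : EuclideanSpace ℝ (Fin n) → ℝ), (∀ t, 0 ≤ t → ContinuousAt g t) →
      Continuous P → (∀ y, 0 ≤ P y) → Continuous (fun y => g (P y)) := fun g P hg hP h0 =>
    continuous_iff_continuousAt.2 fun y => ContinuousAt.comp (hg _ (h0 y)) hP.continuousAt
  have c1 := cc φ Q (fun t ht => (hφ0 t ht).continuousAt) cQ hQ0
  have c2 := cc φ s (fun t ht => (hφ0 t ht).continuousAt) cs hs0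
  have c3 := cc φ1 Q (fun t ht => (hφ1 t ht).continuousAt) cQ hQ0
  have c4 := cc φ1 s (fun t ht => (hφ1 t ht).continuousAt) cs hs0
  have c5 := cc φ2 Q cφ2 cQ hQ0
  have c6 := cc φ2 s cφ2 cs hs0
  have c7 : Continuous (fun y => χ0 (T y)) := cχ0.comp cT
  have c8 : Continuous (fun y => χ1 (T y)) := cχ1.comp cT
  have c9 : Continuous (fun y => χ2 (T y)) := cχ2.comp cT
  have hz' : ∀ y : EuclideanSpace ℝ (Fin n), ρ < ‖y‖ →
      χ0 (T y) = 0 ∧ χ1 (T y) = 0 ∧ χ2 (T y) = 0 := by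
    intro y hy
    exact hz _ (by simp only [hT]; gcongr)
  set W1 : Fin n → EuclideanSpace ℝ (Fin n) → ℝ := fun i y =>
    (χ1 (T y) * Ti i y) * (φ (Q y) - φ (s y)) +
      χ0 (T y) * (φ1 (Q y) * Qi i y - φ1 (s y) * si i y) with hW1
  set W2 : Fin n → EuclideanSpace ℝ (Fin n) → ℝ := fun i y =>
    (((χ2 (T y) * Ti i y) * Ti i y + χ1 (T y) * (2 * 1)) * (φ (Q y) - φ (s y)) +
      (χ1 (T y) * Ti i y) * (φ1 (Q y) * Qi i y - φ1 (s y) * si i y)) +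
      ((χ1 (T y) * Ti i y) * (φ1 (Q y) * Qi i y - φ1 (s y) * si i y) +
      χ0 (T y) * (((φ2 (Q y) * Qi i y) * Qi i y + φ1 (Q y) * (2 * ‖x‖ ^ 2)) -
        ((φ2 (s y) * si i y) * si i y + φ1 (s y) * (2 * 1)))) with hW2
  have main := lsi_ibp n ρ hρ (fun y => χ0 (T y) * (φ (Q y) - φ (s y))) W1 W2
    (fun i y => lsi_ld_mul (lsi_ld_comp (dT i y) (hχ0 _))
      (lsi_ld_sub (lsi_ld_comp (dQ i y) (hφ0 _ (hQ0 y))) (lsi_ld_comp (ds i y) (hφ0 _ (hs0 y)))))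
    (fun i y => lsi_ld_add
      (lsi_ld_mul (lsi_ld_mul (lsi_ld_comp (dT i y) (hχ1 _)) (dTi i y))
        (lsi_ld_sub (lsi_ld_comp (dQ i y) (hφ0 _ (hQ0 y))) (lsi_ld_comp (ds i y) (hφ0 _ (hs0 y)))))
      (lsi_ld_mul (lsi_ld_comp (dT i y) (hχ0 _))
        (lsi_ld_sub (lsi_ld_mul (lsi_ld_comp (dQ i y) (hφ1 _ (hQ0 y))) (dQi i y))
          (lsi_ld_mul (lsi_ld_comp (ds i y) (hφ1 _ (hs0 y))) (dsi i y)))))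
    (c7.mul (c1.sub c2))
    (fun i => ((c8.mul (cTi i)).mul (c1.sub c2)).add (c7.mul ((c3.mul (cQi i)).sub (c4.mul (csi i)))))
    (fun i => (((((c9.mul (cTi i)).mul (cTi i)).add (c8.mul continuous_const)).mul (c1.sub c2)).add
      ((c8.mul (cTi i)).mul ((c3.mul (cQi i)).sub (c4.mul (csi i))))).add
      (((c8.mul (cTi i)).mul ((c3.mul (cQi i)).sub (c4.mul (csi i)))).add
      (c7.mul ((((c5.mul (cQi i)).mul (cQi i)).add (c3.mul continuous_const)).sub
        (((c6.mul (csi i)).mul (csi i)).add (c4.mul continuous_const))))))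
    (fun y hy => by obtain ⟨h0, h1, h2⟩ := hz' y hy; simp [h0])
    (fun i y hy => by obtain ⟨h0, h1, h2⟩ := hz' y hy; simp [hW1, h0, h1])
    (fun i y hy => by obtain ⟨h0, h1, h2⟩ := hz' y hy; simp [hW2, h0, h1, h2]) f hf
  rw [main]
  congr 1
  ext y
  congr 1
  have n1 : ‖y‖ ^ 2 = ∑ i, y i * y i := by
    rw [EuclideanSpace.norm_sq_eq]; simp [pow_two]
  have n2 : inner ℝ x y = ∑ i, x i * y i := by
    simp [PiLp.inner_apply, mul_comm]
  have n3 : ‖x‖ ^ 2 = ∑ i, x i * x i := by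
    rw [EuclideanSpace.norm_sq_eq]; simp [pow_two]
  have eQ : Q y = 1 - 2 * inner ℝ x y + ‖x‖ ^ 2 * ‖y‖ ^ 2 := by
    rw [hQ]; simp only [hb, inner_smul_left]; simp; ring
  have es : s y = ‖x‖ ^ 2 - 2 * inner ℝ x y + ‖y‖ ^ 2 := by
    rw [hs]; simp only [hb, inner_smul_left]; simp; ring
  have bi : ∀ i, b i = -2 * x i := fun i => by simp [hb]
  have lhs : ∑ i, W2 i y =
      (4 * χ2 (T y) * (φ (Q y) - φ (s y)) + 8 * χ1 (T y) * (φ1 (Q y) * ‖x‖ ^ 2 - φ1 (s y)) +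
        χ0 (T y) * (4 * ‖x‖ ^ 4 * φ2 (Q y) - 4 * φ2 (s y))) * ∑ i, y i * y i +
      (8 * χ1 (T y) * (φ1 (s y) - φ1 (Q y)) + χ0 (T y) * (8 * φ2 (s y) - 8 * ‖x‖ ^ 2 * φ2 (Q y))) *
        ∑ i, x i * y i +
      χ0 (T y) * (4 * φ2 (Q y) - 4 * φ2 (s y)) * ∑ i, x i * x i +
      (2 * χ1 (T y) * (φ (Q y) - φ (s y)) + χ0 (T y) * (2 * ‖x‖ ^ 2 * φ1 (Q y) - 2 * φ1 (s y))) *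
        ∑ i : Fin n, 1 := by
    rw [Finset.mul_sum, Finset.mul_sum, Finset.mul_sum, Finset.mul_sum, ← Finset.sum_add_distrib,
      ← Finset.sum_add_distrib, ← Finset.sum_add_distrib]
    refine Finset.sum_congr rfl fun i _ => ?_
    simp only [hW2, hTi, hQi, hsi, bi]
    ring
  rw [lhs, ← n1, ← n2, ← n3]
  simp only [Finset.sum_const, Finset.card_univ, Fintype.card_fin, nsmul_eq_mul, mul_one]
  have eT : T y = ‖y‖ ^ 2 := rfl
  rw [eT]
  generalize φ2 (Q y) = A1
  generalize φ2 (s y) = A2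
  generalize φ1 (Q y) = A3
  generalize φ1 (s y) = A4
  generalize φ (Q y) = A5
  generalize φ (s y) = A6
  rw [eQ, es]
  ring

theorem lsi_mono (F F' : ℝ → ℝ) (s Q : ℝ) (hsQ : s ≤ Q)
    (hF : ∀ t ∈ Set.Icc s Q, HasDerivAt F (F' t) t) (h : ∀ t ∈ Set.Icc s Q, F' t ≤ 0) :
    F Q ≤ F s := by
  have : AntitoneOn F (Set.Icc s Q) := by
    refine antitoneOn_of_deriv_nonpos (convex_Icc _ _)
      (fun t ht => (hF t ht).continuousAt.continuousWithinAt)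
      (fun t ht => (hF t (interior_subset ht)).differentiableAt.differentiableWithinAt) ?_
    intro t ht
    rw [(hF t (interior_subset ht)).deriv]
    exact h t (interior_subset ht)
  exact this ⟨le_rfl, hsQ⟩ ⟨hsQ, le_rfl⟩ hsQ

theorem lsi_phi_bound (a e κ : ℝ) (he : 0 < e) (ha : 0 < a) (φ : ℝ → ℝ)
    (hφ : ∀ t, 0 ≤ t → HasDerivAt φ ((t + e) ^ (-a)) t) (s Q : ℝ) (hs : 0 < s) (hsQ : s ≤ Q)
    (hQ : Q ≤ 4) (hκ0 : 0 < κ) (hκ : 2 * a - 2 ≤ κ) :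
    0 ≤ φ Q - φ s ∧ φ Q - φ s ≤ (Q - s) * s ^ (-a) ∧
      φ Q - φ s ≤ 4 ^ (κ / 2 + 1 - a) * (2 / κ) * s ^ (-κ / 2) := by
  refine ⟨?_, ?_, ?_⟩
  · have := lsi_mono (fun t => -φ t) (fun t => -(t + e) ^ (-a)) s Q hsQ
      (fun t ht => (hφ t (hs.le.trans ht.1)).neg)
      (fun t ht => by
        have h0 : 0 < t := hs.trans_le ht.1
        have : 0 ≤ (t + e) ^ (-a) := by positivity
        linarith)
    linarith
  · have := lsi_mono (fun t => φ t - t * s ^ (-a)) (fun t => (t + e) ^ (-a) - 1 * s ^ (-a)) s Q hsQ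
      (fun t ht => (hφ t (hs.le.trans ht.1)).sub ((hasDerivAt_id t).mul_const _))
      (fun t ht => by
        have h1 : s ≤ t + e := by linarith [ht.1]
        have := Real.rpow_le_rpow_of_nonpos hs h1 (by linarith : -a ≤ 0)
        linarith)
    linarith
  · set K : ℝ := 4 ^ (κ / 2 + 1 - a) with hK
    have hK0 : 0 < K := by positivity
    have := lsi_mono (fun t => φ t + K * (2 / κ) * t ^ (-κ / 2))
      (fun t => (t + e) ^ (-a) + K * (2 / κ) * ((-κ / 2) * t ^ (-κ / 2 - 1))) s Q hsQ
      (fun t ht => (hφ t (hs.le.trans ht.1)).add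
        ((Real.hasDerivAt_rpow_const (Or.inl (hs.trans_le ht.1).ne')).const_mul _))
      (fun t ht => by
        have h0 : 0 < t := hs.trans_le ht.1
        have h1 : (t + e) ^ (-a) ≤ t ^ (-a) :=
          Real.rpow_le_rpow_of_nonpos h0 (by linarith) (by linarith)
        have h2 : t ^ (-a) = t ^ (κ / 2 + 1 - a) * t ^ (-κ / 2 - 1) := by
          rw [← Real.rpow_add h0]; congr 1; ring
        have h3 : t ^ (κ / 2 + 1 - a) ≤ K :=
          Real.rpow_le_rpow h0.le (ht.2.trans hQ) (by linarith)
        have h4 : 0 ≤ t ^ (-κ / 2 - 1) := by positivity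
        have h5 : K * (2 / κ) * ((-κ / 2) * t ^ (-κ / 2 - 1)) = -(K * t ^ (-κ / 2 - 1)) := by
          field_simp
        rw [h5]
        have := mul_le_mul_of_nonneg_right h3 h4
        linarith)
    have hQ0 : 0 < Q := hs.trans_le hsQ
    have h6 : 0 ≤ K * (2 / κ) * Q ^ (-κ / 2) := by positivity
    linarith

set_option maxHeartbeats 1600000 in
theorem lsi_green (n : ℕ) (hn : 2 ≤ n) (κ : ℝ) (hκ0 : 0 < κ) (hκ : (n : ℝ) - 2 ≤ κ) :
    ∃ C : ℝ, 0 ≤ C ∧ ∀ h : ℝ, 0 < h → h < 1 / 2 →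
    ∃ (χ : EuclideanSpace ℝ (Fin n) → ℝ) (ρ : ℝ), Continuous χ ∧ (∀ y, 0 ≤ χ y ∧ χ y ≤ 1) ∧
      (∀ y, ‖y‖ ^ 2 ≤ 1 - h → χ y = 1) ∧ ρ < 1 ∧ (∀ y, ρ < ‖y‖ → χ y = 0) ∧
      ∀ x : EuclideanSpace ℝ (Fin n), ‖x‖ ≤ 1 - 2 * h → ∀ e : ℝ, 0 < e →
      ∃ W Bd : EuclideanSpace ℝ (Fin n) → ℝ,
        Continuous Bd ∧ (∀ y, y ≠ x → |W y| ≤ C * ‖x - y‖ ^ (-κ)) ∧ (∀ y, 1 ≤ ‖y‖ → W y = 0) ∧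
        (∀ y, |Bd y| ≤ C / h * ‖x - y‖ ^ (-((n : ℝ) - 1))) ∧
        (∀ y, Bd y ≠ 0 → 1 - h ≤ ‖y‖ ^ 2) ∧ (∀ y, ρ < ‖y‖ → Bd y = 0) ∧
        ∀ f : EuclideanSpace ℝ (Fin n) → ℂ, ContDiffOn ℝ 2 f (ball 0 1) →
          ∫ y, W y • laplacianC n f y =
          ∫ y, (Bd y + χ y * (‖x‖ ^ 2 *
            (2 * n * e * (1 - 2 * inner ℝ x y + ‖x‖ ^ 2 * ‖y‖ ^ 2 + e) ^ (-((n : ℝ) / 2) - 1)) -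
              2 * n * e * (‖x - y‖ ^ 2 + e) ^ (-((n : ℝ) / 2) - 1))) • f y := by
  have hnR : (2 : ℝ) ≤ n := by exact_mod_cast hn
  obtain ⟨θ, θ1, θ2, C, hC, dθ, dθ1, cθ2, θl, θr, θb⟩ := lsi_theta
  set K : ℝ := 4 ^ (κ / 2 + 1 - (n : ℝ) / 2) * (2 / κ) with hK
  have hK0 : 0 < K := by positivity
  refine ⟨K + (48 + 8 * n) * C, by positivity, fun h hh0 hh1 => ?_⟩
  set χ0 : ℝ → ℝ := fun t => θ ((1 - t) / h) with hχ0
  set χ1 : ℝ → ℝ := fun t => θ1 ((1 - t) / h) * (-1 / h) with hχ1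
  set χ2 : ℝ → ℝ := fun t => θ2 ((1 - t) / h) * (-1 / h) * (-1 / h) with hχ2
  have dl : ∀ t : ℝ, HasDerivAt (fun t => (1 - t) / h) (-1 / h) t := fun t =>
    ((hasDerivAt_id t).const_sub 1).div_const h
  have dχ0 : ∀ t, HasDerivAt χ0 (χ1 t) t := fun t => (dθ _).comp t (dl t)
  have dχ1 : ∀ t, HasDerivAt χ1 (χ2 t) t := fun t =>
    ((dθ1 _).comp t (dl t)).mul_const (-1 / h)
  have cχ2 : Continuous χ2 := by simp only [hχ2]; fun_prop
  have cχ0 : Continuous χ0 := continuous_iff_continuousAt.2 fun t => (dχ0 t).continuousAt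
  have cχ1 : Continuous χ1 := continuous_iff_continuousAt.2 fun t => (dχ1 t).continuousAt
  set ρ : ℝ := Real.sqrt (1 - h / 3) with hρ
  have hρsq : ρ ^ 2 = 1 - h / 3 := Real.sq_sqrt (by linarith)
  have hρ0 : 0 ≤ ρ := Real.sqrt_nonneg _
  have hρ1 : ρ < 1 := by nlinarith
  have hz : ∀ t, ρ ^ 2 < t → χ0 t = 0 ∧ χ1 t = 0 ∧ χ2 t = 0 := by
    intro t ht
    have : (1 - t) / h ≤ 1 / 3 := by rw [div_le_iff₀ hh0]; linarith
    obtain ⟨h1, h2, h3⟩ := θl _ this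
    simp [hχ0, hχ1, hχ2, h1, h2, h3]
  have ho : ∀ t, t ≤ 1 - h → χ0 t = 1 ∧ χ1 t = 0 ∧ χ2 t = 0 := by
    intro t ht
    have : 2 / 3 ≤ (1 - t) / h := by rw [le_div_iff₀ hh0]; linarith
    obtain ⟨h1, h2, h3⟩ := θr _ this
    simp [hχ0, hχ1, hχ2, h1, h2, h3]
  have hzn : ∀ y : EuclideanSpace ℝ (Fin n), ρ < ‖y‖ → ρ ^ 2 < ‖y‖ ^ 2 := fun y hy => by gcongr
  refine ⟨fun y => χ0 (‖y‖ ^ 2), ρ, cχ0.comp (by fun_prop), fun y => ⟨(θb _).1, (θb _).2.1⟩,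
    fun y hy => (ho _ hy).1, hρ1, fun y hy => (hz _ (hzn y hy)).1, fun x hx e he => ?_⟩
  obtain ⟨φ, hφ⟩ := lsi_phi (-((n : ℝ) / 2)) e he
  set φ1 : ℝ → ℝ := fun t => (t + e) ^ (-((n : ℝ) / 2)) with hφ1
  set φ2 : ℝ → ℝ := fun t => -((n : ℝ) / 2) * (t + e) ^ (-((n : ℝ) / 2) - 1) with hφ2
  have dφ1 : ∀ t, 0 ≤ t → HasDerivAt φ1 (φ2 t) t := by
    intro t ht
    have := ((hasDerivAt_id t).add_const e).rpow_const (p := -((n : ℝ) / 2))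
      (Or.inl (by simp only [id]; positivity))
    simpa [hφ2] using this
  have cφ2 : ∀ t, 0 ≤ t → ContinuousAt φ2 t := by
    intro t ht
    refine ContinuousAt.mul continuousAt_const ?_
    exact ContinuousAt.rpow_const (by fun_prop) (Or.inl (by positivity))
  set Q : EuclideanSpace ℝ (Fin n) → ℝ :=
    fun y => 1 + inner ℝ (-(2 : ℝ) • x) y + ‖x‖ ^ 2 * ‖y‖ ^ 2 with hQ
  set s : EuclideanSpace ℝ (Fin n) → ℝ :=
    fun y => ‖x‖ ^ 2 + inner ℝ (-(2 : ℝ) • x) y + 1 * ‖y‖ ^ 2 with hs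
  have eQ : ∀ y, Q y = 1 - 2 * inner ℝ x y + ‖x‖ ^ 2 * ‖y‖ ^ 2 := by
    intro y; simp only [hQ, inner_smul_left]; simp; ring
  have es' : ∀ y, s y = ‖x‖ ^ 2 - 2 * inner ℝ x y + ‖y‖ ^ 2 := by
    intro y; simp only [hs, inner_smul_left]; simp; ring
  have es : ∀ y, s y = ‖x - y‖ ^ 2 := by
    intro y; rw [es', norm_sub_sq_real]
  have hin : ∀ y, |inner ℝ x y| ≤ ‖x‖ * ‖y‖ := fun y => abs_real_inner_le_norm x y
  have hs0 : ∀ y, 0 ≤ s y := fun y => by rw [es]; positivity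
  have hQ0 : ∀ y, 0 ≤ Q y := fun y => by
    rw [eQ]
    nlinarith [sq_nonneg (1 - ‖x‖ * ‖y‖), le_abs_self (inner ℝ x y), hin y]
  have hx1 : ‖x‖ < 1 := by linarith
  have hQs : ∀ y, Q y - s y = (1 - ‖x‖ ^ 2) * (1 - ‖y‖ ^ 2) := fun y => by
    rw [eQ, es']; ring
  have hsQ : ∀ y, ‖y‖ ≤ 1 → s y ≤ Q y := fun y hy => by
    have := hQs y
    have h1 : 0 ≤ 1 - ‖x‖ ^ 2 := by nlinarith [norm_nonneg x]
    have h2 : 0 ≤ 1 - ‖y‖ ^ 2 := by nlinarith [norm_nonneg y]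
    nlinarith [mul_nonneg h1 h2]
  have hQ4 : ∀ y, ‖y‖ ≤ 1 → Q y ≤ 4 := fun y hy => by
    rw [eQ]
    have h1 : ‖x‖ * ‖y‖ ≤ 1 * 1 := mul_le_mul hx1.le hy (norm_nonneg _) zero_le_one
    have h2 : 0 ≤ ‖x‖ * ‖y‖ := by positivity
    nlinarith [neg_abs_le (inner ℝ x y), hin y]
  set Bd : EuclideanSpace ℝ (Fin n) → ℝ := fun y =>
    (4 * ‖y‖ ^ 2 * χ2 (‖y‖ ^ 2) + 2 * n * χ1 (‖y‖ ^ 2)) * (φ (Q y) - φ (s y)) +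
      8 * χ1 (‖y‖ ^ 2) * (φ1 (Q y) * (‖x‖ ^ 2 * ‖y‖ ^ 2 - inner ℝ x y) -
        φ1 (s y) * (‖y‖ ^ 2 - inner ℝ x y)) with hBd
  have cQ : Continuous Q := by simp only [hQ]; fun_prop
  have cs : Continuous s := by simp only [hs]; fun_prop
  have cT : Continuous (fun y : EuclideanSpace ℝ (Fin n) => ‖y‖ ^ 2) := by fun_prop
  have cc : ∀ (g : ℝ → ℝ) (P : EuclideanSpace ℝ (Fin n) → ℝ), (∀ t, 0 ≤ t → ContinuousAt g t) →
      Continuous P → (∀ y, 0 ≤ P y) → Continuous (fun y => g (P y)) := fun g P hg hP h0 =>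
    continuous_iff_continuousAt.2 fun y => ContinuousAt.comp (hg _ (h0 y)) hP.continuousAt
  have c1 := cc φ Q (fun t ht => (hφ t ht).continuousAt) cQ hQ0
  have c2 := cc φ s (fun t ht => (hφ t ht).continuousAt) cs hs0
  have c3 := cc φ1 Q (fun t ht => (dφ1 t ht).continuousAt) cQ hQ0
  have c4 := cc φ1 s (fun t ht => (dφ1 t ht).continuousAt) cs hs0
  have c8 : Continuous (fun y : EuclideanSpace ℝ (Fin n) => χ1 (‖y‖ ^ 2)) := cχ1.comp cT
  have c9 : Continuous (fun y : EuclideanSpace ℝ (Fin n) => χ2 (‖y‖ ^ 2)) := cχ2.comp cT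
  have ci : Continuous (fun y : EuclideanSpace ℝ (Fin n) => inner ℝ x y) := by fun_prop
  have hnb : 0 < (n : ℝ) / 2 := by linarith
  refine ⟨fun y => χ0 (‖y‖ ^ 2) * (φ (Q y) - φ (s y)), Bd, ?_, ?_, ?_, ?_, ?_, ?_, ?_⟩
  · exact ((((continuous_const.mul cT).mul c9).add (continuous_const.mul c8)).mul (c1.sub c2)).add
      ((continuous_const.mul c8).mul ((c3.mul ((continuous_const.mul cT).sub ci)).sub
        (c4.mul (cT.sub ci))))
  · intro y hy
    have hpos : 0 < ‖x - y‖ := norm_sub_pos_iff.2 (Ne.symm hy)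
    rcases le_or_gt ‖y‖ 1 with h1 | h1
    · obtain ⟨b0, -, b2⟩ := lsi_phi_bound ((n : ℝ) / 2) e κ he hnb φ hφ (s y) (Q y)
        (by rw [es]; positivity) (hsQ y h1) (hQ4 y h1) hκ0 (by linarith)
      have : s y ^ (-κ / 2) = ‖x - y‖ ^ (-κ) := by
        rw [es, ← Real.rpow_natCast, ← Real.rpow_mul (norm_nonneg _)]; congr 1; push_cast; ring
      rw [this] at b2
      have t0 := (θb ((1 - ‖y‖ ^ 2) / h)).1
      have t1 := (θb ((1 - ‖y‖ ^ 2) / h)).2.1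
      have e1 : 0 ≤ ‖x - y‖ ^ (-κ) := by positivity
      rw [abs_of_nonneg (mul_nonneg t0 b0)]
      calc χ0 (‖y‖ ^ 2) * (φ (Q y) - φ (s y)) ≤ 1 * (φ (Q y) - φ (s y)) :=
            mul_le_mul_of_nonneg_right t1 b0
        _ ≤ K * ‖x - y‖ ^ (-κ) := by rw [one_mul]; exact b2
        _ ≤ _ := by
          apply mul_le_mul_of_nonneg_right _ e1
          have : 0 ≤ (48 + 8 * n) * C := by positivity
          linarith
    · show |χ0 (‖y‖ ^ 2) * (φ (Q y) - φ (s y))| ≤ _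
      rw [(hz _ (hzn y (by linarith))).1, zero_mul, abs_zero]
      positivity
  · intro y hy
    simp only
    rw [(hz _ (hzn y (by linarith))).1, zero_mul]
  · intro y
    have rhs0 : 0 ≤ (K + (48 + 8 * n) * C) / h * ‖x - y‖ ^ (-((n : ℝ) - 1)) := by positivity
    by_cases hy : ‖y‖ ^ 2 ≤ 1 - h
    · simp only [hBd, (ho _ hy).2.1, (ho _ hy).2.2]
      simpa using rhs0
    by_cases hy1 : ρ < ‖y‖
    · simp only [hBd, (hz _ (hzn y hy1)).2.1, (hz _ (hzn y hy1)).2.2]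
      simpa using rhs0
    push Not at hy hy1
    have hy1' : ‖y‖ < 1 := lt_of_le_of_lt hy1 hρ1
    set d := ‖x - y‖ with hd
    have hyd : ‖y‖ ≤ ‖x‖ + d := by
      have := norm_sub_norm_le y x
      rw [norm_sub_rev] at this; linarith
    have hyy : ‖y‖ ^ 2 ≤ ‖y‖ := by
      rw [pow_two]; exact mul_le_of_le_one_left (norm_nonneg _) hy1'.le
    have hyl : 1 - h ≤ ‖y‖ := by linarith
    have hd1 : 1 - ‖x‖ ≤ 2 * d := by linarith
    have hd0 : 0 < d := by linarith
    obtain ⟨b0, b1, -⟩ := lsi_phi_bound ((n : ℝ) / 2) e κ he hnb φ hφ (s y) (Q y)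
        (by rw [es]; positivity) (hsQ y hy1'.le) (hQ4 y hy1'.le) hκ0 (by linarith)
    set D := d ^ (-((n : ℝ) - 1)) with hD
    have hD0 : 0 < D := by positivity
    have sD : s y ^ (-((n : ℝ) / 2)) * d = D := by
      rw [es, ← Real.rpow_natCast, ← Real.rpow_mul (norm_nonneg _), hD,
        ← Real.rpow_add_one hd0.ne']; congr 1; push_cast; ring
    have hQs' : Q y - s y ≤ 4 * h * d := by
      rw [hQs]
      have i1 : 1 - ‖x‖ ^ 2 ≤ 4 * d := by
        have : (1 - ‖x‖) * (1 - ‖x‖) ≥ 0 := mul_self_nonneg _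
        have e2 : (1 - ‖x‖) * (1 - ‖x‖) = 1 - 2 * ‖x‖ + ‖x‖ ^ 2 := by ring
        linarith
      have i2 : 1 - ‖y‖ ^ 2 ≤ h := by linarith
      have i3 : 0 ≤ 1 - ‖y‖ ^ 2 := by linarith
      calc _ ≤ 4 * d * h := mul_le_mul i1 i2 i3 (by positivity)
        _ = _ := by ring
    have hG : φ (Q y) - φ (s y) ≤ 4 * h * D := by
      refine b1.trans ?_
      have : 0 ≤ s y ^ (-((n : ℝ) / 2)) := Real.rpow_nonneg (hs0 y) _
      calc (Q y - s y) * s y ^ (-((n : ℝ) / 2)) ≤ (4 * h * d) * s y ^ (-((n : ℝ) / 2)) :=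
            mul_le_mul_of_nonneg_right hQs' this
        _ = 4 * h * D := by rw [← sD]; ring
    have hspos : 0 < s y := by rw [es]; positivity
    have hQpos : 0 < Q y := hspos.trans_le (hsQ y hy1'.le)
    have hF1 : |φ1 (s y) * (‖y‖ ^ 2 - inner ℝ x y)| ≤ D := by
      have j1 : φ1 (s y) ≤ s y ^ (-((n : ℝ) / 2)) :=
        Real.rpow_le_rpow_of_nonpos hspos (by linarith) (by linarith)
      have j0 : 0 ≤ φ1 (s y) := by simp only [hφ1]; positivity
      have j2 : |‖y‖ ^ 2 - inner ℝ x y| ≤ d := by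
        have : ‖y‖ ^ 2 - inner ℝ x y = inner ℝ (y - x) y := by
          rw [inner_sub_left, real_inner_self_eq_norm_sq]
        rw [this]
        refine (abs_real_inner_le_norm _ _).trans ?_
        rw [norm_sub_rev]
        exact mul_le_of_le_one_right (norm_nonneg _) hy1'.le
      rw [abs_mul, abs_of_nonneg j0, ← sD]
      exact mul_le_mul j1 j2 (abs_nonneg _) (j0.trans j1)
    have hF2 : |φ1 (Q y) * (‖x‖ ^ 2 * ‖y‖ ^ 2 - inner ℝ x y)| ≤ D := by
      have j0 : 0 ≤ φ1 (Q y) := by simp only [hφ1]; positivity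
      have j1 : φ1 (Q y) ≤ Q y ^ (-((n : ℝ) / 2)) :=
        Real.rpow_le_rpow_of_nonpos hQpos (by linarith) (by linarith)
      have j2 : |‖x‖ ^ 2 * ‖y‖ ^ 2 - inner ℝ x y| ≤ Real.sqrt (Q y) := by
        have : ‖x‖ ^ 2 * ‖y‖ ^ 2 - inner ℝ x y = inner ℝ (‖x‖ ^ 2 • y - x) y := by
          rw [inner_sub_left, inner_smul_left, real_inner_self_eq_norm_sq]; simp
        rw [this]
        refine (abs_real_inner_le_norm _ _).trans ?_
        have k1 : ‖‖x‖ ^ 2 • y - x‖ ≤ Real.sqrt (Q y) := by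
          apply Real.le_sqrt_of_sq_le
          rw [norm_sub_sq_real, norm_smul, inner_smul_left, real_inner_comm, norm_pow, norm_norm]
          have hQn := hQ0 y
          rw [eQ] at hQn ⊢
          have : ‖x‖ ^ 2 ≤ 1 := by nlinarith [norm_nonneg x]
          have k2 := mul_le_mul_of_nonneg_right this hQn
          simp only [conj_trivial]
          calc _ = ‖x‖ ^ 2 * (1 - 2 * inner ℝ x y + ‖x‖ ^ 2 * ‖y‖ ^ 2) := by ring
            _ ≤ _ := by rw [one_mul] at k2; exact k2
        have := mul_le_mul k1 hy1'.le (norm_nonneg _) (Real.sqrt_nonneg _)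
        linarith
      have j3 : Q y ^ (-((n : ℝ) / 2)) * Real.sqrt (Q y) ≤ D := by
        rw [Real.sqrt_eq_rpow, ← Real.rpow_add hQpos]
        have : D = s y ^ (-((n : ℝ) / 2) + 1 / 2) := by
          rw [es, ← Real.rpow_natCast, ← Real.rpow_mul (norm_nonneg _), hD]
          congr 1; push_cast; ring
        rw [this]
        exact Real.rpow_le_rpow_of_nonpos hspos (hsQ y hy1'.le) (by linarith)
      rw [abs_mul, abs_of_nonneg j0]
      refine le_trans ?_ j3
      exact mul_le_mul j1 j2 (abs_nonneg _) (j0.trans j1)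
    have t1 : |χ1 (‖y‖ ^ 2)| ≤ C / h := by
      simp only [hχ1]
      rw [abs_mul, abs_div, abs_neg, abs_one, abs_of_pos hh0, mul_one_div]
      exact div_le_div_of_nonneg_right (θb _).2.2.1 hh0.le
    have t2 : |χ2 (‖y‖ ^ 2)| ≤ C / h / h := by
      simp only [hχ2]
      rw [abs_mul, abs_mul, abs_div, abs_neg, abs_one, abs_of_pos hh0, mul_one_div, mul_one_div]
      exact div_le_div_of_nonneg_right (div_le_div_of_nonneg_right (θb _).2.2.2 hh0.le) hh0.le
    have p1 : |4 * ‖y‖ ^ 2 * χ2 (‖y‖ ^ 2) + 2 * n * χ1 (‖y‖ ^ 2)| ≤ 4 * (C / h / h) + 2 * n * (C / h) := by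
      refine (abs_add_le _ _).trans (add_le_add ?_ ?_)
      · rw [abs_mul, abs_of_nonneg (by positivity : 0 ≤ 4 * ‖y‖ ^ 2)]
        apply mul_le_mul _ t2 (abs_nonneg _) (by norm_num)
        linarith
      · rw [abs_mul, abs_of_nonneg (by positivity : (0 : ℝ) ≤ 2 * n)]
        exact mul_le_mul_of_nonneg_left t1 (by positivity)
    have hCh : 0 < C / h := by positivity
    calc |Bd y| ≤ (4 * (C / h / h) + 2 * n * (C / h)) * (4 * h * D) + 8 * (C / h) * (D + D) := by
          simp only [hBd]
          refine (abs_add_le _ _).trans (add_le_add ?_ ?_)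
          · rw [abs_mul, abs_of_nonneg b0]
            exact mul_le_mul p1 hG b0 (by positivity)
          · rw [abs_mul, abs_mul, abs_of_nonneg (by norm_num : (0 : ℝ) ≤ 8)]
            refine mul_le_mul (mul_le_mul_of_nonneg_left t1 (by norm_num)) ?_ (abs_nonneg _)
              (by positivity)
            exact (abs_sub _ _).trans (add_le_add hF2 hF1)
      _ = (16 * (C / h) + 8 * n * h * (C / h) + 16 * (C / h)) * D := by
          field_simp; ring
      _ ≤ _ := by
          apply mul_le_mul_of_nonneg_right _ hD0.le
          have : (K + (48 + 8 * n) * C) / h = K / h + 48 * (C / h) + 8 * n * (C / h) := by ring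
          rw [this]
          have q1 : 8 * n * h * (C / h) ≤ 8 * n * (C / h) := by
            have : 8 * (n : ℝ) * h ≤ 8 * n * 1 := by gcongr; linarith
            have := mul_le_mul_of_nonneg_right this hCh.le
            linarith
          have q2 : 0 < K / h := by positivity
          linarith
  · intro y hy
    by_contra hlt
    push Not at hlt
    apply hy
    simp [hBd, (ho _ hlt.le).2.1, (ho _ hlt.le).2.2]
  · intro y hy
    simp [hBd, (hz _ (hzn y hy)).2.1, (hz _ (hzn y hy)).2.2]
  · intro f hf
    rw [lsi_green_id n x χ0 χ1 χ2 dχ0 dχ1 cχ2 ρ hρ0 hρ1 hz φ φ1 φ2 hφ dφ1 cφ2 Q s hQ hs hQ0 hs0 f hf]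
    have hψ : ∀ t, 0 ≤ t → 4 * t * φ2 t + 2 * n * φ1 t =
        2 * n * e * (t + e) ^ (-((n : ℝ) / 2) - 1) := by
      intro t ht
      have h0 : 0 < t + e := by positivity
      have : φ1 t = (t + e) ^ (-((n : ℝ) / 2) - 1) * (t + e) := by
        simp only [hφ1]
        rw [← Real.rpow_add_one h0.ne']; congr 1; ring
      rw [this]
      simp only [hφ2]
      ring
    congr 1
    ext y
    rw [hψ _ (hQ0 y), hψ _ (hs0 y), ← es y, ← eQ y]

theorem lsi_delta (n : ℕ) : ∃ c₀ : ℝ, 0 < c₀ ∧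
    ∀ (g : EuclideanSpace ℝ (Fin n) → ℂ) (x : EuclideanSpace ℝ (Fin n)), Integrable g →
    ContinuousAt g x → Filter.Tendsto (fun c : ℝ =>
      ∫ y, ((c ^ 2)⁻¹ * (‖x - y‖ ^ 2 + (c ^ 2)⁻¹) ^ (-((n : ℝ) / 2) - 1)) • g y) Filter.atTop
      (nhds (c₀ • g x)) := by
  set P : EuclideanSpace ℝ (Fin n) → ℝ := fun z => (1 + ‖z‖ ^ 2) ^ (-((n : ℝ) / 2) - 1) with hP
  have hPi : Integrable P := by
    have := integrable_rpow_neg_one_add_norm_sq (E := EuclideanSpace ℝ (Fin n)) (μ := volume)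
      (r := (n : ℝ) + 2) (by simp)
    refine this.congr (Filter.Eventually.of_forall fun z => ?_)
    simp only [hP]; congr 1; ring
  have hPc : Continuous P := by
    refine Continuous.rpow_const (by fun_prop) fun z => Or.inl (by positivity)
  have hP0 : ∀ z, 0 < P z := fun z => by simp only [hP]; positivity
  set c₀ := ∫ z, P z with hc₀
  have hc0 : 0 < c₀ := by
    rw [hc₀, integral_pos_iff_support_of_nonneg (fun z => (hP0 z).le) hPi]
    have : Function.support P = Set.univ := by
      ext z; simp [(hP0 z).ne']
    rw [this]
    exact isOpen_univ.measure_pos _ ⟨0, trivial⟩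
  refine ⟨c₀, hc0, fun g x hg hgx => ?_⟩
  have key := tendsto_integral_comp_smul_smul_of_integrable'
    (μ := (volume : Measure (EuclideanSpace ℝ (Fin n)))) (φ := fun z => c₀⁻¹ * P z)
    (fun z => mul_nonneg (inv_nonneg.2 hc0.le) (hP0 z).le)
    (by rw [integral_const_mul, ← hc₀, inv_mul_cancel₀ hc0.ne'])
    (by
      have hb : Filter.Tendsto (fun z : EuclideanSpace ℝ (Fin n) => c₀⁻¹ * (1 + ‖z‖ ^ 2)⁻¹)
          (Bornology.cobounded _) (nhds 0) := by
        have h1 : Filter.Tendsto (fun z : EuclideanSpace ℝ (Fin n) => 1 + ‖z‖ ^ 2)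
            (Bornology.cobounded _) Filter.atTop :=
          Filter.tendsto_atTop_add_const_left _ _
            ((Filter.tendsto_pow_atTop two_ne_zero).comp tendsto_norm_cobounded_atTop)
        simpa using (tendsto_inv_atTop_zero.comp h1).const_mul c₀⁻¹
      refine squeeze_zero (fun z => ?_) (fun z => ?_) hb
      · have := hP0 z; positivity
      · rw [finrank_euclideanSpace, Fintype.card_fin]
        have h1 : ‖z‖ ^ n ≤ (1 + ‖z‖ ^ 2) ^ ((n : ℝ) / 2) := by
          have : ‖z‖ ^ n = (‖z‖ ^ 2) ^ ((n : ℝ) / 2) := by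
            rw [← Real.rpow_natCast, ← Real.rpow_natCast, ← Real.rpow_mul (norm_nonneg _)]
            congr 1; push_cast; ring
          rw [this]
          exact Real.rpow_le_rpow (by positivity) (by linarith) (by positivity)
        have h2 : (1 + ‖z‖ ^ 2) ^ ((n : ℝ) / 2) * P z = (1 + ‖z‖ ^ 2)⁻¹ := by
          simp only [hP]
          rw [← Real.rpow_add (by positivity), ← Real.rpow_neg_one]; congr 1; ring
        calc ‖z‖ ^ n * (c₀⁻¹ * P z) ≤ (1 + ‖z‖ ^ 2) ^ ((n : ℝ) / 2) * (c₀⁻¹ * P z) := by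
              apply mul_le_mul_of_nonneg_right h1
              have := hP0 z; positivity
          _ = c₀⁻¹ * (1 + ‖z‖ ^ 2)⁻¹ := by rw [← h2]; ring)
    hg hgx
  have key2 := key.const_smul c₀
  refine key2.congr' ?_
  filter_upwards [Filter.eventually_gt_atTop 0] with c hc
  rw [← integral_smul]
  congr 1
  ext1 y
  rw [smul_smul]
  congr 1
  rw [finrank_euclideanSpace, Fintype.card_fin]
  simp only [hP]
  have e1 : 1 + ‖c • (x - y)‖ ^ 2 = c ^ 2 * (‖x - y‖ ^ 2 + (c ^ 2)⁻¹) := by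
    rw [norm_smul, Real.norm_of_nonneg hc.le]; field_simp; ring
  have e2 : c ^ n * (c ^ 2) ^ (-((n : ℝ) / 2) - 1) = (c ^ 2)⁻¹ := by
    rw [← Real.rpow_natCast, ← Real.rpow_natCast, ← Real.rpow_mul hc.le, ← Real.rpow_add hc,
      ← Real.rpow_neg hc.le]
    congr 1; push_cast; ring
  rw [e1, Real.mul_rpow (by positivity) (by positivity), ← e2]
  field_simp

theorem lsi_rep1 (n : ℕ) (hn : 2 ≤ n) (κ : ℝ) (hκ0 : 0 < κ) (hκ : (n : ℝ) - 2 ≤ κ) :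
    ∃ C : ℝ, 0 ≤ C ∧ ∀ f : EuclideanSpace ℝ (Fin n) → ℂ, ContDiffOn ℝ 2 f (ball 0 1) →
    ∀ h : ℝ, 0 < h → h < 1 / 2 → ∀ x : EuclideanSpace ℝ (Fin n), ‖x‖ ≤ 1 - 2 * h →
      ‖f x‖ₑ ≤ ENNReal.ofReal (C / h) *
          (∫⁻ y in {y | 1 - h ≤ ‖y‖ ∧ ‖y‖ < 1}, edist x y ^ (-((n : ℝ) - 1)) * ‖f y‖ₑ) +
        ENNReal.ofReal C * ∫⁻ y in ball 0 1, edist x y ^ (-κ) * ‖laplacianC n f y‖ₑ := by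
  have hnR : (2 : ℝ) ≤ n := by exact_mod_cast hn
  obtain ⟨c₀, hc₀, hdelta⟩ := lsi_delta n
  obtain ⟨C, hC, hgreen⟩ := lsi_green n hn κ hκ0 hκ
  have hN : 0 < 2 * n * c₀ := by positivity
  refine ⟨C / (2 * n * c₀), by positivity, fun f hf h hh0 hh1 x hx => ?_⟩
  obtain ⟨χ, ρ, cχ, χb, χ1, hρ, χz, hG⟩ := hgreen h hh0 hh1
  have hxb : x ∈ ball (0 : EuclideanSpace ℝ (Fin n)) 1 := by
    rw [mem_ball_zero_iff]; linarith
  have hx1 : ‖x‖ < 1 := by linarith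
  have kern : ∀ (a : ℝ), 0 < a → ∀ y, ENNReal.ofReal (‖x - y‖ ^ (-a)) ≤ edist x y ^ (-a) := by
    intro a ha y
    rcases eq_or_ne x y with rfl | hne
    · rw [edist_self, ENNReal.zero_rpow_of_neg (by linarith)]; exact le_top
    · rw [edist_dist, dist_eq_norm, ENNReal.ofReal_rpow_of_pos (norm_sub_pos_iff.2 hne)]
  set S : Set (EuclideanSpace ℝ (Fin n)) := {y | 1 - h ≤ ‖y‖ ∧ ‖y‖ < 1} with hS
  have hSm : MeasurableSet S :=
    (measurableSet_le measurable_const measurable_norm).inter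
      (measurableSet_lt measurable_norm measurable_const)
  set X := ∫⁻ y in S, edist x y ^ (-((n : ℝ) - 1)) * ‖f y‖ₑ with hX
  set Y := ∫⁻ y in ball 0 1, edist x y ^ (-κ) * ‖laplacianC n f y‖ₑ with hY
  have hFi : Integrable (fun y => χ y • f y) := lsi_integrable_aux hρ cχ hf.continuousOn χz
  have hFc : ContinuousAt (fun y => χ y • f y) x :=
    cχ.continuousAt.smul (hf.continuousOn.continuousAt (isOpen_ball.mem_nhds hxb))
  have hlim := hdelta _ x hFi hFc
  have hχx : χ x = 1 := by
    apply χ1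
    nlinarith [norm_nonneg x]
  rw [hχx, one_smul] at hlim
  set q₀ : ℝ := (1 - ‖x‖) ^ 2 with hq₀
  have hq0 : 0 < q₀ := by have : 0 < 1 - ‖x‖ := by linarith
                          positivity
  set M : ℝ := ∫ y, (2 * n * q₀ ^ (-((n : ℝ) / 2) - 1)) * ‖χ y • f y‖ with hM
  have step : ∀ e : ℝ, 0 < e →
      ‖(2 * n : ℝ) • ∫ y, (e * (‖x - y‖ ^ 2 + e) ^ (-((n : ℝ) / 2) - 1)) • (χ y • f y)‖ₑ ≤
      ENNReal.ofReal (C / h) * X + ENNReal.ofReal C * Y + ENNReal.ofReal (e * M) := by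
    intro e he
    obtain ⟨W, Bd, cBd, Wb, Wz, Bb, Bs, Bz, hid⟩ := hG x hx e he
    have hid := hid f hf
    set Qf : EuclideanSpace ℝ (Fin n) → ℝ := fun y =>
      ‖x‖ ^ 2 * (2 * n * e * (1 - 2 * inner ℝ x y + ‖x‖ ^ 2 * ‖y‖ ^ 2 + e) ^ (-((n : ℝ) / 2) - 1))
      with hQf
    have hQn : ∀ y : EuclideanSpace ℝ (Fin n), 0 ≤ 1 - 2 * inner ℝ x y + ‖x‖ ^ 2 * ‖y‖ ^ 2 := by
      intro y
      nlinarith [sq_nonneg (1 - ‖x‖ * ‖y‖), le_abs_self (inner ℝ x y), abs_real_inner_le_norm x y]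
    have cQf : Continuous Qf := by
      refine continuous_const.mul (continuous_const.mul (Continuous.rpow_const (by fun_prop) ?_))
      intro y
      left
      have := hQn y
      positivity
    set sf : EuclideanSpace ℝ (Fin n) → ℝ := fun y =>
      e * (‖x - y‖ ^ 2 + e) ^ (-((n : ℝ) / 2) - 1) with hsf
    have csf : Continuous sf :=
      continuous_const.mul (Continuous.rpow_const (by fun_prop) fun y => Or.inl (by positivity))
    have i1 : Integrable (fun y => Bd y • f y) := lsi_integrable_aux hρ cBd hf.continuousOn Bz
    have i2 : Integrable (fun y => (χ y * Qf y) • f y) :=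
      lsi_integrable_aux hρ (cχ.mul cQf) hf.continuousOn (fun y hy => by rw [χz y hy, zero_mul])
    have i3 : Integrable (fun y => (χ y * sf y) • f y) :=
      lsi_integrable_aux hρ (cχ.mul csf) hf.continuousOn (fun y hy => by rw [χz y hy, zero_mul])
    have hsplit : ∫ y, W y • laplacianC n f y = (∫ y, Bd y • f y) + (∫ y, (χ y * Qf y) • f y) -
        (2 * n : ℝ) • ∫ y, (χ y * sf y) • f y := by
      have i12 : Integrable (fun y => Bd y • f y + (χ y * Qf y) • f y) := i1.add i2
      have i3' : Integrable (fun y => (2 * n : ℝ) • ((χ y * sf y) • f y)) := i3.smul (2 * n : ℝ)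
      rw [hid, ← integral_smul, ← integral_add i1 i2, ← integral_sub i12 i3']
      congr 1
      ext1 y
      simp only [hQf, hsf]
      rw [smul_smul, ← add_smul, ← sub_smul]
      congr 1
      ring
    have e1 : ∫ y, sf y • (χ y • f y) = ∫ y, (χ y * sf y) • f y := by
      congr 1; ext1 y; rw [smul_smul, mul_comm]
    have e2 : (2 * n : ℝ) • ∫ y, sf y • (χ y • f y) =
        (∫ y, Bd y • f y) - (∫ y, W y • laplacianC n f y) + (∫ y, (χ y * Qf y) • f y) := by
      rw [e1, hsplit]; abel
    rw [e2]
    refine (enorm_add_le _ _).trans (add_le_add ((enorm_sub_le).trans (add_le_add ?_ ?_)) ?_)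
    · refine (enorm_integral_le_lintegral_enorm _).trans ?_
      have hzero : ∀ y, y ∉ S → Bd y = 0 := by
        intro y hy
        by_contra hne
        apply hy
        have h1 := Bs y hne
        have h2 : ‖y‖ ≤ ρ := by
          by_contra h3; exact hne (Bz y (not_le.1 h3))
        have h3 : ‖y‖ < 1 := h2.trans_lt hρ
        refine ⟨?_, h3⟩
        nlinarith [norm_nonneg y]
      have : ∫⁻ y, ‖Bd y • f y‖ₑ = ∫⁻ y in S, ‖Bd y • f y‖ₑ := by
        rw [← lintegral_indicator hSm]
        congr 1; ext1 y
        by_cases hy : y ∈ S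
        · rw [Set.indicator_of_mem hy]
        · rw [Set.indicator_of_notMem hy, hzero y hy]; simp
      rw [this, hX, ← lintegral_const_mul' _ _ ENNReal.ofReal_ne_top]
      refine lintegral_mono fun y => ?_
      rw [enorm_smul, ← mul_assoc]
      gcongr
      rw [Real.enorm_eq_ofReal_abs]
      calc ENNReal.ofReal |Bd y| ≤ ENNReal.ofReal (C / h * ‖x - y‖ ^ (-((n : ℝ) - 1))) :=
            ENNReal.ofReal_le_ofReal (Bb y)
        _ = ENNReal.ofReal (C / h) * ENNReal.ofReal (‖x - y‖ ^ (-((n : ℝ) - 1))) :=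
            ENNReal.ofReal_mul (by positivity)
        _ ≤ _ := by gcongr; exact kern _ (by linarith) y
    · refine (enorm_integral_le_lintegral_enorm _).trans ?_
      have : ∫⁻ y, ‖W y • laplacianC n f y‖ₑ = ∫⁻ y in ball 0 1, ‖W y • laplacianC n f y‖ₑ := by
        rw [← lintegral_indicator measurableSet_ball]
        congr 1; ext1 y
        by_cases hy : y ∈ ball (0 : EuclideanSpace ℝ (Fin n)) 1
        · rw [Set.indicator_of_mem hy]
        · rw [Set.indicator_of_notMem hy, Wz y (by simpa using hy)]; simp
      rw [this, hY, ← lintegral_const_mul' _ _ ENNReal.ofReal_ne_top]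
      have hae : ∀ᵐ y ∂(volume.restrict (ball (0 : EuclideanSpace ℝ (Fin n)) 1)), y ≠ x := by
        have : NullSingletonClass (volume : Measure (EuclideanSpace ℝ (Fin n))) := by
          have : Nontrivial (EuclideanSpace ℝ (Fin n)) := by
            have : Nonempty (Fin n) := ⟨⟨0, by omega⟩⟩
            infer_instance
          infer_instance
        exact ae_restrict_of_ae (by simp [ae_iff])
      refine lintegral_mono_ae ?_
      filter_upwards [hae] with y hy
      rw [enorm_smul, ← mul_assoc]
      gcongr
      rw [Real.enorm_eq_ofReal_abs]
      calc ENNReal.ofReal |W y| ≤ ENNReal.ofReal (C * ‖x - y‖ ^ (-κ)) :=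
            ENNReal.ofReal_le_ofReal (Wb y hy)
        _ = ENNReal.ofReal C * ENNReal.ofReal (‖x - y‖ ^ (-κ)) :=
            ENNReal.ofReal_mul (by positivity)
        _ ≤ _ := by gcongr; exact kern _ hκ0 y
    · rw [← ofReal_norm_eq_enorm]
      refine ENNReal.ofReal_le_ofReal ?_
      rw [hM, ← integral_const_mul]
      refine norm_integral_le_of_norm_le ((hFi.norm.const_mul _).const_mul _)
        (Filter.Eventually.of_forall fun y => ?_)
      rcases lt_or_ge ρ ‖y‖ with hy | hy
      · simp [χz y hy]
      have hy1 : ‖y‖ < 1 := hy.trans_lt hρ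
      have hQlow : q₀ ≤ 1 - 2 * inner ℝ x y + ‖x‖ ^ 2 * ‖y‖ ^ 2 + e := by
        have a1 := le_abs_self (inner ℝ x y)
        have a2 := abs_real_inner_le_norm x y
        have a3 : ‖x‖ * ‖y‖ ≤ ‖x‖ := mul_le_of_le_one_right (norm_nonneg _) hy1.le
        have a4 : (1 - ‖x‖) ^ 2 ≤ (1 - ‖x‖ * ‖y‖) ^ 2 := by
          apply pow_le_pow_left₀ <;> linarith
        have a5 : (1 - ‖x‖ * ‖y‖) ^ 2 = 1 - 2 * (‖x‖ * ‖y‖) + ‖x‖ ^ 2 * ‖y‖ ^ 2 := by ring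
        linarith
      have hQu : (1 - 2 * inner ℝ x y + ‖x‖ ^ 2 * ‖y‖ ^ 2 + e) ^ (-((n : ℝ) / 2) - 1) ≤
          q₀ ^ (-((n : ℝ) / 2) - 1) :=
        Real.rpow_le_rpow_of_nonpos hq0 hQlow (by linarith)
      have hpos : 0 ≤ (1 - 2 * inner ℝ x y + ‖x‖ ^ 2 * ‖y‖ ^ 2 + e) ^ (-((n : ℝ) / 2) - 1) :=
        Real.rpow_nonneg (hq0.le.trans hQlow) _
      have hQf0 : 0 ≤ Qf y := by simp only [hQf]; positivity
      have hQf1 : Qf y ≤ e * (2 * n * q₀ ^ (-((n : ℝ) / 2) - 1)) := by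
        simp only [hQf]
        have b1 : ‖x‖ ^ 2 ≤ 1 := pow_le_one₀ (norm_nonneg _) hx1.le
        calc _ ≤ 1 * (2 * n * e * q₀ ^ (-((n : ℝ) / 2) - 1)) := by gcongr
          _ = _ := by ring
      rw [norm_smul, norm_smul, norm_mul, Real.norm_of_nonneg hQf0]
      calc ‖χ y‖ * Qf y * ‖f y‖ = Qf y * (‖χ y‖ * ‖f y‖) := by ring
        _ ≤ e * (2 * n * q₀ ^ (-((n : ℝ) / 2) - 1)) * (‖χ y‖ * ‖f y‖) := by gcongr
        _ = _ := by ring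
  have hlim2 : Filter.Tendsto (fun c : ℝ => ‖(2 * n : ℝ) • ∫ y, ((c ^ 2)⁻¹ *
      (‖x - y‖ ^ 2 + (c ^ 2)⁻¹) ^ (-((n : ℝ) / 2) - 1)) • (χ y • f y)‖ₑ) Filter.atTop
      (nhds ‖(2 * n : ℝ) • (c₀ • f x)‖ₑ) := (hlim.const_smul (2 * n : ℝ)).enorm
  have hlim3 : Filter.Tendsto (fun c : ℝ => ENNReal.ofReal (C / h) * X + ENNReal.ofReal C * Y +
      ENNReal.ofReal ((c ^ 2)⁻¹ * M)) Filter.atTop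
      (nhds (ENNReal.ofReal (C / h) * X + ENNReal.ofReal C * Y + 0)) := by
    refine Filter.Tendsto.const_add _ ?_
    rw [← ENNReal.ofReal_zero]
    refine ENNReal.tendsto_ofReal ?_
    have : Filter.Tendsto (fun c : ℝ => (c ^ 2)⁻¹) Filter.atTop (nhds 0) :=
      tendsto_inv_atTop_zero.comp (Filter.tendsto_pow_atTop two_ne_zero)
    simpa using this.mul_const M
  have fin := le_of_tendsto_of_tendsto hlim2 hlim3 (by
    filter_upwards [Filter.eventually_gt_atTop 0] with c hc
    exact step _ (by positivity))
  rw [add_zero, smul_smul, enorm_smul, Real.enorm_eq_ofReal hN.le] at fin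
  have hNne : ENNReal.ofReal (2 * n * c₀) ≠ 0 := (ENNReal.ofReal_pos.2 hN).ne'
  calc ‖f x‖ₑ = (ENNReal.ofReal (2 * n * c₀))⁻¹ * (ENNReal.ofReal (2 * n * c₀) * ‖f x‖ₑ) := by
        rw [← mul_assoc, ENNReal.inv_mul_cancel hNne ENNReal.ofReal_ne_top, one_mul]
    _ ≤ (ENNReal.ofReal (2 * n * c₀))⁻¹ * (ENNReal.ofReal (C / h) * X + ENNReal.ofReal C * Y) := by
        gcongr
    _ = _ := by
        rw [mul_add, ← mul_assoc, ← mul_assoc, ← ENNReal.ofReal_inv_of_pos hN,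
          ← ENNReal.ofReal_mul (by positivity), ← ENNReal.ofReal_mul (by positivity)]
        congr 3
        · field_simp
        · field_simp

theorem lsiSphere_ae (n : ℕ) : ∀ᵐ w ∂(lsiSphere n), ‖w‖ = 1 := by
  unfold lsiSphere
  rw [ae_map_iff measurable_subtype_coe.aemeasurable
    (measurableSet_eq_fun measurable_norm measurable_const)]
  exact Filter.Eventually.of_forall fun w => by simpa using w.2

theorem lsi_rep2 (n : ℕ) (hn : 2 ≤ n) (κ : ℝ) (hκ0 : 0 < κ) (hκ : (n : ℝ) - 2 ≤ κ) :
    ∃ C : ℝ, 0 ≤ C ∧ ∀ f : EuclideanSpace ℝ (Fin n) → ℂ, ContinuousOn f (closedBall 0 1) →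
    ContDiffOn ℝ 2 f (ball 0 1) → ∀ x ∈ ball (0 : EuclideanSpace ℝ (Fin n)) 1,
      ‖f x‖ₑ ≤ ENNReal.ofReal C *
          (∫⁻ w, edist x w ^ (-((n : ℝ) - 1)) * ‖f w‖ₑ ∂(lsiSphere n)) +
        ENNReal.ofReal C * ∫⁻ y in ball 0 1, edist x y ^ (-κ) * ‖laplacianC n f y‖ₑ := by
  have hnR : (2 : ℝ) ≤ n := by exact_mod_cast hn
  classical
  obtain ⟨C, hC, hrep⟩ := lsi_rep1 n hn κ hκ0 hκ
  have h2 : (1 : ℝ) ≤ 2 ^ ((n : ℝ) - 1) := Real.one_le_rpow (by norm_num) (by linarith)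
  refine ⟨C * 2 ^ ((n : ℝ) - 1), by positivity, fun f hfc hf x hx => ?_⟩
  have hx1 : ‖x‖ < 1 := by simpa using hx
  set Y := ∫⁻ y in ball 0 1, edist x y ^ (-κ) * ‖laplacianC n f y‖ₑ with hY
  set f' := (closedBall (0 : EuclideanSpace ℝ (Fin n)) 1).piecewise f (fun _ => 0) with hf'
  have mf' : Measurable f' := hfc.measurable_piecewise continuousOn_const measurableSet_closedBall
  have hff : ∀ w : EuclideanSpace ℝ (Fin n), ‖w‖ = 1 → f' w = f w := fun w hw => by
    rw [hf', Set.piecewise_eq_of_mem _ _ _ (by simp [hw])]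
  set K : EuclideanSpace ℝ (Fin n) → ℝ≥0∞ := fun w => edist x w ^ (-((n : ℝ) - 1)) with hK
  have mK : Measurable K := by
    simp only [hK]
    exact (measurable_edist_right).pow_const _
  have hI : ∫⁻ w, K w * ‖f w‖ₑ ∂(lsiSphere n) = ∫⁻ w, K w * ‖f' w‖ₑ ∂(lsiSphere n) := by
    refine lintegral_congr_ae ?_
    filter_upwards [lsiSphere_ae n] with w hw
    rw [hff w hw]
  have hKfin : ∫⁻ w, K w ∂(lsiSphere n) ≠ ∞ := by
    have hb : ∫⁻ w, K w ∂(lsiSphere n) ≤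
        ∫⁻ w, ENNReal.ofReal (1 - ‖x‖) ^ (-((n : ℝ) - 1)) ∂(lsiSphere n) := by
      refine lintegral_mono_ae ?_
      filter_upwards [lsiSphere_ae n] with w hw
      simp only [hK]
      have hd : 1 - ‖x‖ ≤ dist x w := by
        rw [dist_comm, dist_eq_norm, ← hw]
        exact norm_sub_norm_le _ _
      rw [edist_dist, ENNReal.ofReal_rpow_of_pos (by linarith),
        ENNReal.ofReal_rpow_of_pos (by linarith)]
      exact ENNReal.ofReal_le_ofReal
        (Real.rpow_le_rpow_of_nonpos (by linarith) hd (by linarith))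
    refine ne_top_of_le_ne_top ?_ hb
    rw [lintegral_const]
    refine ENNReal.mul_ne_top ?_ (measure_ne_top _ _)
    rw [ENNReal.ofReal_rpow_of_pos (by linarith)]
    exact ENNReal.ofReal_ne_top
  have step : ∀ η : ℝ, 0 < η → ‖f x‖ₑ ≤ ENNReal.ofReal (C * 2 ^ ((n : ℝ) - 1)) *
      (∫⁻ w, K w * ‖f' w‖ₑ ∂(lsiSphere n) + ENNReal.ofReal η * ∫⁻ w, K w ∂(lsiSphere n)) +
      ENNReal.ofReal C * Y := by
    intro η hη
    have huc := (isCompact_closedBall (0 : EuclideanSpace ℝ (Fin n)) 1).uniformContinuousOn_of_continuous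
      hfc
    rw [Metric.uniformContinuousOn_iff] at huc
    obtain ⟨δ, hδ, huc⟩ := huc η hη
    set h := min (δ / 2) (min ((1 - ‖x‖) / 2) (1 / 4)) with hh
    have hh0 : 0 < h := lt_min (by linarith) (lt_min (by linarith) (by norm_num))
    have hhδ : h < δ := (min_le_left _ _).trans_lt (by linarith)
    have hhx : h ≤ (1 - ‖x‖) / 2 := (min_le_right _ _).trans (min_le_left _ _)
    have hh4 : h ≤ 1 / 4 := (min_le_right _ _).trans (min_le_right _ _)
    have h0 := hrep f hf h hh0 (by linarith) x (by linarith)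
    refine h0.trans (add_le_add ?_ le_rfl)
    set Φ : EuclideanSpace ℝ (Fin n) → ℝ≥0∞ := fun w =>
      ENNReal.ofReal (2 ^ ((n : ℝ) - 1)) * (K w * (‖f' w‖ₑ + ENNReal.ofReal η)) with hΦ
    have mΦ : Measurable Φ :=
      (mK.mul (mf'.enorm.add_const _)).const_mul _
    have hsh := lsi_shell n (1 - h) (by linarith) (by linarith) Φ mΦ
    have hle : ∫⁻ y in {y | 1 - h ≤ ‖y‖ ∧ ‖y‖ < 1}, edist x y ^ (-((n : ℝ) - 1)) * ‖f y‖ₑ ≤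
        ∫⁻ y in {y : EuclideanSpace ℝ (Fin n) | 1 - h ≤ ‖y‖ ∧ ‖y‖ < 1}, Φ (‖y‖⁻¹ • y) := by
      refine setLIntegral_mono' ((measurableSet_le measurable_const measurable_norm).inter
        (measurableSet_lt measurable_norm measurable_const)) fun y hy => ?_
      obtain ⟨hy1, hy2⟩ := hy
      have hy0 : 0 < ‖y‖ := by linarith
      set ω := ‖y‖⁻¹ • y with hω
      have hω1 : ‖ω‖ = 1 := by
        rw [hω, norm_smul, norm_inv, norm_norm, inv_mul_cancel₀ hy0.ne']
      have hd : dist y ω = 1 - ‖y‖ := by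
        have e1 : ω - y = (‖y‖⁻¹ - 1) • y := by rw [sub_smul, one_smul]
        have e2 : 0 ≤ ‖y‖⁻¹ - 1 := sub_nonneg.2 ((one_le_inv₀ hy0).2 hy2.le)
        rw [dist_comm, dist_eq_norm, e1, norm_smul, Real.norm_of_nonneg e2, sub_mul,
          inv_mul_cancel₀ hy0.ne', one_mul]
      have hxy : h ≤ dist x y := by
        rw [dist_comm, dist_eq_norm]
        have := norm_sub_norm_le y x
        linarith
      have hxω : dist x ω ≤ 2 * dist x y := by
        have := dist_triangle x y ω
        linarith
      have hK1 : edist x y ^ (-((n : ℝ) - 1)) ≤ ENNReal.ofReal (2 ^ ((n : ℝ) - 1)) * K ω := by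
        have hp : 0 < dist x y := by linarith
        have hpω : 0 < dist x ω := by
          rw [dist_comm, dist_eq_norm]
          have := norm_sub_norm_le ω x
          linarith
        simp only [hK]
        rw [edist_dist, edist_dist, ENNReal.ofReal_rpow_of_pos hp, ENNReal.ofReal_rpow_of_pos hpω,
          ← ENNReal.ofReal_mul (by positivity)]
        refine ENNReal.ofReal_le_ofReal ?_
        have e3 : (2 : ℝ) ^ ((n : ℝ) - 1) * (2 * dist x y) ^ (-((n : ℝ) - 1)) =
            dist x y ^ (-((n : ℝ) - 1)) := by
          rw [Real.mul_rpow (by norm_num) hp.le, ← mul_assoc, ← Real.rpow_add (by norm_num)]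
          simp
        rw [← e3]
        gcongr ?_ * ?_
        exact Real.rpow_le_rpow_of_nonpos hpω hxω (by linarith)
      have hf1 : ‖f y‖ₑ ≤ ‖f' ω‖ₑ + ENNReal.ofReal η := by
        rw [hff ω hω1]
        have := huc y (by simpa using hy2.le) ω (by simp [hω1]) (by linarith)
        have e4 : f y = f ω + (f y - f ω) := by ring
        rw [e4]
        refine (enorm_add_le _ _).trans (add_le_add le_rfl ?_)
        rw [← ofReal_norm, ← dist_eq_norm]
        exact ENNReal.ofReal_le_ofReal this.le
      simp only [hΦ]
      rw [← mul_assoc]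
      exact mul_le_mul' hK1 hf1
    have hΦi : ∫⁻ w, Φ w ∂(lsiSphere n) = ENNReal.ofReal (2 ^ ((n : ℝ) - 1)) *
        (∫⁻ w, K w * ‖f' w‖ₑ ∂(lsiSphere n) + ENNReal.ofReal η * ∫⁻ w, K w ∂(lsiSphere n)) := by
      simp only [hΦ]
      rw [lintegral_const_mul' _ _ ENNReal.ofReal_ne_top]
      congr 1
      simp only [mul_add]
      have mm : Measurable (fun w => K w * ‖f' w‖ₑ) := mK.mul mf'.enorm
      rw [lintegral_add_left mm, lintegral_mul_const _ mK, mul_comm (∫⁻ w, K w ∂(lsiSphere n))]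
    calc _ ≤ ENNReal.ofReal (C / h) * (ENNReal.ofReal (1 - (1 - h)) * ∫⁻ w, Φ w ∂(lsiSphere n)) :=
          mul_le_mul' le_rfl (hle.trans hsh)
      _ = _ := by
          rw [hΦi, ← mul_assoc, ← mul_assoc, ← ENNReal.ofReal_mul (by positivity),
            ← ENNReal.ofReal_mul (by rw [sub_sub_cancel]; positivity)]
          congr 2
          field_simp
          ring
  have hlim : Filter.Tendsto (fun η : ℝ => ENNReal.ofReal (C * 2 ^ ((n : ℝ) - 1)) *
      (∫⁻ w, K w * ‖f' w‖ₑ ∂(lsiSphere n) + ENNReal.ofReal η * ∫⁻ w, K w ∂(lsiSphere n)) +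
      ENNReal.ofReal C * Y) (nhdsWithin 0 (Set.Ioi 0)) (nhds (ENNReal.ofReal (C * 2 ^ ((n : ℝ) - 1)) *
      (∫⁻ w, K w * ‖f' w‖ₑ ∂(lsiSphere n) + 0) +
      ENNReal.ofReal C * Y)) := by
    refine Filter.Tendsto.add_const _ (ENNReal.Tendsto.const_mul (Filter.Tendsto.const_add _ ?_)
      (Or.inr ENNReal.ofReal_ne_top))
    have : Filter.Tendsto (fun η : ℝ => ENNReal.ofReal η) (nhdsWithin 0 (Set.Ioi 0)) (nhds 0) := by
      rw [← ENNReal.ofReal_zero]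
      exact ENNReal.tendsto_ofReal (tendsto_nhdsWithin_of_tendsto_nhds Filter.tendsto_id)
    simpa using ENNReal.Tendsto.mul_const this (Or.inr hKfin)
  have fin := ge_of_tendsto hlim (by
    filter_upwards [self_mem_nhdsWithin] with η hη using step η hη)
  rw [add_zero] at fin
  rw [hI]
  refine fin.trans (add_le_add le_rfl ?_)
  gcongr
  nlinarith

theorem lsi_const {X : Type*} [MeasurableSpace X] (μ : Measure X) (c : ℝ≥0∞) (hc : c ≠ ∞) (q : ℝ)
    (hq : 0 < q) (h : X → ℝ≥0∞) :
    (∫⁻ x, (c * h x) ^ q ∂μ) ^ (1 / q) = c * (∫⁻ x, h x ^ q ∂μ) ^ (1 / q) := by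
  simp only [ENNReal.mul_rpow_of_nonneg _ _ hq.le]
  rw [lintegral_const_mul' _ _ (ENNReal.rpow_ne_top_of_nonneg hq.le hc),
    ENNReal.mul_rpow_of_nonneg _ _ (by positivity), ← ENNReal.rpow_mul,
    mul_one_div_cancel hq.ne', ENNReal.rpow_one]

theorem lsi_unit (n : ℕ) (hn : 2 ≤ n) (p q r : ℝ) (hp : 1 ≤ p) (hq : 1 ≤ q) (hr : 1 ≤ r)
    (hqp : q * (n - 2 * p) < n * p) (hqr : q * (n - 1) < n * r) :
    ∃ M : ℝ≥0∞, M ≠ ∞ ∧ ∀ f g : EuclideanSpace ℝ (Fin n) → ℂ,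
      ContinuousOn f (closedBall 0 1) → ContDiffOn ℝ 2 f (ball 0 1) →
      ContinuousOn g (closedBall 0 1) →
      (∀ x ∈ ball 0 1, g x = laplacianC n f x) →
      (∫⁻ x in ball 0 1, ‖f x‖ₑ ^ q) ^ (1 / q) ≤
        M * (∫⁻ x in ball 0 1, ‖g x‖ₑ ^ p) ^ (1 / p) +
        M * (∫⁻ w, ‖f w‖ₑ ^ r ∂(lsiSphere n)) ^ (1 / r) := by
  classical
  have hnR : (2 : ℝ) ≤ n := by exact_mod_cast hn
  have hp0 : 0 < p := by linarith
  have hq0 : 0 < q := by linarith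
  have hr0 : 0 < r := by linarith
  set T : ℝ := n * (1 - 1 / p) + n / max p q with hT
  have hm0 : 0 < max p q := lt_max_of_lt_left hp0
  have hm1 : 0 < max r q := lt_max_of_lt_left hr0
  have h1p : 0 ≤ 1 - 1 / p := by
    rw [sub_nonneg, div_le_one hp0]; exact hp
  have hT0 : 0 < T := by positivity
  have hT2 : (n : ℝ) - 2 < T := by
    have : (n : ℝ) / p - n / max p q < 2 := by
      rcases le_total p q with h | h
      · rw [max_eq_right h, div_sub_div _ _ hp0.ne' hq0.ne', div_lt_iff₀ (by positivity)]
        linarith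
      · rw [max_eq_left h]; simp
    have e : T = n - (n : ℝ) / p + n / max p q := by rw [hT]; ring
    linarith
  set κ := max ((n : ℝ) - 2) (T / 2) with hκ
  have hκ0 : 0 < κ := lt_max_of_lt_right (by linarith)
  have hκ2 : (n : ℝ) - 2 ≤ κ := le_max_left _ _
  have hκT : κ < T := max_lt hT2 (by linarith)
  have hS : (n : ℝ) - 1 < ((n : ℝ) - 1) * (1 - 1 / r) + n / max r q := by
    have : ((n : ℝ) - 1) / r < n / max r q := by
      rcases le_total r q with h | h
      · rw [max_eq_right h, div_lt_div_iff₀ hr0 hq0]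
        linarith
      · rw [max_eq_left h]
        gcongr
        linarith
    have e : ((n : ℝ) - 1) * (1 - 1 / r) = (n : ℝ) - 1 - ((n : ℝ) - 1) / r := by ring
    linarith
  obtain ⟨C, hC, hrep⟩ := lsi_rep2 n hn κ hκ0 hκ2
  obtain ⟨Cs, hCs, hsph⟩ := lsiSphere_closedBall n hn
  set μ := (volume : Measure (EuclideanSpace ℝ (Fin n))).restrict (ball 0 1) with hμ
  have : IsFiniteMeasure μ := ⟨by rw [hμ, Measure.restrict_apply_univ]; exact measure_ball_lt_top⟩
  set Cb := (volume (ball (0 : EuclideanSpace ℝ (Fin n)) 1)).toReal with hCb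
  have hCb0 : 0 ≤ Cb := ENNReal.toReal_nonneg
  have hμb : ∀ (x : EuclideanSpace ℝ (Fin n)) (t : ℝ), 0 < t →
      μ (closedBall x t) ≤ ENNReal.ofReal ((Cb + Cs) * t ^ (n : ℝ)) := by
    intro x t ht
    refine (Measure.restrict_apply_le _ _).trans ?_
    rw [Measure.addHaar_closedBall _ _ ht.le, finrank_euclideanSpace, Fintype.card_fin,
      Real.rpow_natCast]
    have : volume (ball (0 : EuclideanSpace ℝ (Fin n)) 1) = ENNReal.ofReal Cb :=
      (ENNReal.ofReal_toReal measure_ball_lt_top.ne).symm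
    rw [this, ← ENNReal.ofReal_mul (by positivity), mul_comm]
    exact ENNReal.ofReal_le_ofReal (by gcongr; linarith)
  have hνb : ∀ (x : EuclideanSpace ℝ (Fin n)) (t : ℝ), 0 < t →
      lsiSphere n (closedBall x t) ≤ ENNReal.ofReal ((Cb + Cs) * t ^ ((n : ℝ) - 1)) := by
    intro x t ht
    refine (hsph x t ht).trans (ENNReal.ofReal_le_ofReal ?_)
    have : 0 ≤ t ^ ((n : ℝ) - 1) := by positivity
    nlinarith
  obtain ⟨M1, hM1, hY1⟩ := lsi_young μ μ n n (Cb + Cs) κ p q (by positivity) (by linarith)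
    (by linarith) hμb hμb hp hq hκ0.le hκT
  obtain ⟨M2, hM2, hY2⟩ := lsi_young μ (lsiSphere n) n ((n : ℝ) - 1) (Cb + Cs) ((n : ℝ) - 1) r q
    (by positivity) (by linarith) (by linarith) hμb hνb hr hq (by linarith) hS
  refine ⟨ENNReal.ofReal C * (M1 + M2),
    ENNReal.mul_ne_top ENNReal.ofReal_ne_top (ENNReal.add_ne_top.2 ⟨hM1, hM2⟩), ?_⟩
  intro f g hfc hf hgc hg
  set f' := (closedBall (0 : EuclideanSpace ℝ (Fin n)) 1).piecewise f (fun _ => 0) with hf'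
  have mf' : Measurable f' := hfc.measurable_piecewise continuousOn_const measurableSet_closedBall
  have hff : ∀ᵐ w ∂(lsiSphere n), f' w = f w := by
    filter_upwards [lsiSphere_ae n] with w hw
    rw [hf', Set.piecewise_eq_of_mem _ _ _ (by simp [hw])]
  set g' := (closedBall (0 : EuclideanSpace ℝ (Fin n)) 1).piecewise g (fun _ => 0) with hg'
  have mg' : Measurable g' := hgc.measurable_piecewise continuousOn_const measurableSet_closedBall
  have hgg : ∀ x ∈ ball (0 : EuclideanSpace ℝ (Fin n)) 1, g' x = g x := fun x hx => by
    rw [hg', Set.piecewise_eq_of_mem _ _ _ (ball_subset_closedBall hx)]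
  set A : EuclideanSpace ℝ (Fin n) → ℝ≥0∞ := fun x =>
    ∫⁻ w, edist x w ^ (-((n : ℝ) - 1)) * ‖f' w‖ₑ ∂(lsiSphere n) with hA
  set B : EuclideanSpace ℝ (Fin n) → ℝ≥0∞ := fun x =>
    ∫⁻ y, edist x y ^ (-κ) * ‖g' y‖ₑ ∂μ with hB
  have mA : Measurable A := by
    refine Measurable.lintegral_prod_right' (f := fun z : EuclideanSpace ℝ (Fin n) ×
      EuclideanSpace ℝ (Fin n) => edist z.1 z.2 ^ (-((n : ℝ) - 1)) * ‖f' z.2‖ₑ) ?_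
    exact (measurable_edist.pow_const _).mul (mf'.comp measurable_snd).enorm
  have mB : Measurable B := by
    refine Measurable.lintegral_prod_right' (f := fun z : EuclideanSpace ℝ (Fin n) ×
      EuclideanSpace ℝ (Fin n) => edist z.1 z.2 ^ (-κ) * ‖g' z.2‖ₑ) ?_
    exact (measurable_edist.pow_const _).mul (mg'.comp measurable_snd).enorm
  have hpt : ∀ x ∈ ball (0 : EuclideanSpace ℝ (Fin n)) 1,
      ‖f x‖ₑ ≤ ENNReal.ofReal C * (A + B) x := by
    intro x hx
    rw [Pi.add_apply, mul_add]
    refine (hrep f hfc hf x hx).trans (le_of_eq ?_)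
    congr 2
    · refine lintegral_congr_ae ?_
      filter_upwards [hff] with w hw
      rw [hw]
    · refine setLIntegral_congr_fun measurableSet_ball fun y hy => ?_
      rw [hgg y hy, hg y hy]
  have s1 : (∫⁻ x in ball 0 1, ‖f x‖ₑ ^ q) ^ (1 / q) ≤
      ENNReal.ofReal C * (∫⁻ x, (A + B) x ^ q ∂μ) ^ (1 / q) := by
    rw [← lsi_const _ _ ENNReal.ofReal_ne_top _ hq0]
    refine ENNReal.rpow_le_rpow ?_ (by positivity)
    exact setLIntegral_mono' measurableSet_ball fun x hx =>
      ENNReal.rpow_le_rpow (hpt x hx) hq0.le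
  have s2 := ENNReal.lintegral_Lp_add_le (μ := μ) mA.aemeasurable mB.aemeasurable hq
  have s3 : (∫⁻ x, A x ^ q ∂μ) ^ (1 / q) ≤ M2 * (∫⁻ w, ‖f w‖ₑ ^ r ∂(lsiSphere n)) ^ (1 / r) := by
    refine (hY2 (fun w => ‖f' w‖ₑ) mf'.enorm.aemeasurable).trans (le_of_eq ?_)
    congr 2
    refine lintegral_congr_ae ?_
    filter_upwards [hff] with w hw
    rw [hw]
  have s4 : (∫⁻ x, B x ^ q ∂μ) ^ (1 / q) ≤ M1 * (∫⁻ x in ball 0 1, ‖g x‖ₑ ^ p) ^ (1 / p) := by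
    refine (hY1 (fun w => ‖g' w‖ₑ) mg'.enorm.aemeasurable).trans (le_of_eq ?_)
    congr 2
    refine setLIntegral_congr_fun measurableSet_ball fun y hy => ?_
    rw [hgg y hy]
  refine s1.trans ?_
  refine (mul_le_mul' le_rfl (s2.trans (add_le_add s3 s4))).trans ?_
  rw [mul_add, add_comm, ← mul_assoc, ← mul_assoc]
  gcongr
  · exact le_self_add
  · exact le_add_self

theorem lsi_scale_lap (n : ℕ) (x₀ : EuclideanSpace ℝ (Fin n)) (R : ℝ)
    (f : EuclideanSpace ℝ (Fin n) → ℂ) (z : EuclideanSpace ℝ (Fin n)) :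
    laplacianC n (fun z => f (x₀ + R • z)) z = (R ^ 2) • laplacianC n f (x₀ + R • z) := by
  have key : ∀ {F : Type} [NormedAddCommGroup F] [NormedSpace ℝ F]
      (u : EuclideanSpace ℝ (Fin n) → F) (y : EuclideanSpace ℝ (Fin n)),
      fderiv ℝ (fun z => u (x₀ + R • z)) y = R • fderiv ℝ u (x₀ + R • y) := by
    intro F _ _ u y
    have h1 := fderiv_comp_smul (𝕜 := ℝ) (f := fun z => u (x₀ + z)) (c := R) (x := y)
    rw [fderiv_comp_add_left] at h1
    exact h1
  unfold laplacianC
  rw [Finset.smul_sum]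
  refine Finset.sum_congr rfl fun i _ => ?_
  have e : (fun y => fderiv ℝ (fun z => f (x₀ + R • z)) y (EuclideanSpace.single i 1)) =
      fun y => (fun w => R • fderiv ℝ f w (EuclideanSpace.single i 1)) (x₀ + R • y) := by
    ext1 y; rw [key f y]; rfl
  rw [e, key (fun w => R • fderiv ℝ f w (EuclideanSpace.single i 1)) z]
  have e2 : fderiv ℝ (fun w => R • fderiv ℝ f w (EuclideanSpace.single i 1)) =
      R • fderiv ℝ (fun w => fderiv ℝ f w (EuclideanSpace.single i 1)) :=
    fderiv_const_smul_field (f := fun w => fderiv ℝ f w (EuclideanSpace.single i 1)) R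
  rw [e2]
  simp only [Pi.smul_apply, ContinuousLinearMap.smul_apply, smul_smul]
  rw [pow_two]

theorem lsi_scale_vol (n : ℕ) (x₀ : EuclideanSpace ℝ (Fin n)) (R : ℝ) (hR : 0 < R)
    (Φ : EuclideanSpace ℝ (Fin n) → ℝ≥0∞) :
    ∫⁻ z in ball 0 1, Φ (x₀ + R • z) = ENNReal.ofReal ((R ^ n)⁻¹) * ∫⁻ x in ball x₀ R, Φ x := by
  set T : EuclideanSpace ℝ (Fin n) ≃ₜ EuclideanSpace ℝ (Fin n) :=
    (Homeomorph.smulOfNeZero R hR.ne').trans (Homeomorph.addLeft x₀) with hT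
  have hTe : ∀ z, T z = x₀ + R • z := fun z => rfl
  have hmap : Measure.map T volume = ENNReal.ofReal ((R ^ n)⁻¹) •
      (volume : Measure (EuclideanSpace ℝ (Fin n))) := by
    have : (T : EuclideanSpace ℝ (Fin n) → EuclideanSpace ℝ (Fin n)) =
      (fun y => x₀ + y) ∘ (fun z => R • z) := rfl
    rw [this, ← Measure.map_map (by fun_prop) (by fun_prop), Measure.map_addHaar_smul _ hR.ne',
      Measure.map_smul, map_add_left_eq_self, finrank_euclideanSpace, Fintype.card_fin,
      abs_of_pos (by positivity)]
  have hpre : T ⁻¹' (ball x₀ R) = ball 0 1 := by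
    ext z
    simp only [Set.mem_preimage, hTe, mem_ball, dist_eq_norm, add_sub_cancel_left, sub_zero,
      norm_smul, Real.norm_of_nonneg hR.le]
    constructor
    · intro h; nlinarith
    · intro h; nlinarith
  have h1 : ∫⁻ x in ball x₀ R, Φ x ∂(Measure.map T volume) = ∫⁻ z in ball 0 1, Φ (T z) := by
    rw [T.measurableEmbedding.restrict_map, T.measurableEmbedding.lintegral_map, hpre]
  rw [hmap, Measure.restrict_smul, lintegral_smul_measure] at h1
  exact h1.symm

theorem lsi_scale_sphere (n : ℕ) (hn : 2 ≤ n) (x₀ : EuclideanSpace ℝ (Fin n)) (R : ℝ)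
    (hR : 0 < R) : ∃ C : ℝ≥0∞, C ≠ ∞ ∧ ∀ Φ : EuclideanSpace ℝ (Fin n) → ℝ≥0∞,
    ∫⁻ w, Φ (x₀ + R • w) ∂(lsiSphere n) ≤ C * ∫⁻ x in sphere x₀ R, Φ x ∂(μH[(n : ℝ) - 1]) := by
  obtain ⟨C, hC, h⟩ := lsiSphere_le_hausdorff n hn x₀ R hR
  refine ⟨C, hC, fun Φ => ?_⟩
  set T : EuclideanSpace ℝ (Fin n) ≃ₜ EuclideanSpace ℝ (Fin n) :=
    (Homeomorph.smulOfNeZero R hR.ne').trans (Homeomorph.addLeft x₀) with hT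
  have hTe : ∀ z, T z = x₀ + R • z := fun z => rfl
  have hTf : (T : EuclideanSpace ℝ (Fin n) → EuclideanSpace ℝ (Fin n)) =
    fun w => x₀ + R • w := rfl
  have h1 : ∫⁻ w, Φ (x₀ + R • w) ∂(lsiSphere n) = ∫⁻ x, Φ x ∂(Measure.map T (lsiSphere n)) :=
    (T.measurableEmbedding.lintegral_map _).symm
  have h2 : Measure.map T (lsiSphere n) = (Measure.map T (lsiSphere n)).restrict (sphere x₀ R) := by
    symm
    apply Measure.restrict_eq_self_of_ae_mem
    refine (ae_map_iff (p := fun y => y ∈ sphere x₀ R) T.measurable.aemeasurable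
      isClosed_sphere.measurableSet).2 ?_
    filter_upwards [lsiSphere_ae n] with w hw
    rw [hTe, mem_sphere, dist_eq_norm, add_sub_cancel_left, norm_smul, hw,
      Real.norm_of_nonneg hR.le, mul_one]
  rw [h1, h2]
  calc _ ≤ ∫⁻ x in sphere x₀ R, Φ x ∂(C • μH[(n : ℝ) - 1]) :=
        lintegral_mono' (Measure.restrict_mono le_rfl h) le_rfl
    _ = _ := by rw [Measure.restrict_smul, lintegral_smul_measure, smul_eq_mul]

theorem lsi_real (n : ℕ) (μ : Measure (EuclideanSpace ℝ (Fin n))) (x₀ : EuclideanSpace ℝ (Fin n))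
    (R : ℝ) (s : Set (EuclideanSpace ℝ (Fin n))) (hs : MeasurableSet s) (hsb : s ⊆ closedBall x₀ R)
    (hμ : μ s < ∞) (h : EuclideanSpace ℝ (Fin n) → ℂ) (hh : ContinuousOn h (closedBall x₀ R))
    (a : ℝ) (ha : 0 < a) :
    (∫ x in s, ‖h x‖ ^ a ∂μ) ^ (1 / a) = ((∫⁻ x in s, ‖h x‖ₑ ^ a ∂μ) ^ (1 / a)).toReal ∧
      (∫⁻ x in s, ‖h x‖ₑ ^ a ∂μ) ^ (1 / a) ≠ ∞ := by
  have e : ∀ x, ENNReal.ofReal (‖h x‖ ^ a) = ‖h x‖ₑ ^ a := fun x => by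
    rw [← ENNReal.ofReal_rpow_of_nonneg (norm_nonneg _) ha.le, ofReal_norm]
  constructor
  · rw [integral_eq_lintegral_of_nonneg_ae (Filter.Eventually.of_forall fun x => by positivity),
      ← ENNReal.toReal_rpow]
    · simp only [e]
    · have : ContinuousOn (fun x => ‖h x‖ ^ a) s :=
        (hh.mono hsb).norm.rpow_const fun x _ => Or.inr ha.le
      exact this.aestronglyMeasurable hs
  · refine ENNReal.rpow_ne_top_of_nonneg (by positivity) ?_
    obtain ⟨K, hK⟩ := (isCompact_closedBall x₀ R).exists_bound_of_continuousOn hh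
    have : ∫⁻ x in s, ‖h x‖ₑ ^ a ∂μ ≤ ∫⁻ x in s, ENNReal.ofReal K ^ a ∂μ := by
      refine setLIntegral_mono' hs fun x hx => ENNReal.rpow_le_rpow ?_ ha.le
      rw [← ofReal_norm]
      exact ENNReal.ofReal_le_ofReal (hK x (hsb hx))
    refine ne_top_of_le_ne_top ?_ this
    rw [setLIntegral_const]
    exact ENNReal.mul_ne_top (ENNReal.rpow_ne_top_of_nonneg ha.le ENNReal.ofReal_ne_top) hμ.ne

theorem laplace_sobolev_inequality_ball
    (n : ℕ) (hn : 2 ≤ n) (x₀ : EuclideanSpace ℝ (Fin n)) (R : ℝ) (hR : 0 < R)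
    (p q r : ℝ) (hp : 1 ≤ p) (hq : 1 ≤ q) (hr : 1 ≤ r)
    (hqp : q * (n - 2 * p) < n * p) (hqr : q * (n - 1) < n * r)
    (hdim2 : n = 2 → 1 < q → 1 < p) :
    ∃ δ > (0 : ℝ), ∀ f g : EuclideanSpace ℝ (Fin n) → ℂ,
      ContinuousOn f (closure (ball x₀ R)) →
      ContDiffOn ℝ 2 f (ball x₀ R) →
      ContinuousOn g (closure (ball x₀ R)) →
      (∀ x ∈ ball x₀ R, g x = laplacianC n f x) →
      δ * (∫ x in ball x₀ R, ‖f x‖ ^ q) ^ (1 / q)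
        ≤ (∫ x in ball x₀ R, ‖g x‖ ^ p) ^ (1 / p)
          + (∫ x in sphere x₀ R, ‖f x‖ ^ r ∂(μH[(n : ℝ) - 1])) ^ (1 / r) := by
  have hp0 : 0 < p := by linarith
  have hq0 : 0 < q := by linarith
  have hr0 : 0 < r := by linarith
  obtain ⟨M, hM, hunit⟩ := lsi_unit n hn p q r hp hq hr hqp hqr
  obtain ⟨Cs, hCs, hsph⟩ := lsi_scale_sphere n hn x₀ R hR
  set c : ℝ≥0∞ := ENNReal.ofReal ((R ^ n)⁻¹) with hc
  have hc0 : c ≠ 0 := (ENNReal.ofReal_pos.2 (by positivity)).ne'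
  have hct : c ≠ ∞ := ENNReal.ofReal_ne_top
  set a : ℝ≥0∞ := c ^ (1 / q) with ha
  have ha0 : a ≠ 0 := by
    rw [ha]
    exact (ENNReal.rpow_pos (pos_iff_ne_zero.2 hc0) hct).ne'
  have hat : a ≠ ∞ := ENNReal.rpow_ne_top_of_nonneg (by positivity) hct
  set M1 : ℝ≥0∞ := M * (ENNReal.ofReal (R ^ 2) * c ^ (1 / p)) with hM1
  have hM1t : M1 ≠ ∞ := ENNReal.mul_ne_top hM (ENNReal.mul_ne_top ENNReal.ofReal_ne_top
    (ENNReal.rpow_ne_top_of_nonneg (by positivity) hct))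
  set M2 : ℝ≥0∞ := M * Cs ^ (1 / r) with hM2
  have hM2t : M2 ≠ ∞ := ENNReal.mul_ne_top hM
    (ENNReal.rpow_ne_top_of_nonneg (by positivity) hCs)
  set N : ℝ≥0∞ := a⁻¹ * (M1 + M2) with hN
  have hNt : N ≠ ∞ := ENNReal.mul_ne_top (ENNReal.inv_ne_top.2 ha0)
    (ENNReal.add_ne_top.2 ⟨hM1t, hM2t⟩)
  have hN0 : 0 ≤ N.toReal := ENNReal.toReal_nonneg
  refine ⟨(N.toReal + 1)⁻¹, by positivity, fun f g hfc hf hgc hg => ?_⟩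
  rw [closure_ball x₀ hR.ne'] at hfc hgc
  obtain ⟨eF, -⟩ := lsi_real n volume x₀ R _ measurableSet_ball ball_subset_closedBall
    measure_ball_lt_top f hfc q hq0
  obtain ⟨eG, hG⟩ := lsi_real n volume x₀ R _ measurableSet_ball ball_subset_closedBall
    measure_ball_lt_top g hgc p hp0
  obtain ⟨eS, hS⟩ := lsi_real n μH[(n : ℝ) - 1] x₀ R _ isClosed_sphere.measurableSet
    sphere_subset_closedBall (lsi_hausdorff_sphere_lt_top n hn x₀ R hR) f hfc r hr0
  rw [eF, eG, eS]
  set F := (∫⁻ x in ball x₀ R, ‖f x‖ₑ ^ q) ^ (1 / q) with hF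
  set G := (∫⁻ x in ball x₀ R, ‖g x‖ₑ ^ p) ^ (1 / p) with hGdef
  set S := (∫⁻ x in sphere x₀ R, ‖f x‖ₑ ^ r ∂(μH[(n : ℝ) - 1])) ^ (1 / r) with hSdef
  have hTc : Continuous (fun z : EuclideanSpace ℝ (Fin n) => x₀ + R • z) := by fun_prop
  have hTb : Set.MapsTo (fun z : EuclideanSpace ℝ (Fin n) => x₀ + R • z) (ball 0 1)
      (ball x₀ R) := by
    intro z hz
    rw [mem_ball_zero_iff] at hz
    rw [mem_ball, dist_eq_norm, add_sub_cancel_left, norm_smul, Real.norm_of_nonneg hR.le]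
    nlinarith
  have hTcb : Set.MapsTo (fun z : EuclideanSpace ℝ (Fin n) => x₀ + R • z) (closedBall 0 1)
      (closedBall x₀ R) := by
    intro z hz
    rw [mem_closedBall_zero_iff] at hz
    rw [mem_closedBall, dist_eq_norm, add_sub_cancel_left, norm_smul, Real.norm_of_nonneg hR.le]
    nlinarith
  have key := hunit (fun z => f (x₀ + R • z)) (fun z => (R ^ 2) • g (x₀ + R • z))
    (hfc.comp hTc.continuousOn hTcb)
    (hf.comp (by fun_prop : ContDiff ℝ 2
      (fun z : EuclideanSpace ℝ (Fin n) => x₀ + R • z)).contDiffOn hTb)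
    ((hgc.comp hTc.continuousOn hTcb).const_smul (R ^ 2))
    (fun z hz => by rw [lsi_scale_lap, hg _ (hTb hz)])
  have kF : (∫⁻ z in ball 0 1, ‖f (x₀ + R • z)‖ₑ ^ q) ^ (1 / q) = a * F := by
    rw [lsi_scale_vol n x₀ R hR (fun x => ‖f x‖ₑ ^ q),
      ENNReal.mul_rpow_of_nonneg _ _ (by positivity)]
  have kG : (∫⁻ z in ball 0 1, ‖(R ^ 2) • g (x₀ + R • z)‖ₑ ^ p) ^ (1 / p) =
      ENNReal.ofReal (R ^ 2) * c ^ (1 / p) * G := by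
    simp only [enorm_smul]
    rw [Real.enorm_of_nonneg (by positivity), lsi_const _ _ ENNReal.ofReal_ne_top _ hp0,
      lsi_scale_vol n x₀ R hR (fun x => ‖g x‖ₑ ^ p),
      ENNReal.mul_rpow_of_nonneg _ _ (by positivity), mul_assoc]
  have kS : (∫⁻ w, ‖f (x₀ + R • w)‖ₑ ^ r ∂(lsiSphere n)) ^ (1 / r) ≤ Cs ^ (1 / r) * S := by
    rw [hSdef, ← ENNReal.mul_rpow_of_nonneg _ _ (by positivity)]
    exact ENNReal.rpow_le_rpow (hsph (fun x => ‖f x‖ₑ ^ r)) (by positivity)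
  rw [kF, kG] at key
  have key2 : F ≤ N * (G + S) := by
    calc F = a⁻¹ * (a * F) := by
          rw [← mul_assoc, ENNReal.inv_mul_cancel ha0 hat, one_mul]
      _ ≤ a⁻¹ * (M1 * G + M2 * S) := by
          refine mul_le_mul' le_rfl (key.trans ?_)
          rw [hM1, hM2, mul_assoc M, mul_assoc M]
          exact add_le_add le_rfl (mul_le_mul' le_rfl kS)
      _ ≤ a⁻¹ * ((M1 + M2) * G + (M1 + M2) * S) := by
          refine mul_le_mul' le_rfl (add_le_add (mul_le_mul' le_self_add le_rfl)
            (mul_le_mul' le_add_self le_rfl))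
      _ = N * (G + S) := by rw [hN, ← mul_add, mul_assoc]
  have key3 : F.toReal ≤ N.toReal * (G.toReal + S.toReal) := by
    rw [← ENNReal.toReal_add hG hS, ← ENNReal.toReal_mul]
    exact ENNReal.toReal_mono (ENNReal.mul_ne_top hNt (ENNReal.add_ne_top.2 ⟨hG, hS⟩)) key2
  have hG0 : 0 ≤ G.toReal := ENNReal.toReal_nonneg
  have hS0 : 0 ≤ S.toReal := ENNReal.toReal_nonneg
  rw [inv_mul_le_iff₀ (by positivity)]
  nlinarith
end

section
/- Let n ≥ 2, let x₀ ∈ ℝⁿ, R > 0, and let B = B(x₀,R) be the open ball with boundary sphere ∂B. Let 1 ≤ p < ∞ and 1 ≤ q < ∞ satisfy q(n−1) < np. Then there exists a constant δ > 0, depending only on n, p, q, R, such that for every f : ℝⁿ → ℂ that is continuous on cl(B) and harmonic on B (i.e. twice continuously differentiable on B with ∑ᵢ₌₁ⁿ ∂²f/∂xᵢ² ≡ 0 on B), one has δ·‖f‖_{L^q(B)} ≤ ‖f‖_{L^p(∂B)}. (The Euclidean-ball case of Corollary 1.4.) -/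
open Metric MeasureTheory

lemma aux_norm_line {n : ℕ} (x : EuclideanSpace ℝ (Fin n)) (i : Fin n) (t : ℝ) :
    ‖x + t • EuclideanSpace.single i (1:ℝ)‖ ^ 2 = ‖x‖ ^ 2 + 2 * t * x i + t ^ 2 := by
  rw [norm_add_sq_real, inner_smul_right, EuclideanSpace.inner_single_right, norm_smul]
  simp
  ring

/-- Pointwise harmonicity, expressed through second derivatives along coordinate lines. -/
def LineHarm {n : ℕ} (w : EuclideanSpace ℝ (Fin n) → ℝ) (x : EuclideanSpace ℝ (Fin n)) : Prop :=
  ∃ (b : Fin n → ℝ → ℝ) (a : Fin n → ℝ),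
    (∀ i, ∀ᶠ t in nhds (0:ℝ),
      HasDerivAt (fun t : ℝ => w (x + t • EuclideanSpace.single i (1:ℝ))) (b i t) t) ∧
    (∀ i, HasDerivAt (b i) (a i) 0) ∧ ∑ i, a i = 0

lemma LineHarm.add {n : ℕ} {v w : EuclideanSpace ℝ (Fin n) → ℝ} {x : EuclideanSpace ℝ (Fin n)}
    (hv : LineHarm v x) (hw : LineHarm w x) : LineHarm (v + w) x := by
  obtain ⟨b, a, h1, h2, h3⟩ := hv
  obtain ⟨b', a', h1', h2', h3'⟩ := hw
  refine ⟨fun i t => b i t + b' i t, fun i => a i + a' i, fun i => ?_, fun i => ?_, ?_⟩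
  · filter_upwards [h1 i, h1' i] with t k1 k2 using k1.add k2
  · exact (h2 i).add (h2' i)
  · rw [Finset.sum_add_distrib, h3, h3', add_zero]

lemma LineHarm.smul {n : ℕ} {v : EuclideanSpace ℝ (Fin n) → ℝ} {x : EuclideanSpace ℝ (Fin n)}
    (c : ℝ) (hv : LineHarm v x) : LineHarm (c • v) x := by
  obtain ⟨b, a, h1, h2, h3⟩ := hv
  refine ⟨fun i t => c * b i t, fun i => c * a i, fun i => ?_, fun i => ?_, ?_⟩
  · filter_upwards [h1 i] with t k1 using k1.const_mul c
  · exact (h2 i).const_mul c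
  · rw [← Finset.mul_sum, h3, mul_zero]

lemma LineHarm.zero {n : ℕ} (x : EuclideanSpace ℝ (Fin n)) : LineHarm 0 x :=
  ⟨fun _ _ => 0, fun _ => 0, fun _ => Filter.Eventually.of_forall fun t => hasDerivAt_const _ _,
    fun _ => hasDerivAt_const _ _, by simp⟩

lemma second_deriv_nonpos {g b : ℝ → ℝ} {a : ℝ} (h : IsLocalMax g 0)
    (h1 : ∀ᶠ t in nhds (0:ℝ), HasDerivAt g (b t) t) (h2 : HasDerivAt b a 0) : a ≤ 0 := by
  by_contra! ha
  have hd : deriv g =ᶠ[nhds 0] b := h1.mono fun t ht => ht.deriv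
  have hdd : deriv (deriv g) 0 = a := by rw [hd.deriv_eq, h2.deriv]
  have h0 : deriv g 0 = 0 := h.deriv_eq_zero
  have hmin : IsLocalMin g 0 := isLocalMin_of_deriv_deriv_pos (by rw [hdd]; exact ha) h0
    h1.self_of_nhds.continuousAt
  have hc : g =ᶠ[nhds 0] fun _ => g 0 := by
    filter_upwards [h, hmin] with t k1 k2 using le_antisymm k1 k2
  have h3 := hc.deriv.deriv_eq
  rw [hdd] at h3
  simp at h3
  linarith

lemma quad_deriv (A B t : ℝ) :
    HasDerivAt (fun t : ℝ => A + 2 * t * B + t ^ 2) (2 * B + 2 * t) t := by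
  have e1 := (((hasDerivAt_id' t).const_mul 2).mul_const B).const_add A
  have e2 := e1.add ((hasDerivAt_id' t).fun_pow 2)
  refine e2.congr_deriv ?_
  norm_num

lemma lin_deriv (B t : ℝ) : HasDerivAt (fun t : ℝ => 2 * B + 2 * t) 2 t := by
  have e1 := ((hasDerivAt_id' t).const_mul 2).const_add (2 * B)
  exact e1.congr_deriv (by norm_num)

lemma max_principle {n : ℕ} (hn : 0 < n) {r : ℝ} {w : EuclideanSpace ℝ (Fin n) → ℝ}
    (hc : ContinuousOn w (closedBall 0 r)) (hw : ∀ x ∈ ball 0 r, LineHarm w x) {M : ℝ}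
    (hM : ∀ x ∈ sphere 0 r, w x ≤ M) : ∀ x ∈ closedBall 0 r, w x ≤ M := by
  intro x hx
  have key : ∀ ε > 0, w x ≤ M + ε * r ^ 2 := by
    intro ε hε
    obtain ⟨z, hz, hmax⟩ := (isCompact_closedBall (0 : EuclideanSpace ℝ (Fin n)) r).exists_isMaxOn
      ⟨x, hx⟩ (f := fun y => w y + ε * ‖y‖ ^ 2)
      (hc.add (continuousOn_const (c := ε) |>.mul (continuous_norm.pow 2).continuousOn))
    have hmx : w x + ε * ‖x‖ ^ 2 ≤ w z + ε * ‖z‖ ^ 2 := hmax hx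
    rcases (mem_closedBall.1 hz).lt_or_eq with hlt | heq
    · exfalso
      obtain ⟨b, a, h1, h2, h3⟩ := hw z hlt
      have hi : ∀ i, a i + 2 * ε ≤ 0 := by
        intro i
        refine second_deriv_nonpos
          (g := fun t : ℝ => w (z + t • EuclideanSpace.single i (1:ℝ)) +
            ε * (‖z‖ ^ 2 + 2 * t * z i + t ^ 2))
          (b := fun t => b i t + ε * (2 * z i + 2 * t)) ?_ ?_ ?_
        · have hcont : ContinuousAt (fun t : ℝ => z + t • EuclideanSpace.single i (1:ℝ)) 0 := by
            fun_prop
          have hnb : closedBall (0 : EuclideanSpace ℝ (Fin n)) r ∈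
              nhds (z + (0:ℝ) • EuclideanSpace.single i (1:ℝ)) := by
            rw [zero_smul, add_zero]
            exact Filter.mem_of_superset (isOpen_ball.mem_nhds hlt) ball_subset_closedBall
          filter_upwards [hcont hnb] with t ht
          have : w _ + ε * ‖_‖ ^ 2 ≤ w z + ε * ‖z‖ ^ 2 := hmax ht
          rw [aux_norm_line] at this
          simpa using this
        · filter_upwards [h1 i] with t ht
          exact ht.add ((quad_deriv _ _ t).const_mul ε)
        · refine ((h2 i).add ((lin_deriv _ 0).const_mul ε)).congr_deriv ?_
          ring
      have hs : ∑ i : Fin n, (a i + 2 * ε) ≤ 0 := Finset.sum_nonpos fun i _ => hi i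
      rw [Finset.sum_add_distrib, h3] at hs
      simp at hs
      have : (0:ℝ) < n := by exact_mod_cast hn
      nlinarith [mul_pos this hε]
    · have h1 := hM z heq
      have h2 : ‖z‖ = r := by simpa using heq
      rw [h2] at hmx
      nlinarith [mul_nonneg hε.le (sq_nonneg ‖x‖)]
  refine le_of_forall_pos_le_add fun δ hδ => ?_
  refine (key (δ / (r^2 + 1)) (by positivity)).trans ?_
  have : δ / (r^2 + 1) * r^2 ≤ δ := by
    rw [div_mul_eq_mul_div, div_le_iff₀ (by positivity)]
    nlinarith
  linarith

/-- The (unnormalised) Poisson kernel. -/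
noncomputable def pois {n : ℕ} (R : ℝ) (x y : EuclideanSpace ℝ (Fin n)) : ℝ :=
  (R ^ 2 - ‖x‖ ^ 2) * (‖x - y‖ ^ 2) ^ (-(n : ℝ) / 2)

lemma lineHarm_pois {n : ℕ} {R : ℝ} {x y : EuclideanSpace ℝ (Fin n)} (hy : ‖y‖ = R) (hxy : x ≠ y) :
    LineHarm (fun x => pois R x y) x := by
  set d := x - y with hd
  set k : ℝ := -(n : ℝ) / 2 with hk
  have hD0 : 0 < ‖d‖ ^ 2 := by
    have : 0 < ‖d‖ := norm_pos_iff.2 (sub_ne_zero.2 hxy)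
    positivity
  have hform : ∀ (i : Fin n) (t : ℝ), pois R (x + t • EuclideanSpace.single i (1:ℝ)) y =
      (R ^ 2 - (‖x‖ ^ 2 + 2 * t * x i + t ^ 2)) * (‖d‖ ^ 2 + 2 * t * d i + t ^ 2) ^ k := by
    intro i t
    have e : x + t • EuclideanSpace.single i (1:ℝ) - y = d + t • EuclideanSpace.single i (1:ℝ) := by
      rw [hd]; abel
    rw [pois, e, aux_norm_line, aux_norm_line]
  have hA : ∀ (i : Fin n) (t : ℝ), HasDerivAt (fun t : ℝ => R ^ 2 - (‖x‖ ^ 2 + 2 * t * x i + t ^ 2))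
      (-(2 * x i + 2 * t)) t := fun i t => (quad_deriv _ _ t).const_sub _
  have hA' : ∀ (i : Fin n) (t : ℝ), HasDerivAt (fun t : ℝ => -(2 * x i + 2 * t)) (-2) t :=
    fun i t => (lin_deriv _ t).neg
  have hD : ∀ (i : Fin n) (t : ℝ), HasDerivAt (fun t : ℝ => ‖d‖ ^ 2 + 2 * t * d i + t ^ 2)
      (2 * d i + 2 * t) t := fun i t => quad_deriv _ _ t
  have hD' : ∀ (i : Fin n) (t : ℝ), HasDerivAt (fun t : ℝ => (2 * d i + 2 * t)) 2 t :=
    fun i t => lin_deriv _ t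
  have hpos : ∀ i : Fin n, ∀ᶠ t in nhds (0:ℝ), 0 < ‖d‖ ^ 2 + 2 * t * d i + t ^ 2 := by
    intro i
    have : ContinuousAt (fun t : ℝ => ‖d‖ ^ 2 + 2 * t * d i + t ^ 2) 0 := by fun_prop
    exact this.eventually_const_lt (by simpa using hD0)
  refine ⟨fun i t => -(2 * x i + 2 * t) * (‖d‖ ^ 2 + 2 * t * d i + t ^ 2) ^ k +
      (R ^ 2 - (‖x‖ ^ 2 + 2 * t * x i + t ^ 2)) *
        ((2 * d i + 2 * t) * k * (‖d‖ ^ 2 + 2 * t * d i + t ^ 2) ^ (k - 1)),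
    fun i => (-2 * (‖d‖ ^ 2) ^ k + (-(2 * x i)) * (2 * d i * k * (‖d‖ ^ 2) ^ (k - 1))) +
      ((-(2 * x i)) * (2 * d i * k * (‖d‖ ^ 2) ^ (k - 1)) +
        (R ^ 2 - ‖x‖ ^ 2) * (2 * k * (‖d‖ ^ 2) ^ (k - 1) +
          2 * d i * k * (2 * d i * (k - 1) * (‖d‖ ^ 2) ^ (k - 1 - 1)))), ?_, ?_, ?_⟩
  · intro i
    filter_upwards [hpos i] with t ht
    simp only [hform]
    exact (hA i t).mul ((hD i t).rpow_const (Or.inl ht.ne'))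
  · intro i
    have h0 := (hpos i).self_of_nhds.ne'
    have e := ((hA' i 0).mul ((hD i 0).rpow_const (p := k) (Or.inl h0))).add
      ((hA i 0).mul (((hD' i 0).mul_const k).mul ((hD i 0).rpow_const (p := k - 1) (Or.inl h0))))
    refine e.congr_deriv ?_
    simp
  · have e1 : (‖d‖ ^ 2) ^ k = ‖d‖ ^ 2 * (‖d‖ ^ 2) ^ (k - 1) := by
      rw [Real.rpow_sub_one hD0.ne', mul_div_assoc', mul_div_cancel_left₀ _ hD0.ne']
    have e2 : (‖d‖ ^ 2) * (‖d‖ ^ 2) ^ (k - 1 - 1) = (‖d‖ ^ 2) ^ (k - 1) := by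
      rw [Real.rpow_sub_one hD0.ne' (k - 1), mul_div_assoc', mul_div_cancel_left₀ _ hD0.ne']
    have hin : ∑ i, x i * d i = inner ℝ x d := by
      rw [PiLp.inner_apply]; simp [mul_comm]
    have hdd : ∑ i, d i * d i = ‖d‖ ^ 2 := by
      rw [EuclideanSpace.norm_sq_eq]; simp [sq]
    have hrel : R ^ 2 = ‖x‖ ^ 2 - 2 * inner ℝ x d + ‖d‖ ^ 2 := by
      have : y = x - d := by rw [hd]; abel
      rw [← hy, this, norm_sub_sq_real]
    set S := (‖d‖ ^ 2) ^ (k - 1) with hS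
    set T := (‖d‖ ^ 2) ^ (k - 1 - 1) with hT
    have expand : ∀ i, (-2 * (‖d‖ ^ 2) ^ k + (-(2 * x i)) * (2 * d i * k * S)) +
      ((-(2 * x i)) * (2 * d i * k * S) +
        (R ^ 2 - ‖x‖ ^ 2) * (2 * k * S +
          2 * d i * k * (2 * d i * (k - 1) * T))) =
        (-2 * (‖d‖ ^ 2) ^ k + (R ^ 2 - ‖x‖ ^ 2) * (2 * k * S)) + (-8 * k * S) * (x i * d i)
          + ((R ^ 2 - ‖x‖ ^ 2) * 4 * k * (k - 1) * T) * (d i * d i) := by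
      intro i; ring
    simp only [expand]
    rw [Finset.sum_add_distrib, Finset.sum_add_distrib, ← Finset.mul_sum, ← Finset.mul_sum, hin, hdd]
    simp only [Finset.sum_const, Finset.card_univ, Fintype.card_fin, nsmul_eq_mul]
    have hnk : (n : ℝ) = -2 * k := by rw [hk]; ring
    rw [hnk, e1]
    have : (R ^ 2 - ‖x‖ ^ 2) * 4 * k * (k - 1) * T * ‖d‖ ^ 2 =
      (R ^ 2 - ‖x‖ ^ 2) * 4 * k * (k - 1) * S := by rw [← e2]; ring
    rw [this, hrel]
    ring

lemma lineHarm_re {n : ℕ} {R : ℝ} {f : EuclideanSpace ℝ (Fin n) → ℂ}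
    (hf : ContDiffOn ℝ 2 f (ball 0 R)) (hl : ∀ x ∈ ball 0 R, laplacianC n f x = 0) (θ : ℂ)
    {x : EuclideanSpace ℝ (Fin n)} (hx : x ∈ ball 0 R) :
    LineHarm (fun z => (θ * f z).re) x := by
  let L : ℂ →L[ℝ] ℝ := Complex.reCLM.comp (ContinuousLinearMap.mul ℝ ℂ θ)
  have hline : ∀ (i : Fin n) (t : ℝ), HasDerivAt
      (fun t : ℝ => x + t • EuclideanSpace.single i (1:ℝ)) (EuclideanSpace.single i (1:ℝ)) t := by
    intro i t
    simpa using ((hasDerivAt_id' t).smul_const (EuclideanSpace.single i (1:ℝ))).const_add x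
  have hat : ContDiffAt ℝ 2 f x := hf.contDiffAt (isOpen_ball.mem_nhds hx)
  have hfd : DifferentiableAt ℝ (fderiv ℝ f) x :=
    (hat.fderiv_right (m := 1) (by norm_num)).differentiableAt (by norm_num)
  refine ⟨fun i t => L (fderiv ℝ f (x + t • EuclideanSpace.single i (1:ℝ))
      (EuclideanSpace.single i (1:ℝ))),
    fun i => L (fderiv ℝ (fun y => fderiv ℝ f y (EuclideanSpace.single i 1)) x
      (EuclideanSpace.single i 1)), ?_, ?_, ?_⟩
  · intro i
    have hcont : ContinuousAt (fun t : ℝ => x + t • EuclideanSpace.single i (1:ℝ)) 0 := by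
      fun_prop
    have hnb : ball (0 : EuclideanSpace ℝ (Fin n)) R ∈
        nhds (x + (0:ℝ) • EuclideanSpace.single i (1:ℝ)) := by
      rw [zero_smul, add_zero]
      exact isOpen_ball.mem_nhds hx
    filter_upwards [hcont hnb] with t ht
    have hd : DifferentiableAt ℝ f (x + t • EuclideanSpace.single i (1:ℝ)) :=
      (hf.contDiffAt (isOpen_ball.mem_nhds ht)).differentiableAt (by norm_num)
    exact L.hasFDerivAt.comp_hasDerivAt t (hd.hasFDerivAt.comp_hasDerivAt t (hline i t))
  · intro i
    have hd : DifferentiableAt ℝ (fun y => fderiv ℝ f y (EuclideanSpace.single i 1))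
      (x + (0:ℝ) • EuclideanSpace.single i (1:ℝ)) := by
      rw [zero_smul, add_zero]
      exact hfd.clm_apply (differentiableAt_const _)
    have := L.hasFDerivAt.comp_hasDerivAt (0:ℝ) (hd.hasFDerivAt.comp_hasDerivAt 0 (hline i 0))
    simp only [zero_smul, add_zero] at this
    exact this
  · rw [← map_sum]
    have := hl x hx
    rw [laplacianC] at this
    rw [this, map_zero]

lemma hausdorff_sphere_pos (m : ℕ) {R : ℝ} (hR : 0 < R) :
    0 < μH[(m : ℝ)] (sphere (0 : EuclideanSpace ℝ (Fin (m + 1))) R) := by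
  let π : EuclideanSpace ℝ (Fin (m + 1)) → (Fin m → ℝ) := fun x j => x j.succ
  have hπ : LipschitzWith 1 π := by
    refine LipschitzWith.of_dist_le_mul fun x y => ?_
    rw [NNReal.coe_one, one_mul, dist_pi_le_iff dist_nonneg]
    intro j
    have := PiLp.norm_apply_le (x - y) j.succ
    rw [dist_eq_norm, dist_eq_norm]
    simpa [π] using this
  have hsub : ball (0 : Fin m → ℝ) (R / (m + 1)) ⊆
      π '' (sphere (0 : EuclideanSpace ℝ (Fin (m + 1))) R) := by
    intro z hz
    have hz' : ∀ j, |z j| ≤ R / (m + 1) := fun j => by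
      have h1 := norm_le_pi_norm z j
      have h2 : ‖z‖ < R / (m+1) := by simpa using hz
      rw [Real.norm_eq_abs] at h1; linarith
    have hsum : ∑ j, z j ^ 2 ≤ R ^ 2 := by
      calc ∑ j, z j ^ 2 ≤ ∑ j : Fin m, (R / (m + 1)) ^ 2 :=
            Finset.sum_le_sum fun j _ => by
              rw [← sq_abs]; exact pow_le_pow_left₀ (abs_nonneg _) (hz' j) 2
        _ = m * (R / (m + 1)) ^ 2 := by simp
        _ ≤ R ^ 2 := by
            rw [div_pow, mul_div_assoc', div_le_iff₀ (by positivity)]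
            have : (0:ℝ) ≤ m := by positivity
            nlinarith [sq_nonneg R, mul_nonneg (sq_nonneg R) this,
              mul_nonneg (sq_nonneg R) (sq_nonneg (m:ℝ))]
    refine ⟨WithLp.toLp 2 (Fin.cons (Real.sqrt (R ^ 2 - ∑ j, z j ^ 2)) z), ?_, ?_⟩
    · rw [mem_sphere_zero_iff_norm, EuclideanSpace.norm_eq, Fin.sum_univ_succ]
      simp only [Fin.cons_zero, Fin.cons_succ, Real.norm_eq_abs, sq_abs]
      rw [Real.sq_sqrt (by linarith)]
      rw [sub_add_cancel, Real.sqrt_sq hR.le]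
    · ext j; simp [π]
  have h1 := hπ.hausdorffMeasure_image_le (d := (m:ℝ)) (by positivity)
    (sphere (0 : EuclideanSpace ℝ (Fin (m + 1))) R)
  have h2 : (μH[(m:ℝ)] : Measure (Fin m → ℝ)) = volume := by
    have := hausdorffMeasure_pi_real (ι := Fin m)
    simpa using this
  have h3 : 0 < volume (ball (0 : Fin m → ℝ) (R / (m + 1))) := measure_ball_pos _ _ (by positivity)
  rw [h2] at h1
  have h4 := h3.trans_le ((measure_mono hsub).trans h1)
  simpa using h4

lemma hausdorff_sphere_lt_top (m : ℕ) {R : ℝ} (hR : 0 < R) :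
    μH[(m : ℝ)] (sphere (0 : EuclideanSpace ℝ (Fin (m + 1))) R) < ⊤ := by
  let ι : Fin (m + 1) → ℝ → (Fin m → ℝ) → EuclideanSpace ℝ (Fin (m + 1)) :=
    fun i a z => WithLp.toLp 2 (Fin.insertNth i a z)
  let N : EuclideanSpace ℝ (Fin (m + 1)) → EuclideanSpace ℝ (Fin (m + 1)) :=
    fun x => (R / ‖x‖) • x
  have h2 : (μH[(m:ℝ)] : Measure (Fin m → ℝ)) = volume := by
    have := hausdorffMeasure_pi_real (ι := Fin m)
    simpa using this
  have hι : ∀ i a, LipschitzWith (Real.toNNReal (m + 1)) (ι i a) := by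
    intro i a
    refine LipschitzWith.of_dist_le_mul fun x y => ?_
    rw [Real.coe_toNNReal _ (by positivity), EuclideanSpace.dist_eq]
    rw [Real.sqrt_le_left (by positivity), Fin.sum_univ_succAbove _ i]
    simp only [ι, Fin.insertNth_apply_same, Fin.insertNth_apply_succAbove, dist_self]
    calc (0:ℝ) ^ 2 + ∑ j, dist (x j) (y j) ^ 2 ≤ 0 ^ 2 + ∑ j : Fin m, (dist x y) ^ 2 := by
          gcongr with j
          exact dist_le_pi_dist x y j
      _ = m * (dist x y) ^ 2 := by simp
      _ ≤ ((m + 1) * dist x y) ^ 2 := by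
          have : (0:ℝ) ≤ m := by positivity
          rw [mul_pow]
          gcongr
          nlinarith
  have hN : LipschitzOnWith 2 N {x | R ≤ ‖x‖} := by
    refine LipschitzOnWith.of_dist_le_mul fun x hx y hy => ?_
    have hx0 : R ≤ ‖x‖ := hx
    have hy0 : R ≤ ‖y‖ := hy
    have hxp : 0 < ‖x‖ := hR.trans_le hx
    have hyp : 0 < ‖y‖ := hR.trans_le hy
    have e : N x - N y = (R / ‖x‖) • (x - y) + (R / ‖x‖ - R / ‖y‖) • y := by
      simp only [N, smul_sub, sub_smul]; abel
    rw [dist_eq_norm, dist_eq_norm, e]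
    refine (norm_add_le _ _).trans ?_
    rw [norm_smul, norm_smul, Real.norm_eq_abs, Real.norm_eq_abs, abs_of_nonneg (by positivity)]
    have k1 : R / ‖x‖ ≤ 1 := (div_le_one hxp).2 hx
    have k2 : |R / ‖x‖ - R / ‖y‖| * ‖y‖ = R / ‖x‖ * |‖y‖ - ‖x‖| := by
      have : R / ‖x‖ - R / ‖y‖ = (R / ‖x‖ / ‖y‖) * (‖y‖ - ‖x‖) := by field_simp
      rw [this, abs_mul, abs_of_nonneg (by positivity)]
      field_simp
    rw [k2]
    have k3 := abs_norm_sub_norm_le y x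
    rw [norm_sub_rev] at k3
    have k4 : (0:ℝ) ≤ R / ‖x‖ := by positivity
    have := norm_nonneg (x - y)
    have := abs_nonneg (‖y‖ - ‖x‖)
    push_cast
    nlinarith
  have hpiece : ∀ (i : Fin (m + 1)) (a : ℝ), |a| = R →
      μH[(m : ℝ)] (N '' (ι i a '' closedBall 0 R)) < ⊤ := by
    intro i a ha
    have hsub : ι i a '' closedBall 0 R ⊆ {x | R ≤ ‖x‖} := by
      rintro _ ⟨z, -, rfl⟩
      have := PiLp.norm_apply_le (ι i a z) i
      simp only [ι, Fin.insertNth_apply_same, Real.norm_eq_abs, ha] at this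
      exact this
    refine ((hN.mono hsub).hausdorffMeasure_image_le (by positivity)).trans_lt ?_
    refine ENNReal.mul_lt_top (by simp) ?_
    refine ((hι i a).hausdorffMeasure_image_le (by positivity) _).trans_lt ?_
    rw [h2]
    exact ENNReal.mul_lt_top (by simp) measure_closedBall_lt_top
  have hcov : sphere (0 : EuclideanSpace ℝ (Fin (m + 1))) R ⊆
      ⋃ i : Fin (m + 1), (N '' (ι i R '' closedBall 0 R)) ∪ (N '' (ι i (-R) '' closedBall 0 R)) := by
    intro x hx
    have hx' : ‖x‖ = R := by simpa using hx
    obtain ⟨i, hi⟩ := Finite.exists_max (fun i => |x i|)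
    have hpos : 0 < |x i| := by
      by_contra! h
      have : x = 0 := by
        ext j
        have := (hi j).trans h
        simpa using this
      rw [this] at hx'; simp at hx'; linarith
    have main : ∀ s : ℝ, 0 < s → s * |x i| = R → x ∈ N '' (ι i (s * x i) '' closedBall 0 R) := by
      intro s hs hsx
      have hz : ι i (s * x i) (fun j => s * x (i.succAbove j)) = s • x := by
        ext j
        refine Fin.succAboveCases i ?_ (fun j => ?_) j
        · simp [ι]
        · simp [ι]
      refine ⟨s • x, ⟨_, ?_, hz⟩, ?_⟩
      · rw [mem_closedBall_zero_iff, pi_norm_le_iff_of_nonneg hR.le]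
        intro j
        rw [Real.norm_eq_abs, abs_mul, abs_of_pos hs, ← hsx]
        exact mul_le_mul_of_nonneg_left (hi _) hs.le
      · simp only [N, norm_smul, Real.norm_eq_abs, abs_of_pos hs, hx', smul_smul]
        have : R / (s * R) * s = 1 := by field_simp
        rw [this, one_smul]
    have hm := main (R / |x i|) (by positivity) (by field_simp)
    refine Set.mem_iUnion.2 ⟨i, ?_⟩
    rcases abs_cases (x i) with h | h
    · left
      have e : R / |x i| * x i = R := by
        rw [h.1]; rw [h.1] at hpos; field_simp
      rwa [e] at hm
    · right
      have e : R / |x i| * x i = -R := by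
        have : x i ≠ 0 := by linarith [h.2] 
        rw [h.1]; field_simp
      rwa [e] at hm
  refine (measure_mono hcov).trans_lt ((measure_iUnion_le _).trans_lt ?_)
  rw [tsum_fintype]
  refine ENNReal.sum_lt_top.2 fun i _ => ?_
  refine (measure_union_le _ _).trans_lt (ENNReal.add_lt_top.2 ⟨hpiece _ _ ?_, hpiece _ _ ?_⟩)
  · exact abs_of_pos hR
  · rw [abs_neg]; exact abs_of_pos hR

/-- Restrictions to a closed ball of functions continuous there and harmonic inside. -/
def harmSub (n : ℕ) (r : ℝ) :
    Submodule ℝ C(closedBall (0 : EuclideanSpace ℝ (Fin n)) r, ℝ) where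
  carrier := {u | ∃ w : EuclideanSpace ℝ (Fin n) → ℝ, ContinuousOn w (closedBall 0 r) ∧
    (∀ x ∈ ball 0 r, LineHarm w x) ∧ ∀ x, u x = w x}
  add_mem' := by
    rintro u v ⟨w, h1, h2, h3⟩ ⟨w', h1', h2', h3'⟩
    exact ⟨w + w', h1.add h1', fun x hx => (h2 x hx).add (h2' x hx), fun x => by simp [h3, h3']⟩
  zero_mem' := ⟨0, continuousOn_const, fun x _ => LineHarm.zero x, fun x => by simp⟩
  smul_mem' := by
    rintro c u ⟨w, h1, h2, h3⟩
    exact ⟨c • w, h1.const_smul c, fun x hx => (h2 x hx).smul c, fun x => by simp [h3]⟩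

lemma max_principle_closure {n : ℕ} (hn : 0 < n) {r : ℝ}
    {u : C(closedBall (0 : EuclideanSpace ℝ (Fin n)) r, ℝ)}
    (hu : u ∈ (harmSub n r).topologicalClosure) {M : ℝ}
    (hM : ∀ x : closedBall (0 : EuclideanSpace ℝ (Fin n)) r, ‖(x : EuclideanSpace ℝ (Fin n))‖ = r →
      u x ≤ M) (x : closedBall (0 : EuclideanSpace ℝ (Fin n)) r) : u x ≤ M := by
  refine le_of_forall_pos_le_add fun ε hε => ?_
  have hu' : u ∈ closure (harmSub n r : Set C(closedBall (0 : EuclideanSpace ℝ (Fin n)) r, ℝ)) := hu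
  obtain ⟨v, ⟨w, h1, h2, h3⟩, hv⟩ := Metric.mem_closure_iff.1 hu' (ε / 2) (by positivity)
  have hd : ∀ z, |u z - v z| ≤ ε / 2 := fun z => by
    rw [← Real.dist_eq]; exact (ContinuousMap.dist_apply_le_dist z).trans hv.le
  have := max_principle hn h1 h2 (M := M + ε / 2) (fun z hz => by
    have hz' : ‖z‖ = r := by simpa using hz
    have k1 := hM ⟨z, sphere_subset_closedBall hz⟩ hz'
    have k2 := abs_le.1 (hd ⟨z, sphere_subset_closedBall hz⟩)
    have k3 := h3 ⟨z, sphere_subset_closedBall hz⟩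
    simp only at k3
    linarith) x x.2
  rw [← h3] at this
  have := abs_le.1 (hd x)
  linarith

lemma integral_mem_closure {S : Type*} [MeasurableSpace S] {F : Type*} [NormedAddCommGroup F]
    [NormedSpace ℝ F] [CompleteSpace F] (μ : Measure S) [IsFiniteMeasure μ] (H : Submodule ℝ F)
    (Φ : S → F) (hΦ : Integrable Φ μ) (h : ∀ y, Φ y ∈ H) : ∫ y, Φ y ∂μ ∈ H.topologicalClosure := by
  by_cases h0 : μ = 0
  · simp [h0]
  have : NeZero μ := ⟨h0⟩
  rw [← measure_smul_average]
  refine Submodule.smul_mem _ _ ?_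
  exact (Submodule.convex H.topologicalClosure).average_mem H.isClosed_topologicalClosure
    (Filter.Eventually.of_forall fun y => H.le_topologicalClosure (h y)) hΦ

lemma pois_contOn {n : ℕ} {R r : ℝ} (hr : r < R) :
    ContinuousOn (fun p : EuclideanSpace ℝ (Fin n) × EuclideanSpace ℝ (Fin n) => pois R p.1 p.2)
      (closedBall 0 r ×ˢ sphere 0 R) := by
  unfold pois
  refine ContinuousOn.mul (by fun_prop) ?_
  refine ContinuousOn.rpow_const (by fun_prop) ?_
  rintro ⟨x, y⟩ ⟨hx, hy⟩
  left
  have hx' : ‖x‖ ≤ r := by simpa using hx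
  have hy' : ‖y‖ = R := by simpa using hy
  have : x - y ≠ 0 := fun h => by
    rw [sub_eq_zero] at h; rw [h] at hx'; linarith
  exact pow_ne_zero 2 (norm_ne_zero_iff.2 this)

lemma poisson_int_mp {n : ℕ} (hn : 0 < n) {R r : ℝ} (hr : r < R)
    (μ : Measure (EuclideanSpace ℝ (Fin n))) (hμ : μ (sphere 0 R) < ⊤)
    {g w : EuclideanSpace ℝ (Fin n) → ℝ} (hg : ContinuousOn g (sphere 0 R))
    (hwc : ContinuousOn w (closedBall 0 r)) (hw : ∀ x ∈ ball 0 r, LineHarm w x) {M : ℝ}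
    (hM : ∀ x ∈ sphere 0 r, w x + ∫ y in sphere 0 R, pois R x y * g y ∂μ ≤ M)
    (x : EuclideanSpace ℝ (Fin n)) (hx : x ∈ closedBall 0 r) :
    w x + ∫ y in sphere 0 R, pois R x y * g y ∂μ ≤ M := by
  let S := sphere (0 : EuclideanSpace ℝ (Fin n)) R
  let K := closedBall (0 : EuclideanSpace ℝ (Fin n)) r
  let ν : Measure S := μ.comap Subtype.val
  have hS : MeasurableSet S := isClosed_sphere.measurableSet
  have : IsFiniteMeasure ν := ⟨by
    rw [comap_subtype_coe_apply hS]; simpa using hμ⟩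
  have : CompactSpace S := isCompact_iff_compactSpace.1 (isCompact_sphere _ _)
  have : CompactSpace K := isCompact_iff_compactSpace.1 (isCompact_closedBall _ _)
  have hcont : Continuous (fun p : S × K => pois R (p.2 : EuclideanSpace ℝ (Fin n)) p.1 * g p.1) := by
    refine Continuous.mul ?_ ?_
    · have := (pois_contOn (n := n) hr).comp_continuous
        (f := fun p : S × K => ((p.2 : EuclideanSpace ℝ (Fin n)), (p.1 : EuclideanSpace ℝ (Fin n))))
        (by fun_prop) (fun p => ⟨p.2.2, p.1.2⟩)
      exact this
    · exact hg.comp_continuous (f := fun p : S × K => (p.1 : EuclideanSpace ℝ (Fin n)))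
        (by fun_prop) (fun p => p.1.2)
  let Ψ : C(S × K, ℝ) := ⟨_, hcont⟩
  let Φ : C(S, C(K, ℝ)) := Ψ.curry
  have hΦi : Integrable Φ ν := by
    refine Φ.continuous.integrable_of_hasCompactSupport ?_
    exact HasCompactSupport.of_compactSpace _
  have hmem : ∀ y, Φ y ∈ harmSub n r := by
    intro y
    refine ⟨fun x => g y * pois R x y, ?_, ?_, ?_⟩
    · refine continuousOn_const.mul ?_
      exact (pois_contOn (n := n) hr).comp (f := fun x => (x, (y : EuclideanSpace ℝ (Fin n))))
        (by fun_prop) (fun x hx => ⟨hx, y.2⟩)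
    · intro x hx
      refine LineHarm.smul (g y) (lineHarm_pois (by simp) ?_)
      intro h
      have h1 : ‖x‖ < r := by simpa using hx
      have h2 : ‖(y : EuclideanSpace ℝ (Fin n))‖ = R := by simp
      rw [h] at h1; linarith
    · intro x; exact mul_comm _ _
  have hI := integral_mem_closure ν (harmSub n r) Φ hΦi hmem
  have hIx : ∀ x : K, (∫ y, Φ y ∂ν) x = ∫ y in sphere 0 R, pois R x y * g y ∂μ := by
    intro x
    have := (ContinuousMap.evalCLM ℝ x).integral_comp_comm hΦi
    change _ = (∫ y, Φ y ∂ν) x at this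
    rw [← this]
    exact integral_subtype_comap hS (fun y => pois R x y * g y)
  let W : C(K, ℝ) := ⟨fun x => w x, continuousOn_iff_continuous_domRestrict.1 hwc⟩
  have hW : W ∈ harmSub n r := ⟨w, hwc, hw, fun x => rfl⟩
  have hsum := Submodule.add_mem _ ((harmSub n r).le_topologicalClosure hW) hI
  have := max_principle_closure hn hsum (M := M) (fun x hx => by
    rw [ContinuousMap.add_apply, hIx]
    exact hM x (by simpa using hx)) ⟨x, hx⟩
  rw [ContinuousMap.add_apply, hIx] at this
  exact this

lemma pois_rot {n : ℕ} {R : ℝ} (d : ℝ) (x x' : EuclideanSpace ℝ (Fin n)) (h : ‖x‖ = ‖x'‖) :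
    ∫ y in sphere 0 R, pois R x y ∂(μH[d]) = ∫ y in sphere 0 R, pois R x' y ∂(μH[d]) := by
  let L := (Submodule.span ℝ {x - x'})ᗮ.reflection
  have hL : L x = x' := Submodule.reflection_sub h
  have hmp := L.toIsometryEquiv.measurePreserving_hausdorffMeasure d
  have := hmp.setIntegral_preimage_emb L.toIsometryEquiv.toHomeomorph.measurableEmbedding
    (fun y => pois R x' y) (sphere 0 R)
  rw [← this]
  have hpre : L.toIsometryEquiv ⁻¹' (sphere 0 R) = sphere 0 R := by
    ext y; simp
  rw [hpre]
  refine integral_congr_ae (Filter.Eventually.of_forall fun y => ?_)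
  simp only [pois]
  rw [h]
  have : x' - L.toIsometryEquiv y = L (x - y) := by rw [map_sub, hL]; rfl
  rw [this, LinearIsometryEquiv.norm_map]

lemma pois_const {n : ℕ} (hn : 0 < n) {R : ℝ} (d : ℝ)
    (hμ : μH[d] (sphere (0 : EuclideanSpace ℝ (Fin n)) R) < ⊤)
    (x : EuclideanSpace ℝ (Fin n)) (hx : ‖x‖ < R) :
    ∫ y in sphere 0 R, pois R x y ∂(μH[d]) =
      ∫ y in sphere (0 : EuclideanSpace ℝ (Fin n)) R, pois R 0 y ∂(μH[d]) := by
  apply le_antisymm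
  · have := poisson_int_mp hn hx μH[d] hμ (g := fun _ => -1) (w := 0) continuousOn_const
      continuousOn_const (fun x _ => LineHarm.zero x) (M := -∫ y in sphere 0 R, pois R x y ∂(μH[d]))
      (fun z hz => by
        rw [pois_rot d x z (by simpa using hz.symm)]
        simp [integral_neg]) 0 (by simp)
    simp [integral_neg] at this
    exact this
  · have := poisson_int_mp hn hx μH[d] hμ (g := fun _ => 1) (w := 0) continuousOn_const
      continuousOn_const (fun x _ => LineHarm.zero x) (M := ∫ y in sphere 0 R, pois R x y ∂(μH[d]))
      (fun z hz => by
        rw [pois_rot d x z (by simpa using hz.symm)]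
        simp) 0 (by simp)
    simp at this
    exact this

lemma pois_nonneg {n : ℕ} {R : ℝ} {x : EuclideanSpace ℝ (Fin n)} (hx : ‖x‖ ≤ R)
    (y : EuclideanSpace ℝ (Fin n)) : 0 ≤ pois R x y := by
  unfold pois
  have : 0 ≤ R ^ 2 - ‖x‖ ^ 2 := by
    have := norm_nonneg x
    nlinarith
  positivity

lemma pois_int {n : ℕ} {R : ℝ} (μ : Measure (EuclideanSpace ℝ (Fin n))) (hμ : μ (sphere 0 R) < ⊤)
    {g : EuclideanSpace ℝ (Fin n) → ℝ} (hg : ContinuousOn g (sphere 0 R))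
    {x : EuclideanSpace ℝ (Fin n)} (hx : ‖x‖ < R) :
    IntegrableOn (fun y => pois R x y * g y) (sphere 0 R) μ := by
  refine ContinuousOn.integrableOn_of_subset_isCompact (K := sphere 0 R) ?_
    (isCompact_sphere _ _) isClosed_sphere.measurableSet subset_rfl hμ.ne
  refine ContinuousOn.mul ?_ hg
  exact (pois_contOn (n := n) hx).comp (f := fun y => (x, y))
        (by fun_prop) (fun y hy => ⟨by simp, hy⟩)

lemma poisson_repr {n : ℕ} (hn : 0 < n) {R : ℝ} (hR : 0 < R) (d : ℝ)
    (hμ : μH[d] (sphere (0 : EuclideanSpace ℝ (Fin n)) R) < ⊤)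
    {u : EuclideanSpace ℝ (Fin n) → ℝ} (hc : ContinuousOn u (closedBall 0 R))
    (hu : ∀ x ∈ ball 0 R, LineHarm u x) (x : EuclideanSpace ℝ (Fin n)) (hx : ‖x‖ < R) :
    (∫ y in sphere (0 : EuclideanSpace ℝ (Fin n)) R, pois R 0 y ∂(μH[d])) * u x ≤
      ∫ y in sphere 0 R, pois R x y * u y ∂(μH[d]) := by
  set c := ∫ y in sphere (0 : EuclideanSpace ℝ (Fin n)) R, pois R 0 y ∂(μH[d]) with hcdef
  have hc0 : 0 ≤ c := integral_nonneg fun y => pois_nonneg (by simpa using hR.le) y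
  have hcS : ContinuousOn u (sphere 0 R) := hc.mono sphere_subset_closedBall
  refine le_of_forall_pos_le_add fun ε hε => ?_
  set η := ε / (2 * (c + 1)) with hη
  have hηpos : 0 < η := by positivity
  obtain ⟨δ, hδ, hunif⟩ := Metric.uniformContinuousOn_iff.1
    ((isCompact_closedBall (0 : EuclideanSpace ℝ (Fin n)) R).uniformContinuousOn_of_continuous hc)
    η hηpos
  obtain ⟨M, hM⟩ := (isCompact_closedBall (0 : EuclideanSpace ℝ (Fin n)) R).exists_bound_of_continuousOn hc
  have hM0 : 0 ≤ M := (norm_nonneg _).trans (hM 0 (by simpa using hR.le))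
  set σ := μH[d].real (sphere (0 : EuclideanSpace ℝ (Fin n)) R) with hσ
  set A := (δ ^ 2) ^ (-(n:ℝ) / 2) * (2 * M) with hA
  have hA0 : 0 ≤ A := by positivity
  have hlim : ∀ᶠ r in nhdsWithin R (Set.Iio R), (R ^ 2 - r ^ 2) * A * σ < ε / 2 := by
    have : ContinuousAt (fun r : ℝ => (R ^ 2 - r ^ 2) * A * σ) R := by fun_prop
    have h2 := this.eventually_lt_const (u := ε / 2) (by simpa using hε)
    exact nhdsWithin_le_nhds h2
  have hlt : ∀ᶠ r in nhdsWithin R (Set.Iio R), ‖x‖ < r :=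
    nhdsWithin_le_nhds (eventually_gt_nhds hx)
  obtain ⟨r, ⟨hr1, hr2⟩, hr3⟩ := ((hlim.and hlt).and self_mem_nhdsWithin).exists
  have hr3 : r < R := hr3
  have key : ∀ z ∈ sphere (0 : EuclideanSpace ℝ (Fin n)) r,
      (c • u) z + ∫ y in sphere 0 R, pois R z y * -u y ∂(μH[d]) ≤ ε := by
    intro z hz
    have hz' : ‖z‖ = r := by simpa using hz
    have hzR : ‖z‖ < R := by linarith
    have i1 := pois_int μH[d] hμ (continuousOn_const (c := u z)) hzR
    have i2 : IntegrableOn (fun y => pois R z y * -u y) (sphere 0 R) μH[d] :=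
      pois_int μH[d] hμ hcS.neg hzR
    have i3 := pois_int μH[d] hμ (continuousOn_const (c := η)) hzR
    have i4 : IntegrableOn (fun _ : EuclideanSpace ℝ (Fin n) => (R ^ 2 - r ^ 2) * A) (sphere 0 R) μH[d] :=
      integrableOn_const hμ.ne
    have e1 : (c • u) z = ∫ y in sphere 0 R, pois R z y * u z ∂(μH[d]) := by
      rw [integral_mul_const, pois_const hn d hμ z hzR]; rfl
    rw [e1, ← integral_add i1 i2]
    have e2 : ∫ y in sphere 0 R, (pois R z y * η + (R ^ 2 - r ^ 2) * A) ∂(μH[d]) =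
        c * η + (R ^ 2 - r ^ 2) * A * σ := by
      rw [integral_add i3 i4, integral_mul_const, pois_const hn d hμ z hzR]
      simp [hσ, mul_comm, ← hcdef]
    have e3 : c * η ≤ ε / 2 := by
      rw [hη, mul_div_assoc', div_le_iff₀ (by positivity)]
      nlinarith
    have e4 : ∫ y in sphere 0 R, (pois R z y * u z + pois R z y * -u y) ∂(μH[d]) ≤
        ∫ y in sphere 0 R, (pois R z y * η + (R ^ 2 - r ^ 2) * A) ∂(μH[d]) := by
      refine setIntegral_mono_on (i1.add i2) (i3.add i4) isClosed_sphere.measurableSet ?_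
      intro y hy
      have hp := pois_nonneg hzR.le y
      have hyb : y ∈ closedBall (0 : EuclideanSpace ℝ (Fin n)) R := sphere_subset_closedBall hy
      have hzb : z ∈ closedBall (0 : EuclideanSpace ℝ (Fin n)) R := by simpa using hzR.le
      have hRr : 0 ≤ R ^ 2 - r ^ 2 := by
        have := norm_nonneg z
        nlinarith
      by_cases hd : dist z y < δ
      · have h1 := hunif z hzb y hyb hd
        rw [Real.dist_eq] at h1
        have h2 := (abs_lt.1 h1).2
        have h3 : 0 ≤ (R ^ 2 - r ^ 2) * A := by positivity
        nlinarith
      · push Not at hd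
        have h1 := abs_le.1 (hM z hzb)
        have h2 := abs_le.1 (hM y hyb)
        have h3 : pois R z y ≤ (R ^ 2 - r ^ 2) * (δ ^ 2) ^ (-(n:ℝ) / 2) := by
          unfold pois
          rw [hz']
          refine mul_le_mul_of_nonneg_left ?_ hRr
          rw [dist_eq_norm] at hd
          refine Real.rpow_le_rpow_of_nonpos (by positivity) (by gcongr) ?_
          have : (0:ℝ) ≤ n := by positivity
          linarith
        have h4 : pois R z y * u z + pois R z y * -u y = pois R z y * (u z - u y) := by ring
        have h5 : pois R z y * (u z - u y) ≤ pois R z y * (2 * M) :=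
          mul_le_mul_of_nonneg_left (by linarith) hp
        have h6 : pois R z y * (2 * M) ≤ (R ^ 2 - r ^ 2) * (δ ^ 2) ^ (-(n:ℝ) / 2) * (2 * M) :=
          mul_le_mul_of_nonneg_right h3 (by positivity)
        have h7 : 0 ≤ pois R z y * η := by positivity
        rw [h4, hA]
        linarith
    linarith
  have := poisson_int_mp hn hr3 μH[d] hμ (g := fun y => -u y) hcS.neg
    ((hc.mono (closedBall_subset_closedBall hr3.le)).const_smul c)
    (fun z hz => (hu z (ball_subset_ball hr3.le hz)).smul c) key x (by simpa using hr2.le)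
  simp only [Pi.neg_apply, mul_neg, integral_neg, Pi.smul_apply, smul_eq_mul] at this
  linarith

lemma jensen_weight {α : Type*} [MeasurableSpace α] {μ : Measure α} {k g : α → ENNReal}
    (hk : AEMeasurable k μ) (hg : AEMeasurable g μ) {s : ℝ} (hs : 1 ≤ s) :
    (∫⁻ a, g a * k a ∂μ) ^ s ≤ (∫⁻ a, g a * k a ^ s ∂μ) * (∫⁻ a, g a ∂μ) ^ (s - 1) := by
  have hs0 : 0 < s := by linarith
  have hk' : AEMeasurable k (μ.withDensity g) := hk.mono_ac (withDensity_absolutelyContinuous _ _)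
  have := eLpNorm'_le_eLpNorm'_mul_rpow_measure_univ (μ := μ.withDensity g) (f := k) one_pos hs
    hk'.aestronglyMeasurable
  simp only [eLpNorm', enorm_eq_self, ENNReal.rpow_one, div_one] at this
  rw [lintegral_withDensity_eq_lintegral_mul₀ hg hk,
    lintegral_withDensity_eq_lintegral_mul₀ hg (hk.pow_const s), withDensity_apply _ MeasurableSet.univ,
    Measure.restrict_univ] at this
  simp only [Pi.mul_apply] at this
  have h2 := ENNReal.rpow_le_rpow this hs0.le
  rw [ENNReal.mul_rpow_of_nonneg _ _ hs0.le, ← ENNReal.rpow_mul, ← ENNReal.rpow_mul] at h2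
  have e1 : 1 / s * s = 1 := by field_simp
  have e2 : (1 - 1 / s) * s = s - 1 := by field_simp
  rwa [e1, e2, ENNReal.rpow_one] at h2

lemma pois_le {n : ℕ} {R : ℝ} {x y : EuclideanSpace ℝ (Fin n)} (hx : ‖x‖ < R) (hy : ‖y‖ = R) :
    pois R x y ≤ 2 * R * ‖x - y‖ ^ (1 - (n : ℝ)) := by
  have hxy : 0 < ‖x - y‖ := by
    rw [norm_pos_iff, sub_ne_zero]; rintro rfl; linarith
  have h1 : R - ‖x‖ ≤ ‖x - y‖ := by
    rw [← hy, norm_sub_rev]; exact norm_sub_norm_le y x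
  have h0 := norm_nonneg x
  have h2 : R ^ 2 - ‖x‖ ^ 2 ≤ 2 * R * ‖x - y‖ := by nlinarith
  have h3 : (‖x - y‖ ^ 2) ^ (-(n : ℝ) / 2) = ‖x - y‖ ^ (-(n : ℝ)) := by
    rw [← Real.rpow_natCast, ← Real.rpow_mul hxy.le]
    congr 1; push_cast; ring
  have h4 : ‖x - y‖ ^ (1 - (n : ℝ)) = ‖x - y‖ * ‖x - y‖ ^ (-(n : ℝ)) := by
    rw [sub_eq_add_neg (1:ℝ), Real.rpow_add hxy, Real.rpow_one]
  rw [pois, h3, h4, ← mul_assoc]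
  gcongr

lemma kernel_bound {n : ℕ} (hn : 0 < n) {R : ℝ} (hR : 0 < R) {s : ℝ} (hs : 1 ≤ s)
    (hsn : s * ((n : ℝ) - 1) < n) :
    ∃ C : ENNReal, C < ⊤ ∧ ∀ y : EuclideanSpace ℝ (Fin n), ‖y‖ = R →
      ∫⁻ x in ball 0 R, ENNReal.ofReal (pois R x y) ^ s ≤ C := by
  let G : EuclideanSpace ℝ (Fin n) → ℝ := fun z => (2 * R) ^ s * ‖z‖ ^ (-(s * ((n : ℝ) - 1)))
  have hG : IntegrableOn G (ball 0 (2 * R)) := by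
    refine integrableOn_ball_of_norm_le_rpow (C := (2 * R) ^ s) (α := s * ((n : ℝ) - 1))
      ?_ ?_ ?_ ?_
    · simpa using Nat.succ_le_of_lt hn
    · simpa using hsn
    · refine Filter.Eventually.of_forall fun x => ?_
      rw [Real.norm_of_nonneg]
      have := norm_nonneg x
      simp only [G]; positivity
    · have : Measurable G := by fun_prop
      exact this.aestronglyMeasurable
  refine ⟨∫⁻ z in ball 0 (2 * R), ENNReal.ofReal (G z), hG.setLIntegral_lt_top, fun y hy => ?_⟩
  calc ∫⁻ x in ball 0 R, ENNReal.ofReal (pois R x y) ^ s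
      ≤ ∫⁻ x in ball 0 R, (ball 0 (2 * R)).indicator (fun z => ENNReal.ofReal (G z)) (x - y) := by
        refine setLIntegral_mono' measurableSet_ball fun x hx => ?_
        have hx' : ‖x‖ < R := by simpa using hx
        have hmem : x - y ∈ ball (0 : EuclideanSpace ℝ (Fin n)) (2 * R) := by
          rw [mem_ball_zero_iff]
          have := norm_sub_le x y
          linarith
        rw [Set.indicator_of_mem hmem, ENNReal.ofReal_rpow_of_nonneg (pois_nonneg hx'.le y) (by linarith)]
        refine ENNReal.ofReal_le_ofReal ?_
        refine (Real.rpow_le_rpow (pois_nonneg hx'.le y) (pois_le hx' hy) (by linarith)).trans ?_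
        rw [Real.mul_rpow (by positivity) (by positivity), ← Real.rpow_mul (norm_nonneg _)]
        simp only [G]
        have : (1 - (n:ℝ)) * s = -(s * ((n:ℝ) - 1)) := by ring
        rw [this]
    _ ≤ ∫⁻ x, (ball 0 (2 * R)).indicator (fun z => ENNReal.ofReal (G z)) (x - y) :=
        setLIntegral_le_lintegral _ _
    _ = ∫⁻ x, (ball 0 (2 * R)).indicator (fun z => ENNReal.ofReal (G z)) x :=
        lintegral_sub_right_eq_self _ y
    _ = _ := lintegral_indicator measurableSet_ball _

lemma poisson_enorm {n : ℕ} (hn : 0 < n) {R : ℝ} (hR : 0 < R) (d : ℝ)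
    (hμ : μH[d] (sphere (0 : EuclideanSpace ℝ (Fin n)) R) < ⊤)
    {f : EuclideanSpace ℝ (Fin n) → ℂ} (hc : ContinuousOn f (closedBall 0 R))
    (hf : ContDiffOn ℝ 2 f (ball 0 R)) (hl : ∀ x ∈ ball 0 R, laplacianC n f x = 0)
    (x : EuclideanSpace ℝ (Fin n)) (hx : ‖x‖ < R) :
    ENNReal.ofReal (∫ y in sphere (0 : EuclideanSpace ℝ (Fin n)) R, pois R 0 y ∂(μH[d])) * ‖f x‖ₑ ≤
      ∫⁻ y in sphere 0 R, ENNReal.ofReal (pois R x y) * ‖f y‖ₑ ∂(μH[d]) := by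
  obtain ⟨θ, hθ1, hθ⟩ : ∃ θ : ℂ, ‖θ‖ = 1 ∧ (θ * f x).re = ‖f x‖ := by
    by_cases h0 : f x = 0
    · exact ⟨1, by simp, by simp [h0]⟩
    · have hn0 : (‖f x‖ : ℂ) ≠ 0 := by simpa using h0
      refine ⟨(starRingEnd ℂ) (f x) / ‖f x‖, ?_, ?_⟩
      · simp [h0]
      · rw [div_mul_eq_mul_div, mul_comm, Complex.mul_conj, Complex.normSq_eq_norm_sq]
        push_cast
        rw [sq, mul_div_assoc, div_self hn0, mul_one, Complex.ofReal_re]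
  have hre : ∀ z, (θ * f z).re ≤ ‖f z‖ := fun z => by
    refine (Complex.re_le_norm _).trans ?_
    rw [norm_mul, hθ1, one_mul]
  have hcS : ContinuousOn f (sphere 0 R) := hc.mono sphere_subset_closedBall
  have hcu : ContinuousOn (fun z => (θ * f z).re) (closedBall 0 R) :=
    Complex.continuous_re.comp_continuousOn (continuousOn_const.mul hc)
  have h1 := poisson_repr hn hR d hμ hcu (fun z hz => lineHarm_re hf hl θ hz) x hx
  rw [hθ] at h1
  have i1 := pois_int μH[d] hμ (hcu.mono sphere_subset_closedBall) hx
  have i2 := pois_int μH[d] hμ hcS.norm hx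
  have h2 : ∫ y in sphere 0 R, pois R x y * (θ * f y).re ∂(μH[d]) ≤
      ∫ y in sphere 0 R, pois R x y * ‖f y‖ ∂(μH[d]) :=
    integral_mono i1 i2 fun y => mul_le_mul_of_nonneg_left (hre y) (pois_nonneg hx.le y)
  have h3 := ENNReal.ofReal_le_ofReal (h1.trans h2)
  have hc0 : 0 ≤ ∫ y in sphere (0 : EuclideanSpace ℝ (Fin n)) R, pois R 0 y ∂(μH[d]) :=
    integral_nonneg fun y => pois_nonneg (by simpa using hR.le) y
  rw [ENNReal.ofReal_mul hc0, ofReal_norm, ofReal_integral_eq_lintegral_ofReal i2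
    (Filter.Eventually.of_forall fun y => mul_nonneg (pois_nonneg hx.le y) (norm_nonneg _))] at h3
  refine h3.trans (le_of_eq (lintegral_congr fun y => ?_))
  rw [ENNReal.ofReal_mul (pois_nonneg hx.le y), ofReal_norm]

lemma pois_meas {n : ℕ} {R : ℝ} :
    Measurable (fun z : EuclideanSpace ℝ (Fin n) × EuclideanSpace ℝ (Fin n) => pois R z.1 z.2) := by
  unfold pois
  fun_prop

lemma main_ge {n : ℕ} (hn : 0 < n) {R : ℝ} (hR : 0 < R) (d : ℝ)
    (hμ : μH[d] (sphere (0 : EuclideanSpace ℝ (Fin n)) R) < ⊤)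
    (hμ0 : 0 < μH[d] (sphere (0 : EuclideanSpace ℝ (Fin n)) R))
    {p q : ℝ} (hp : 1 ≤ p) (hpq : p ≤ q) (hqp : q * ((n : ℝ) - 1) < n * p) :
    ∃ D : ENNReal, D < ⊤ ∧ ∀ f : EuclideanSpace ℝ (Fin n) → ℂ, ContinuousOn f (closedBall 0 R) →
      ContDiffOn ℝ 2 f (ball 0 R) → (∀ x ∈ ball 0 R, laplacianC n f x = 0) →
      ∫⁻ x in ball 0 R, ‖f x‖ₑ ^ q ≤ D * (∫⁻ y in sphere 0 R, ‖f y‖ₑ ^ p ∂(μH[d])) ^ (q / p) := by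
  have hp0 : 0 < p := by linarith
  set s := q / p with hsdef
  have hs : 1 ≤ s := by rw [hsdef, le_div_iff₀ hp0]; linarith
  have hs0 : 0 < s := by linarith
  have hsn : s * ((n : ℝ) - 1) < n := by
    rw [hsdef, div_mul_eq_mul_div, div_lt_iff₀ hp0]; exact hqp
  obtain ⟨C, hC, hCb⟩ := kernel_bound hn hR hs hsn
  set cr := ∫ y in sphere (0 : EuclideanSpace ℝ (Fin n)) R, pois R 0 y ∂(μH[d]) with hcr
  have hcpos : 0 < cr := by
    have : cr = ∫ y in sphere (0 : EuclideanSpace ℝ (Fin n)) R, R ^ 2 * (R ^ 2) ^ (-(n:ℝ) / 2) ∂(μH[d]) := by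
      refine setIntegral_congr_fun isClosed_sphere.measurableSet fun y hy => ?_
      have : ‖y‖ = R := by simpa using hy
      simp [pois, this]
    rw [this, setIntegral_const, smul_eq_mul]
    have : 0 < μH[d].real (sphere (0 : EuclideanSpace ℝ (Fin n)) R) :=
      ENNReal.toReal_pos hμ0.ne' hμ.ne
    positivity
  set c := ENNReal.ofReal cr with hcdef
  have hc0 : c ≠ 0 := by simpa [hcdef] using hcpos
  have hct : c ≠ ⊤ := ENNReal.ofReal_ne_top
  have hcq0 : c ^ q ≠ 0 := by simp [ENNReal.rpow_eq_zero_iff, hc0, hct]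
  have hcqt : c ^ q ≠ ⊤ := by simp [ENNReal.rpow_eq_top_iff, hc0, hct]
  refine ⟨(c ^ q)⁻¹ * ((c ^ (p - 1)) ^ s * C), ?_, fun f hfc hf hl => ?_⟩
  · refine ENNReal.mul_lt_top (ENNReal.inv_lt_top.2 (pos_iff_ne_zero.2 hcq0))
      (ENNReal.mul_lt_top ?_ hC)
    refine ENNReal.rpow_lt_top_of_nonneg hs0.le ?_
    exact (ENNReal.rpow_lt_top_of_nonneg (by linarith) hct).ne
  set ν := μH[d].restrict (sphere (0 : EuclideanSpace ℝ (Fin n)) R) with hν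
  have : IsFiniteMeasure ν := ⟨by simpa [hν] using hμ⟩
  set J := ∫⁻ y, ‖f y‖ₑ ^ p ∂ν with hJ
  have hfm : AEMeasurable (fun y => ‖f y‖ₑ) ν :=
    ((hfc.mono sphere_subset_closedBall).aemeasurable isClosed_sphere.measurableSet).enorm
  have hPm : ∀ x, Measurable (fun y : EuclideanSpace ℝ (Fin n) => ENNReal.ofReal (pois R x y)) :=
    fun x => (pois_meas.comp (measurable_const.prodMk measurable_id)).ennreal_ofReal
  have hpt : ∀ x ∈ ball (0 : EuclideanSpace ℝ (Fin n)) R, c ^ q * ‖f x‖ₑ ^ q ≤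
      (c ^ (p - 1)) ^ s * (J ^ (s - 1) * ∫⁻ y, ‖f y‖ₑ ^ p * ENNReal.ofReal (pois R x y) ^ s ∂ν) := by
    intro x hx
    have hx' : ‖x‖ < R := by simpa using hx
    have h1 := poisson_enorm hn hR d hμ hfc hf hl x hx'
    have h2 := ENNReal.rpow_le_rpow h1 hp0.le
    have h3 := jensen_weight (μ := ν) hfm (hPm x).aemeasurable hp
    have hPc : ∫⁻ y, ENNReal.ofReal (pois R x y) ∂ν = c := by
      rw [hcdef, hcr, ← pois_const hn d hμ x hx', ofReal_integral_eq_lintegral_ofReal]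
      · have := pois_int μH[d] hμ (continuousOn_const (c := (1:ℝ))) hx'
        simp only [mul_one] at this
        exact this
      · exact Filter.Eventually.of_forall fun y => pois_nonneg hx'.le y
    rw [hPc] at h3
    have h4 := ENNReal.rpow_le_rpow (h2.trans h3) hs0.le
    have e : p * s = q := by rw [hsdef]; field_simp
    rw [← ENNReal.rpow_mul, e, ENNReal.mul_rpow_of_nonneg _ _ (by linarith),
      ENNReal.mul_rpow_of_nonneg _ _ hs0.le] at h4
    have h5 := jensen_weight (μ := ν) (hPm x).aemeasurable (hfm.pow_const p) hs
    have h6 : ∫⁻ y, ENNReal.ofReal (pois R x y) * ‖f y‖ₑ ^ p ∂ν =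
      ∫⁻ y, ‖f y‖ₑ ^ p * ENNReal.ofReal (pois R x y) ∂ν := lintegral_congr fun y => mul_comm _ _
    rw [h6] at h4
    refine h4.trans ?_
    rw [mul_comm]
    gcongr
    rw [mul_comm]
    exact h5
  have hswap : ∫⁻ x in ball 0 R, ∫⁻ y, ‖f y‖ₑ ^ p * ENNReal.ofReal (pois R x y) ^ s ∂ν =
      ∫⁻ y, (∫⁻ x in ball 0 R, ‖f y‖ₑ ^ p * ENNReal.ofReal (pois R x y) ^ s) ∂ν := by
    refine lintegral_lintegral_swap ?_
    refine AEMeasurable.mul ?_ ?_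
    · exact (hfm.pow_const p).comp_snd
    · exact (pois_meas.ennreal_ofReal.pow_const s).aemeasurable
  have hin : ∫⁻ y, (∫⁻ x in ball 0 R, ‖f y‖ₑ ^ p * ENNReal.ofReal (pois R x y) ^ s) ∂ν ≤ C * J := by
    rw [hJ, ← lintegral_const_mul' _ _ hC.ne]
    refine setLIntegral_mono' isClosed_sphere.measurableSet fun y hy => ?_
    have hm : Measurable (fun x : EuclideanSpace ℝ (Fin n) => ENNReal.ofReal (pois R x y) ^ s) :=
      (pois_meas.comp (measurable_id.prodMk measurable_const)).ennreal_ofReal.pow_const s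
    rw [lintegral_const_mul _ hm, mul_comm]
    gcongr
    exact hCb y (by simpa using hy)
  have hJt : J ≠ ⊤ := by
    have i : IntegrableOn (fun y => ‖f y‖ ^ p) (sphere 0 R) μH[d] :=
      ContinuousOn.integrableOn_of_subset_isCompact (K := sphere 0 R)
        ((hfc.mono sphere_subset_closedBall).norm.rpow_const fun _ _ => Or.inr hp0.le)
        (isCompact_sphere _ _) isClosed_sphere.measurableSet subset_rfl hμ.ne
    have := i.setLIntegral_lt_top.ne
    convert this using 2
    ext y
    rw [← ENNReal.ofReal_rpow_of_nonneg (norm_nonneg _) hp0.le, ofReal_norm]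
  have hJs : J ^ (s - 1) * J = J ^ s := by
    by_cases hJ0 : J = 0
    · rw [hJ0, mul_zero, ENNReal.zero_rpow_of_pos hs0]
    · conv_lhs => rw [← ENNReal.rpow_one J]
      rw [← ENNReal.rpow_mul, one_mul, ← ENNReal.rpow_add _ _ hJ0 hJt]
      congr 1; ring
  have hall : c ^ q * ∫⁻ x in ball 0 R, ‖f x‖ₑ ^ q ≤ (c ^ (p - 1)) ^ s * C * J ^ s := by
    rw [← lintegral_const_mul' _ _ hcqt]
    refine (setLIntegral_mono' measurableSet_ball hpt).trans ?_
    have t1 : (c ^ (p - 1)) ^ s ≠ ⊤ := (ENNReal.rpow_lt_top_of_nonneg hs0.le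
      (ENNReal.rpow_lt_top_of_nonneg (by linarith) hct).ne).ne
    have t2 : J ^ (s - 1) ≠ ⊤ := (ENNReal.rpow_lt_top_of_nonneg (by linarith) hJt).ne
    rw [lintegral_const_mul' _ _ t1, lintegral_const_mul' _ _ t2, hswap, ← hJs]
    calc _ ≤ (c ^ (p - 1)) ^ s * (J ^ (s - 1) * (C * J)) := by gcongr
      _ = _ := by ring
  rw [mul_assoc (c ^ q)⁻¹]
  rw [← ENNReal.inv_mul_le_iff, inv_inv]
  · exact hall
  · exact ENNReal.inv_ne_zero.2 hcqt
  · exact ENNReal.inv_ne_top.2 hcq0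

lemma main_all {n : ℕ} (hn : 0 < n) {R : ℝ} (hR : 0 < R) (d : ℝ)
    (hμ : μH[d] (sphere (0 : EuclideanSpace ℝ (Fin n)) R) < ⊤)
    (hμ0 : 0 < μH[d] (sphere (0 : EuclideanSpace ℝ (Fin n)) R))
    {p q : ℝ} (hp : 1 ≤ p) (hq : 1 ≤ q) (hqp : q * ((n : ℝ) - 1) < n * p) :
    ∃ D : ENNReal, D < ⊤ ∧ ∀ f : EuclideanSpace ℝ (Fin n) → ℂ, ContinuousOn f (closedBall 0 R) →
      ContDiffOn ℝ 2 f (ball 0 R) → (∀ x ∈ ball 0 R, laplacianC n f x = 0) →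
      ∫⁻ x in ball 0 R, ‖f x‖ₑ ^ q ≤ D * (∫⁻ y in sphere 0 R, ‖f y‖ₑ ^ p ∂(μH[d])) ^ (q / p) := by
  rcases le_total p q with hpq | hpq
  · exact main_ge hn hR d hμ hμ0 hp hpq hqp
  have hp0 : 0 < p := by linarith
  have hq0 : 0 < q := by linarith
  obtain ⟨D, hD, hDf⟩ := main_ge hn hR d hμ hμ0 hp le_rfl (by nlinarith)
  have hV : volume (ball (0 : EuclideanSpace ℝ (Fin n)) R) ≠ ⊤ := measure_ball_lt_top.ne
  have hpq1 : 1 ≤ p / q := by rw [le_div_iff₀ hq0]; linarith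
  refine ⟨(D * volume (ball (0 : EuclideanSpace ℝ (Fin n)) R) ^ (p / q - 1)) ^ (q / p), ?_,
    fun f hfc hf hl => ?_⟩
  · refine ENNReal.rpow_lt_top_of_nonneg (by positivity) (ENNReal.mul_lt_top hD ?_).ne
    exact ENNReal.rpow_lt_top_of_nonneg (by linarith) hV
  have h1 := hDf f hfc hf hl
  rw [div_self hp0.ne', ENNReal.rpow_one] at h1
  have hfm : AEMeasurable (fun y => ‖f y‖ₑ) (volume.restrict (ball 0 R)) :=
    ((hfc.mono ball_subset_closedBall).aemeasurable measurableSet_ball).enorm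
  have h2 := jensen_weight (hfm.pow_const q) (aemeasurable_const (b := (1 : ENNReal))) hpq1
  simp only [one_mul, lintegral_one, Measure.restrict_apply_univ, ← ENNReal.rpow_mul] at h2
  have e : q * (p / q) = p := by field_simp
  rw [e] at h2
  have h3 := ENNReal.rpow_le_rpow (h2.trans (mul_le_mul_left h1 _)) (z := q / p) (by positivity)
  have e2 : p / q * (q / p) = 1 := by field_simp
  rw [← ENNReal.rpow_mul, e2, ENNReal.rpow_one] at h3
  refine h3.trans (le_of_eq ?_)
  rw [← ENNReal.mul_rpow_of_nonneg _ _ (by positivity)]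
  congr 1
  ring

lemma main_real {n : ℕ} (hn : 0 < n) {R : ℝ} (hR : 0 < R) (d : ℝ)
    (hμ : μH[d] (sphere (0 : EuclideanSpace ℝ (Fin n)) R) < ⊤)
    (hμ0 : 0 < μH[d] (sphere (0 : EuclideanSpace ℝ (Fin n)) R))
    {p q : ℝ} (hp : 1 ≤ p) (hq : 1 ≤ q) (hqp : q * ((n : ℝ) - 1) < n * p) :
    ∃ δ > (0 : ℝ), ∀ f : EuclideanSpace ℝ (Fin n) → ℂ, ContinuousOn f (closedBall 0 R) →
      ContDiffOn ℝ 2 f (ball 0 R) → (∀ x ∈ ball 0 R, laplacianC n f x = 0) →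
      δ * (∫ x in ball 0 R, ‖f x‖ ^ q) ^ (1 / q)
        ≤ (∫ x in sphere 0 R, ‖f x‖ ^ p ∂(μH[d])) ^ (1 / p) := by
  have hp0 : 0 < p := by linarith
  have hq0 : 0 < q := by linarith
  obtain ⟨D, hD, hDf⟩ := main_all hn hR d hμ hμ0 hp hq hqp
  set T := D.toReal ^ (1 / q) with hT
  have hT0 : 0 ≤ T := by positivity
  refine ⟨1 / (T + 1), by positivity, fun f hfc hf hl => ?_⟩
  have h := hDf f hfc hf hl
  have conv : ∀ (μ : Measure (EuclideanSpace ℝ (Fin n))) (a : ℝ), 0 < a →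
      Integrable (fun x => ‖f x‖ ^ a) μ →
      ∫⁻ x, ‖f x‖ₑ ^ a ∂μ = ENNReal.ofReal (∫ x, ‖f x‖ ^ a ∂μ) := by
    intro μ a ha hi
    rw [ofReal_integral_eq_lintegral_ofReal hi
      (Filter.Eventually.of_forall fun y => by positivity)]
    refine lintegral_congr fun y => ?_
    rw [← ENNReal.ofReal_rpow_of_nonneg (norm_nonneg _) ha.le, ofReal_norm]
  have i1 : IntegrableOn (fun y => ‖f y‖ ^ p) (sphere 0 R) μH[d] :=
    ContinuousOn.integrableOn_of_subset_isCompact (K := sphere 0 R)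
      ((hfc.mono sphere_subset_closedBall).norm.rpow_const fun _ _ => Or.inr hp0.le)
      (isCompact_sphere _ _) isClosed_sphere.measurableSet subset_rfl hμ.ne
  have i2 : IntegrableOn (fun y => ‖f y‖ ^ q) (ball 0 R) volume :=
    ContinuousOn.integrableOn_of_subset_isCompact (K := closedBall 0 R)
      (hfc.norm.rpow_const fun _ _ => Or.inr hq0.le)
      (isCompact_closedBall _ _) measurableSet_ball ball_subset_closedBall measure_ball_lt_top.ne
  rw [conv _ _ hq0 i2, conv _ _ hp0 i1, ← ENNReal.ofReal_toReal hD.ne] at h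
  have hI0 : 0 ≤ ∫ x in ball 0 R, ‖f x‖ ^ q := integral_nonneg fun y => by positivity
  have hJ0 : 0 ≤ ∫ x in sphere 0 R, ‖f x‖ ^ p ∂(μH[d]) := integral_nonneg fun y => by positivity
  set I := ∫ x in ball 0 R, ‖f x‖ ^ q
  set J := ∫ x in sphere 0 R, ‖f x‖ ^ p ∂(μH[d])
  rw [ENNReal.ofReal_rpow_of_nonneg hJ0 (by positivity), ← ENNReal.ofReal_mul (by positivity),
    ENNReal.ofReal_le_ofReal_iff (by positivity)] at h
  have h2 := Real.rpow_le_rpow hI0 h (z := 1 / q) (by positivity)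
  rw [Real.mul_rpow (by positivity) (by positivity), ← Real.rpow_mul hJ0] at h2
  have e : q / p * (1 / q) = 1 / p := by field_simp
  rw [e] at h2
  rw [one_div_mul_eq_div, div_le_iff₀ (by positivity)]
  have : 0 ≤ J ^ (1 / p) := by positivity
  nlinarith

theorem harmonic_boundary_inequality_ball
    (n : ℕ) (hn : 2 ≤ n) (x₀ : EuclideanSpace ℝ (Fin n)) (R : ℝ) (hR : 0 < R)
    (p q : ℝ) (hp : 1 ≤ p) (hq : 1 ≤ q) (hqp : q * (n - 1) < n * p) :
    ∃ δ > (0 : ℝ), ∀ f : EuclideanSpace ℝ (Fin n) → ℂ,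
      ContinuousOn f (closure (ball x₀ R)) →
      ContDiffOn ℝ 2 f (ball x₀ R) →
      (∀ x ∈ ball x₀ R, laplacianC n f x = 0) →
      δ * (∫ x in ball x₀ R, ‖f x‖ ^ q) ^ (1 / q)
        ≤ (∫ x in sphere x₀ R, ‖f x‖ ^ p ∂(μH[(n : ℝ) - 1])) ^ (1 / p) := by
  have hfin : 0 < μH[(n : ℝ) - 1] (sphere (0 : EuclideanSpace ℝ (Fin n)) R) ∧
      μH[(n : ℝ) - 1] (sphere (0 : EuclideanSpace ℝ (Fin n)) R) < ⊤ := by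
    obtain ⟨m, rfl⟩ : ∃ m, n = m + 1 := ⟨n - 1, by omega⟩
    have e : ((m + 1 : ℕ) : ℝ) - 1 = m := by push_cast; ring
    rw [e]
    exact ⟨hausdorff_sphere_pos m hR, hausdorff_sphere_lt_top m hR⟩
  obtain ⟨δ, hδ, h⟩ := main_real (by omega) hR _ hfin.2 hfin.1 hp hq hqp
  refine ⟨δ, hδ, fun f hfc hf hl => ?_⟩
  rw [closure_ball x₀ hR.ne'] at hfc
  have hpb : ∀ z, z ∈ ball (0 : EuclideanSpace ℝ (Fin n)) R → z + x₀ ∈ ball x₀ R := by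
    intro z hz
    simpa using hz
  have := h (fun z => f (z + x₀))
    (hfc.comp (by fun_prop) (fun z hz => by simpa using hz))
    (hf.comp (by fun_prop) (fun z hz => hpb z hz))
    (fun z hz => by
      have := hl (z + x₀) (hpb z hz)
      rw [laplacianC] at this ⊢
      rw [← this]
      refine Finset.sum_congr rfl fun i _ => ?_
      simp only [fderiv_comp_add_right]
      rw [fderiv_comp_add_right (f := fun y => fderiv ℝ f y (EuclideanSpace.single i 1))])
  have e1 : ∫ x in ball 0 R, ‖f (x + x₀)‖ ^ q = ∫ x in ball x₀ R, ‖f x‖ ^ q := by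
    have hmp := measurePreserving_add_right (volume : Measure (EuclideanSpace ℝ (Fin n))) x₀
    have := hmp.setIntegral_preimage_emb (measurableEmbedding_addRight x₀)
      (fun y => ‖f y‖ ^ q) (ball x₀ R)
    rw [← this]
    congr 2
    ext z; simp
  have e2 : ∫ x in sphere 0 R, ‖f (x + x₀)‖ ^ p ∂(μH[(n : ℝ) - 1]) =
      ∫ x in sphere x₀ R, ‖f x‖ ^ p ∂(μH[(n : ℝ) - 1]) := by
    have hmp := (IsometryEquiv.addRight x₀).measurePreserving_hausdorffMeasure ((n : ℝ) - 1)
    have := hmp.setIntegral_preimage_emb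
      (IsometryEquiv.addRight x₀).toHomeomorph.measurableEmbedding
      (fun y => ‖f y‖ ^ p) (sphere x₀ R)
    rw [← this]
    congr 2
    ext z; simp
  rw [e1, e2] at this
  exact this
end
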